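/- The leading coefficients κ_n of the orthonormal polynomials φ_n for the weight W satisfy κ_{n−1}² = (1/G[2πw]) · (1 − (1/n) Σ_{k=1}^m β_k² + O(1/n²)) as n → ∞. -/

import Mathlib

open scoped Real
open Filter MeasureTheory Metric Set Polynomial
open scoped Topology

/-- The character `θ ↦ exp (i j θ)`. -/
noncomputable def circExp (j : ℤ) (θ : ℝ) : ℂ := Complex.exp (j * θ * Complex.I)

lemma circExp_add (j k : ℤ) (θ : ℝ) : circExp (j + k) θ = circExp j θ * circExp k θ := by
  simp only [circExp, ← Complex.exp_add]; congr 1; push_cast; ring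

lemma circExp_zero (θ : ℝ) : circExp 0 θ = 1 := by simp [circExp]

lemma circExp_one (θ : ℝ) : circExp 1 θ = Complex.exp (θ * Complex.I) := by simp [circExp]

lemma circExp_conj (j : ℤ) (θ : ℝ) : (starRingEnd ℂ) (circExp j θ) = circExp (-j) θ := by
  simp only [circExp, ← Complex.exp_conj]; congr 1; simp

lemma norm_circExp (j : ℤ) (θ : ℝ) : ‖circExp j θ‖ = 1 := by
  have : (j * θ * Complex.I : ℂ) = ((j * θ : ℝ) : ℂ) * Complex.I := by push_cast; ring
  rw [circExp, this, Complex.norm_exp_ofReal_mul_I]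

lemma circExp_ne_zero (j : ℤ) (θ : ℝ) : circExp j θ ≠ 0 := Complex.exp_ne_zero _

lemma circExp_natCast (n : ℕ) (θ : ℝ) : circExp n θ = circExp 1 θ ^ n := by
  simp only [circExp, ← Complex.exp_nat_mul]; congr 1; push_cast; ring

lemma circExp_neg_mul (j : ℤ) (θ : ℝ) : circExp (-j) θ * circExp j θ = 1 := by
  rw [← circExp_add]; simp [circExp_zero]

lemma circExp_eq_zpow (j : ℤ) (θ : ℝ) : circExp j θ = circExp 1 θ ^ j := by
  simp only [circExp, ← Complex.exp_int_mul]; congr 1; push_cast; ring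

@[fun_prop]
lemma continuous_circExp (j : ℤ) : Continuous (circExp j) := by
  unfold circExp; fun_prop

/-- Restriction of a polynomial to the unit circle, as a function of the angle. -/
noncomputable def onCirc (P : ℂ[X]) (θ : ℝ) : ℂ := P.eval (circExp 1 θ)

@[fun_prop]
lemma continuous_onCirc (P : ℂ[X]) : Continuous (onCirc P) := by
  unfold onCirc; exact P.continuous.comp (continuous_circExp 1)

lemma onCirc_add (P Q : ℂ[X]) (θ : ℝ) : onCirc (P + Q) θ = onCirc P θ + onCirc Q θ := by
  simp [onCirc]
lemma onCirc_sub (P Q : ℂ[X]) (θ : ℝ) : onCirc (P - Q) θ = onCirc P θ - onCirc Q θ := by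
  simp [onCirc]
lemma onCirc_mul (P Q : ℂ[X]) (θ : ℝ) : onCirc (P * Q) θ = onCirc P θ * onCirc Q θ := by
  simp [onCirc]
lemma onCirc_C (c : ℂ) (θ : ℝ) : onCirc (C c) θ = c := by simp [onCirc]
lemma onCirc_X_pow (k : ℕ) (θ : ℝ) : onCirc (X ^ k) θ = circExp k θ := by
  simp [onCirc, circExp_natCast]
lemma onCirc_X (θ : ℝ) : onCirc X θ = circExp 1 θ := by simp [onCirc]
lemma onCirc_zero (θ : ℝ) : onCirc 0 θ = 0 := by simp [onCirc]
lemma onCirc_one (θ : ℝ) : onCirc 1 θ = 1 := by simp [onCirc]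

lemma onCirc_eq_sum {P : ℂ[X]} {N : ℕ} (h : P.natDegree < N) (θ : ℝ) :
    onCirc P θ = ∑ i ∈ Finset.range N, P.coeff i * circExp i θ := by
  rw [onCirc, P.eval_eq_sum_range' h]
  simp [circExp_natCast]

/-- The reversed conjugate polynomial of formal degree `n`. -/
noncomputable def starPoly (n : ℕ) (P : ℂ[X]) : ℂ[X] :=
  Polynomial.reflect n (P.map (starRingEnd ℂ))

lemma starPoly_coeff {n i : ℕ} (P : ℂ[X]) (hi : i ≤ n) :
    (starPoly n P).coeff i = (starRingEnd ℂ) (P.coeff (n - i)) := by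
  simp [starPoly, coeff_reflect, revAt_le hi]

lemma starPoly_coeff_of_lt {n i : ℕ} {P : ℂ[X]} (hP : P.natDegree ≤ n) (hi : n < i) :
    (starPoly n P).coeff i = 0 := by
  rw [starPoly, coeff_reflect, revAt_eq_self_of_lt hi, coeff_map,
    coeff_eq_zero_of_natDegree_lt (by omega), map_zero]

lemma natDegree_starPoly_le {n : ℕ} {P : ℂ[X]} (hP : P.natDegree ≤ n) :
    (starPoly n P).natDegree ≤ n :=
  natDegree_le_iff_coeff_eq_zero.2 fun _ hi => starPoly_coeff_of_lt hP hi

lemma onCirc_starPoly {n : ℕ} {P : ℂ[X]} (hP : P.natDegree ≤ n) (θ : ℝ) :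
    onCirc (starPoly n P) θ = circExp n θ * (starRingEnd ℂ) (onCirc P θ) := by
  rw [onCirc_eq_sum (Nat.lt_succ_of_le (natDegree_starPoly_le hP)),
    onCirc_eq_sum (Nat.lt_succ_of_le hP), map_sum, Finset.mul_sum,
    ← Finset.sum_range_reflect]
  refine Finset.sum_congr rfl fun i hi => ?_
  have hi' : i ≤ n := by simpa [Nat.lt_succ_iff] using hi
  rw [starPoly_coeff P (by omega), map_mul, circExp_conj]
  have h1 : n - (n + 1 - 1 - i) = i := by omega
  have h2 : ((n + 1 - 1 - i : ℕ) : ℤ) = n + -(i : ℤ) := by omega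
  rw [Nat.succ_eq_add_one, h1, h2, circExp_add]; ring

/-- The sesquilinear form of `L²(μ)`. -/
noncomputable def wInner (μ : Measure ℝ) (f g : ℝ → ℂ) : ℂ := ∫ θ, f θ * (starRingEnd ℂ) (g θ) ∂μ

/-- The `L²(μ)` norm. -/
noncomputable def wNorm (μ : Measure ℝ) (f : ℝ → ℂ) : ℝ := √(∫ θ, ‖f θ‖ ^ 2 ∂μ)

/-- Every continuous function is integrable. -/
def ContInt (μ : Measure ℝ) : Prop := ∀ f : ℝ → ℂ, Continuous f → Integrable f μ

@[fun_prop]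
lemma continuous_conj' {f : ℝ → ℂ} (hf : Continuous f) :
    Continuous fun θ => (starRingEnd ℂ) (f θ) := Complex.continuous_conj.comp hf


section WInner

variable {μ : Measure ℝ}

lemma wInner_add_left (hμ : ContInt μ) {f g h : ℝ → ℂ} (hf : Continuous f) (hg : Continuous g)
    (hh : Continuous h) :
    wInner μ (fun θ => f θ + g θ) h = wInner μ f h + wInner μ g h := by
  simp only [wInner, add_mul]
  exact integral_add (hμ _ (by fun_prop)) (hμ _ (by fun_prop))

lemma wInner_sub_left (hμ : ContInt μ) {f g h : ℝ → ℂ} (hf : Continuous f) (hg : Continuous g)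
    (hh : Continuous h) :
    wInner μ (fun θ => f θ - g θ) h = wInner μ f h - wInner μ g h := by
  simp only [wInner, sub_mul]
  exact integral_sub (hμ _ (by fun_prop)) (hμ _ (by fun_prop))

lemma wInner_smul_left (c : ℂ) (f h : ℝ → ℂ) :
    wInner μ (fun θ => c * f θ) h = c * wInner μ f h := by
  simp only [wInner, mul_assoc]
  exact integral_const_mul _ _

lemma wInner_conj (f g : ℝ → ℂ) : (starRingEnd ℂ) (wInner μ f g) = wInner μ g f := by
  simp only [wInner]
  rw [← integral_conj]
  congr 1; ext θ; simp [mul_comm]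

lemma wInner_sum_left (hμ : ContInt μ) {ι : Type*} (s : Finset ι) {f : ι → ℝ → ℂ} {h : ℝ → ℂ}
    (hf : ∀ i ∈ s, Continuous (f i)) (hh : Continuous h) :
    wInner μ (fun θ => ∑ i ∈ s, f i θ) h = ∑ i ∈ s, wInner μ (f i) h := by
  simp only [wInner, Finset.sum_mul]
  exact integral_finsetSum _ fun i hi => hμ _ (by have := hf i hi; fun_prop)

lemma wInner_add_right (hμ : ContInt μ) {f g h : ℝ → ℂ} (hf : Continuous f) (hg : Continuous g)
    (hh : Continuous h) :
    wInner μ h (fun θ => f θ + g θ) = wInner μ h f + wInner μ h g := by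
  rw [← wInner_conj, wInner_add_left hμ hf hg hh, map_add, wInner_conj, wInner_conj]

lemma wInner_smul_right (c : ℂ) (f h : ℝ → ℂ) :
    wInner μ h (fun θ => c * f θ) = (starRingEnd ℂ) c * wInner μ h f := by
  rw [← wInner_conj, wInner_smul_left, map_mul, wInner_conj]

lemma wInner_sum_right (hμ : ContInt μ) {ι : Type*} (s : Finset ι) {f : ι → ℝ → ℂ} {h : ℝ → ℂ}
    (hf : ∀ i ∈ s, Continuous (f i)) (hh : Continuous h) :
    wInner μ h (fun θ => ∑ i ∈ s, f i θ) = ∑ i ∈ s, wInner μ h (f i) := by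
  rw [← wInner_conj, wInner_sum_left hμ s hf hh, map_sum]
  exact Finset.sum_congr rfl fun _ _ => wInner_conj _ _

lemma wInner_self (f : ℝ → ℂ) : wInner μ f f = ((wNorm μ f ^ 2 : ℝ) : ℂ) := by
  rw [wNorm, Real.sq_sqrt (integral_nonneg fun _ => by positivity), wInner, ← integral_complex_ofReal]
  congr 1; ext θ; rw [Complex.mul_conj, Complex.normSq_eq_norm_sq]

lemma wNorm_nonneg (f : ℝ → ℂ) : 0 ≤ wNorm μ f := Real.sqrt_nonneg _

lemma wNorm_sq (f : ℝ → ℂ) : wNorm μ f ^ 2 = ∫ θ, ‖f θ‖ ^ 2 ∂μ :=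
  Real.sq_sqrt (integral_nonneg fun _ => by positivity)

lemma ContInt.real (hμ : ContInt μ) {f : ℝ → ℝ} (hf : Continuous f) : Integrable f μ := by
  have := (hμ (fun θ => (f θ : ℂ)) (by fun_prop)).re
  simpa using this

lemma ContInt.integral_norm_mul_le (hμ : ContInt μ) {f g : ℝ → ℂ} (hf : Continuous f)
    (hg : Continuous g) : ∫ θ, ‖f θ‖ * ‖g θ‖ ∂μ ≤ wNorm μ f * wNorm μ g := by
  have key : ∀ f : ℝ → ℂ, Continuous f → MemLp f (ENNReal.ofReal 2) μ := by
    intro f hf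
    have h2 : ENNReal.ofReal 2 = 2 := by simp
    rw [h2, memLp_two_iff_integrable_sq_norm (hμ f hf).1]
    exact hμ.real (by fun_prop)
  have := integral_mul_norm_le_Lp_mul_Lq (μ := μ) Real.HolderConjugate.two_two (key f hf) (key g hg)
  simpa [wNorm, Real.sqrt_eq_rpow] using this

lemma norm_wInner_le (hμ : ContInt μ) {f g : ℝ → ℂ} (hf : Continuous f)
    (hg : Continuous g) : ‖wInner μ f g‖ ≤ wNorm μ f * wNorm μ g := by
  refine (norm_integral_le_integral_norm _).trans ?_
  simpa using hμ.integral_norm_mul_le hf hg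

lemma wNorm_add_le (hμ : ContInt μ) {f g : ℝ → ℂ} (hf : Continuous f)
    (hg : Continuous g) : wNorm μ (fun θ => f θ + g θ) ≤ wNorm μ f + wNorm μ g := by
  refine abs_le_of_sq_le_sq' ?_ (add_nonneg (wNorm_nonneg _) (wNorm_nonneg _)) |>.2
  have h1 := hμ.integral_norm_mul_le hf hg
  have h2 : ∫ θ, ‖f θ + g θ‖ ^ 2 ∂μ ≤
      ∫ θ, (‖f θ‖ ^ 2 + 2 * (‖f θ‖ * ‖g θ‖) + ‖g θ‖ ^ 2) ∂μ := by
    refine integral_mono (hμ.real (by fun_prop)) (hμ.real (by fun_prop)) fun θ => ?_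
    have := norm_add_le (f θ) (g θ)
    have h0 := norm_nonneg (f θ + g θ)
    simp only
    nlinarith
  rw [integral_add (hμ.real (by fun_prop)) (hμ.real (by fun_prop)),
    integral_add (hμ.real (by fun_prop)) (hμ.real (by fun_prop)), integral_const_mul] at h2
  rw [wNorm_sq]
  nlinarith [wNorm_sq (μ := μ) f, wNorm_sq (μ := μ) g]

lemma wNorm_congr {f g : ℝ → ℂ} (h : ∀ θ, ‖f θ‖ = ‖g θ‖) : wNorm μ f = wNorm μ g := by
  simp [wNorm, h]

lemma wNorm_circExp_mul (k : ℤ) (f : ℝ → ℂ) : wNorm μ (fun θ => circExp k θ * f θ) = wNorm μ f :=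
  wNorm_congr fun θ => by simp [norm_circExp]

lemma wInner_circExp_mul (k : ℤ) (f g : ℝ → ℂ) :
    wInner μ (fun θ => circExp k θ * f θ) (fun θ => circExp k θ * g θ) = wInner μ f g := by
  simp only [wInner]
  congr 1; ext θ
  rw [map_mul, circExp_conj]
  linear_combination (f θ * (starRingEnd ℂ) (g θ)) * circExp_neg_mul k θ

end WInner

/-- `φ` is the sequence of orthonormal polynomials of `μ`, with leading coefficients `κ`. -/
structure IsOPUC (μ : Measure ℝ) (φ : ℕ → ℂ[X]) (κ : ℕ → ℝ) : Prop where
  contInt : ContInt μ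
  pos : ∀ n, 0 < κ n
  deg : ∀ n, (φ n).natDegree = n
  lead : ∀ n, (φ n).coeff n = (κ n : ℂ)
  orth : ∀ n j, wInner μ (onCirc (φ n)) (onCirc (φ j)) = if n = j then 1 else 0

namespace IsOPUC

variable {μ : Measure ℝ} {φ : ℕ → ℂ[X]} {κ : ℕ → ℝ}

lemma natDegree_sub_lt (H : IsOPUC μ φ κ) {P : ℂ[X]} {N : ℕ} (hP : P.natDegree ≤ N) :
    ∀ j, N ≤ j → (P - C (P.coeff N / κ N) * φ N).coeff j = 0 := by
  intro j hj
  have h0 : (κ N : ℂ) ≠ 0 := by exact_mod_cast (H.pos N).ne'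
  rcases hj.eq_or_lt with rfl | hj
  · simp [H.lead, h0]
  · rw [coeff_sub, coeff_C_mul, coeff_eq_zero_of_natDegree_lt (by omega),
      coeff_eq_zero_of_natDegree_lt (p := φ N) (by rw [H.deg]; omega)]; simp

lemma orth_of_coeff (H : IsOPUC μ φ κ) (N : ℕ) : ∀ P : ℂ[X], (∀ j, N ≤ j → P.coeff j = 0) →
    ∀ n, N ≤ n → wInner μ (onCirc (φ n)) (onCirc P) = 0 := by
  have hμ := H.contInt
  induction N with
  | zero =>
    intro P hP n _
    have : P = 0 := by ext j; simpa using hP j (Nat.zero_le j)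
    subst this
    simp [wInner, onCirc]
  | succ N ih =>
    intro P hP n hn
    have hdeg : P.natDegree ≤ N := natDegree_le_iff_coeff_eq_zero.2 fun j hj => hP j hj
    have h1 := ih _ (H.natDegree_sub_lt hdeg) n (by omega)
    have h2 : onCirc P = fun θ => onCirc (P - C (P.coeff N / κ N) * φ N) θ +
        (P.coeff N / κ N) * onCirc (φ N) θ := by
      ext θ; simp [onCirc]
    rw [h2, wInner_add_right hμ (by fun_prop) (by fun_prop) (by fun_prop), h1, wInner_smul_right,
      H.orth, if_neg (by omega)]
    simp

lemma orth_of_lt (H : IsOPUC μ φ κ) {P : ℂ[X]} {n : ℕ} (h : P.natDegree < n) :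
    wInner μ (onCirc (φ n)) (onCirc P) = 0 :=
  H.orth_of_coeff n P (fun j hj => coeff_eq_zero_of_natDegree_lt (by omega)) n le_rfl

/-- Integrals of `φ n` against negative powers vanish. -/
lemma integral_mul_circExp_neg (H : IsOPUC μ φ κ) {j n : ℕ} (h : j < n) :
    ∫ θ, onCirc (φ n) θ * circExp (-j) θ ∂μ = 0 := by
  have := H.orth_of_lt (P := X ^ j) (n := n) (by simpa using h)
  simpa [wInner, onCirc_X_pow, circExp_conj] using this

lemma integral_mul_circExp_neg_mul (H : IsOPUC μ φ κ) {s n : ℕ} (h : s < n) {g : ℂ[X]}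
    (hg : g.natDegree ≤ s) :
    ∫ θ, onCirc (φ n) θ * (circExp (-s) θ * onCirc g θ) ∂μ = 0 := by
  have := H.orth_of_lt (P := starPoly s g) (n := n) ((natDegree_starPoly_le hg).trans_lt h)
  simpa [wInner, onCirc_starPoly hg, circExp_conj] using this

lemma wInner_right_eq (H : IsOPUC μ φ κ) {P : ℂ[X]} {n : ℕ} (h : P.natDegree ≤ n) :
    wInner μ (onCirc (φ n)) (onCirc P) = (starRingEnd ℂ) (P.coeff n) / κ n := by
  have h1 := H.orth_of_coeff n _ (H.natDegree_sub_lt h) n le_rfl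
  have h2 : onCirc P = fun θ => onCirc (P - C (P.coeff n / κ n) * φ n) θ +
        (P.coeff n / κ n) * onCirc (φ n) θ := by
    ext θ; simp [onCirc]
  rw [h2, wInner_add_right H.contInt (by fun_prop) (by fun_prop) (by fun_prop), h1,
    wInner_smul_right, H.orth]
  simp

lemma eq_zero_of_wNorm (H : IsOPUC μ φ κ) {P : ℂ[X]} (h : wNorm μ (onCirc P) = 0) : P = 0 := by
  have h1 := H.wInner_right_eq (le_refl P.natDegree)
  have h2 : ‖wInner μ (onCirc (φ P.natDegree)) (onCirc P)‖ ≤ 0 := by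
    have := norm_wInner_le H.contInt (continuous_onCirc (φ P.natDegree)) (continuous_onCirc P)
    simpa [h] using this
  have h0 : (κ P.natDegree : ℂ) ≠ 0 := by exact_mod_cast (H.pos _).ne'
  rw [norm_le_zero_iff.1 h2] at h1
  have h3 := (div_eq_zero_iff.1 h1.symm).resolve_right h0
  simpa using h3

lemma wNorm_eq_one (H : IsOPUC μ φ κ) (n : ℕ) : wNorm μ (onCirc (φ n)) = 1 := by
  have h := H.orth n n
  rw [wInner_self, if_pos rfl] at h
  have h' : wNorm μ (onCirc (φ n)) ^ 2 = 1 := by exact_mod_cast h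
  nlinarith [wNorm_nonneg (μ := μ) (onCirc (φ n))]

end IsOPUC

namespace IsOPUC

variable {μ : Measure ℝ} {φ : ℕ → ℂ[X]} {κ : ℕ → ℝ}

lemma wInner_star_eq_zero (H : IsOPUC μ φ κ) {n : ℕ} {Q : ℂ[X]} (hQ : Q.natDegree < n) :
    wInner μ (onCirc (starPoly n (φ n))) (fun θ => circExp 1 θ * onCirc Q θ) = 0 := by
  have h := H.integral_mul_circExp_neg_mul (s := n - 1) (n := n) (by omega) (g := Q) (by omega)
  rw [← wInner_conj, ← map_zero (starRingEnd ℂ), ← h]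
  congr 1
  simp only [wInner]
  congr 1; ext θ
  rw [onCirc_starPoly (H.deg n).le, map_mul, Complex.conj_conj, circExp_conj]
  have : (-((n - 1 : ℕ) : ℤ)) = -(n : ℤ) + 1 := by omega
  rw [this, circExp_add]; ring

lemma wInner_star_right (H : IsOPUC μ φ κ) {n : ℕ} {P : ℂ[X]} (h : P.natDegree ≤ n) :
    wInner μ (onCirc (starPoly n (φ n))) (onCirc P) = (starRingEnd ℂ) (P.coeff 0) / κ n := by
  have h1 := H.wInner_right_eq (natDegree_starPoly_le h)
  rw [starPoly_coeff P le_rfl, Nat.sub_self, Complex.conj_conj] at h1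
  have h2 : (starRingEnd ℂ) (P.coeff 0) / κ n = (starRingEnd ℂ) (P.coeff 0 / κ n) := by simp
  rw [h2, ← h1, wInner_conj]
  simp only [wInner]
  congr 1; ext θ
  rw [onCirc_starPoly (H.deg n).le, onCirc_starPoly h]; ring

lemma wNorm_star (H : IsOPUC μ φ κ) (n : ℕ) : wNorm μ (onCirc (starPoly n (φ n))) = 1 := by
  rw [← H.wNorm_eq_one n]
  exact wNorm_congr fun θ => by simp [onCirc_starPoly (H.deg n).le, norm_circExp]

lemma star_coeff_zero (H : IsOPUC μ φ κ) (n : ℕ) : (starPoly n (φ n)).coeff 0 = κ n := by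
  rw [starPoly_coeff _ (Nat.zero_le n)]; simp [H.lead]

/-- The conjugate Verblunsky coefficient. -/
noncomputable def _root_.verb (μ : Measure ℝ) (φ : ℕ → ℂ[X]) (n : ℕ) : ℂ :=
  ∫ θ, circExp (1 - n) θ * onCirc (φ n) θ ^ 2 ∂μ

lemma verb_eq (H : IsOPUC μ φ κ) (n : ℕ) :
    verb μ φ n = wInner μ (onCirc (X * φ n)) (onCirc (starPoly n (φ n))) := by
  simp only [verb, wInner]
  congr 1; ext θ
  rw [onCirc_starPoly (H.deg n).le, map_mul, Complex.conj_conj, circExp_conj, sub_eq_add_neg,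
    circExp_add, onCirc_mul, onCirc_X]; ring

lemma wInner_X_mul (P Q : ℂ[X]) :
    wInner μ (onCirc (X * P)) (fun θ => circExp 1 θ * onCirc Q θ) =
      wInner μ (onCirc P) (onCirc Q) := by
  rw [← wInner_circExp_mul 1 (onCirc P) (onCirc Q)]
  congr 1; ext θ; simp [onCirc_mul, onCirc_X]

lemma recursion (H : IsOPUC μ φ κ) (n : ℕ) :
    X * φ n - C (verb μ φ n) * starPoly n (φ n) = C ((κ n / κ (n + 1) : ℝ) : ℂ) * φ (n + 1) := by
  have hμ := H.contInt
  have k0 : (κ n : ℂ) ≠ 0 := by exact_mod_cast (H.pos n).ne'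
  have k1 : (κ (n + 1) : ℂ) ≠ 0 := by exact_mod_cast (H.pos (n + 1)).ne'
  set ρ : ℂ := ((κ n / κ (n + 1) : ℝ) : ℂ) with hρ
  set R := X * φ n - C (verb μ φ n) * starPoly n (φ n) - C ρ * φ (n + 1) with hR
  have hdeg : R.natDegree ≤ n := by
    refine natDegree_le_iff_coeff_eq_zero.2 fun j hj => ?_
    obtain ⟨i, rfl⟩ : ∃ i, j = i + 1 := ⟨j - 1, by omega⟩
    rw [hR, coeff_sub, coeff_sub, coeff_X_mul, coeff_C_mul, coeff_C_mul,
      starPoly_coeff_of_lt (H.deg n).le (by omega)]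
    rcases (show n ≤ i by omega).eq_or_lt with rfl | hi
    · rw [H.lead, H.lead, hρ]; push_cast; field_simp; simp
    · rw [coeff_eq_zero_of_natDegree_lt (p := φ n) (by rw [H.deg]; omega),
        coeff_eq_zero_of_natDegree_lt (p := φ (n + 1)) (by rw [H.deg]; omega)]; simp
  have hRf : onCirc R = fun θ => (onCirc (X * φ n) θ -
      verb μ φ n * onCirc (starPoly n (φ n)) θ) - ρ * onCirc (φ (n + 1)) θ := by
    ext θ; simp [hR, onCirc]
  have expand : ∀ g : ℝ → ℂ, Continuous g → wInner μ (onCirc R) g = wInner μ (onCirc (X * φ n)) g -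
      verb μ φ n * wInner μ (onCirc (starPoly n (φ n))) g -
        ρ * wInner μ (onCirc (φ (n + 1))) g := by
    intro g hg
    rw [hRf, wInner_sub_left hμ (by fun_prop) (by fun_prop) hg,
      wInner_sub_left hμ (by fun_prop) (by fun_prop) hg, wInner_smul_left, wInner_smul_left]
  have hstar : wInner μ (onCirc R) (onCirc (starPoly n (φ n))) = 0 := by
    rw [expand _ (by fun_prop), ← H.verb_eq, wInner_self, H.wNorm_star,
      H.orth_of_lt ((natDegree_starPoly_le (H.deg n).le).trans_lt (Nat.lt_succ_self n))]
    simp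
  have hX : ∀ Q : ℂ[X], Q.natDegree < n →
      wInner μ (onCirc R) (fun θ => circExp 1 θ * onCirc Q θ) = 0 := by
    intro Q hQ
    rw [expand _ (by fun_prop), wInner_X_mul, H.orth_of_lt hQ, H.wInner_star_eq_zero hQ]
    have : (fun θ => circExp 1 θ * onCirc Q θ) = onCirc (X * Q) := by
      ext θ; simp [onCirc_mul, onCirc_X]
    rw [this, H.orth_of_lt (by
      refine natDegree_mul_le.trans_lt ?_
      have := natDegree_X_le (R := ℂ); omega)]
    simp
  have hRR : wInner μ (onCirc R) (onCirc R) = 0 := by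
    set c : ℂ := R.coeff 0 / κ n with hc
    set S := R - C c * starPoly n (φ n) with hS
    have hS0 : S.coeff 0 = 0 := by
      rw [hS, coeff_sub, coeff_C_mul, H.star_coeff_zero, hc]; field_simp; simp
    have hSdeg : S.natDegree ≤ n := by
      refine (natDegree_sub_le _ _).trans (max_le hdeg ?_)
      exact (natDegree_C_mul_le _ _).trans (natDegree_starPoly_le (H.deg n).le)
    have hSX : S = X * S.divX := by
      have := S.divX_mul_X_add
      rw [hS0, C_0, add_zero] at this
      rw [mul_comm]; exact this.symm
    have h2 : onCirc R = fun θ => circExp 1 θ * onCirc S.divX θ +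
        c * onCirc (starPoly n (φ n)) θ := by
      ext θ
      have : R = X * S.divX + C c * starPoly n (φ n) := by rw [← hSX, hS]; ring
      conv_lhs => rw [this]
      simp [onCirc]
    have h3 : wInner μ (onCirc R) (fun θ => circExp 1 θ * onCirc S.divX θ) = 0 := by
      rcases Nat.eq_zero_or_pos n with hn | hn
      · have : S.divX = 0 := by
          rw [hn] at hSdeg
          rw [eq_C_of_natDegree_le_zero hSdeg, divX_C]
        simp [this, onCirc_zero, wInner]
      · refine hX _ ?_
        rw [natDegree_divX_eq_natDegree_tsub_one]; omega
    rw [congrArg (wInner μ (onCirc R)) h2, wInner_add_right hμ (by fun_prop) (by fun_prop) (by fun_prop), h3, wInner_smul_right,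
      hstar]
    simp
  have hR0 : R = 0 := by
    apply H.eq_zero_of_wNorm
    rw [wInner_self] at hRR
    have : wNorm μ (onCirc R) ^ 2 = 0 := by exact_mod_cast hRR
    simpa using this
  exact sub_eq_zero.1 hR0

lemma rho_sq (H : IsOPUC μ φ κ) (n : ℕ) :
    ‖verb μ φ n‖ ^ 2 + (κ n / κ (n + 1)) ^ 2 = 1 := by
  have hμ := H.contInt
  have hrec := H.recursion n
  set ρ := κ n / κ (n + 1)
  have h1 : onCirc (X * φ n) = fun θ => verb μ φ n * onCirc (starPoly n (φ n)) θ +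
      (ρ : ℂ) * onCirc (φ (n + 1)) θ := by
    ext θ
    have : X * φ n = C (verb μ φ n) * starPoly n (φ n) + C (ρ : ℂ) * φ (n + 1) := by
      rw [← hrec]; ring
    rw [this]; simp [onCirc]
  have h2 : wNorm μ (onCirc (X * φ n)) = 1 := by
    rw [← H.wNorm_eq_one n]
    exact wNorm_congr fun θ => by simp [onCirc_mul, onCirc_X, norm_circExp]
  have h3 := wInner_self (μ := μ) (onCirc (X * φ n))
  have hz : wInner μ (onCirc (φ (n + 1))) (onCirc (starPoly n (φ n))) = 0 :=
    H.orth_of_lt ((natDegree_starPoly_le (H.deg n).le).trans_lt (Nat.lt_succ_self n))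
  rw [h2, h1, wInner_add_left hμ (by fun_prop) (by fun_prop) (by fun_prop), wInner_smul_left,
    wInner_smul_left, wInner_add_right hμ (by fun_prop) (by fun_prop) (by fun_prop),
    wInner_add_right hμ (by fun_prop) (by fun_prop) (by fun_prop), wInner_smul_right,
    wInner_smul_right, wInner_smul_right, wInner_smul_right, wInner_self, wInner_self,
    H.wNorm_star, H.wNorm_eq_one, ← wInner_conj, hz] at h3
  have h4 : ((‖verb μ φ n‖ ^ 2 + ρ ^ 2 : ℝ) : ℂ) = (1 : ℝ) := by
    have := Complex.mul_conj (verb μ φ n)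
    rw [Complex.normSq_eq_norm_sq] at this
    push_cast at this h3 ⊢
    simp only [map_zero, mul_zero, add_zero, zero_add, mul_one, Complex.conj_ofReal, one_pow] at h3
    rw [← this, ← h3]; ring
  exact_mod_cast h4

lemma norm_verb_lt_one (H : IsOPUC μ φ κ) (n : ℕ) : ‖verb μ φ n‖ < 1 := by
  have := H.rho_sq n
  have h : 0 < κ n / κ (n + 1) := div_pos (H.pos _) (H.pos _)
  have : ‖verb μ φ n‖ ^ 2 < 1 := by nlinarith [sq_pos_of_pos h]
  nlinarith [norm_nonneg (verb μ φ n)]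

lemma rho_le_one (H : IsOPUC μ φ κ) (n : ℕ) : κ n / κ (n + 1) ≤ 1 := by
  have := H.rho_sq n
  have h : 0 < κ n / κ (n + 1) := div_pos (H.pos _) (H.pos _)
  nlinarith [sq_nonneg ‖verb μ φ n‖]

lemma one_sub_rho_le (H : IsOPUC μ φ κ) (n : ℕ) : 1 - κ n / κ (n + 1) ≤ ‖verb μ φ n‖ ^ 2 := by
  have := H.rho_sq n
  have h : 0 < κ n / κ (n + 1) := div_pos (H.pos _) (H.pos _)
  have := H.rho_le_one n
  nlinarith

lemma wNorm_succ_sub (H : IsOPUC μ φ κ) (n : ℕ) :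
    wNorm μ (fun θ => onCirc (φ (n + 1)) θ - circExp 1 θ * onCirc (φ n) θ) ≤
      2 * ‖verb μ φ n‖ := by
  have hμ := H.contInt
  have h1 : (fun θ => onCirc (φ (n + 1)) θ - circExp 1 θ * onCirc (φ n) θ) = fun θ =>
      ((1 - κ n / κ (n + 1) : ℝ) : ℂ) * onCirc (φ (n + 1)) θ +
        (- verb μ φ n) * onCirc (starPoly n (φ n)) θ := by
    ext θ
    have := congrArg (fun P => onCirc P θ) (H.recursion n)
    simp only [onCirc_sub, onCirc_mul, onCirc_X, onCirc_C] at this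
    push_cast at this ⊢
    linear_combination -this
  have hs : ∀ (c : ℂ) (f : ℝ → ℂ), wNorm μ (fun θ => c * f θ) = ‖c‖ * wNorm μ f := by
    intro c f
    simp only [wNorm, norm_mul, mul_pow]
    rw [integral_const_mul, Real.sqrt_mul (by positivity), Real.sqrt_sq (norm_nonneg _)]
  rw [h1]
  refine (wNorm_add_le hμ (by fun_prop) (by fun_prop)).trans ?_
  rw [hs, hs, H.wNorm_eq_one, H.wNorm_star, norm_neg, Complex.norm_real, Real.norm_eq_abs,
    abs_of_nonneg (by have := H.rho_le_one n; linarith)]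
  have h2 := H.one_sub_rho_le n
  have h3 := (H.norm_verb_lt_one n).le
  nlinarith [norm_nonneg (verb μ φ n)]

/-- Partial sums of the moduli of the Verblunsky coefficients. -/
noncomputable def _root_.verbSum (μ : Measure ℝ) (φ : ℕ → ℂ[X]) (n i : ℕ) : ℝ :=
  ∑ j ∈ Finset.range i, ‖verb μ φ (n + j)‖

lemma _root_.verbSum_nonneg (n i : ℕ) : 0 ≤ verbSum μ φ n i :=
  Finset.sum_nonneg fun _ _ => norm_nonneg _

lemma wNorm_add_sub (H : IsOPUC μ φ κ) (n i : ℕ) :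
    wNorm μ (fun θ => onCirc (φ (n + i)) θ - circExp i θ * onCirc (φ n) θ) ≤
      2 * verbSum μ φ n i := by
  have hμ := H.contInt
  induction i with
  | zero => simp [verbSum, circExp_zero, wNorm]
  | succ i ih =>
    have h1 : (fun θ => onCirc (φ (n + (i + 1))) θ - circExp ((i + 1 : ℕ) : ℤ) θ * onCirc (φ n) θ) =
      fun θ => (onCirc (φ (n + i + 1)) θ - circExp 1 θ * onCirc (φ (n + i)) θ) +
        circExp 1 θ * (onCirc (φ (n + i)) θ - circExp i θ * onCirc (φ n) θ) := by
      ext θ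
      push_cast
      rw [circExp_add, ← add_assoc n i 1]; ring
    rw [h1]
    refine (wNorm_add_le hμ (by fun_prop) (by fun_prop)).trans ?_
    rw [wNorm_circExp_mul]
    have := H.wNorm_succ_sub (n + i)
    simp only [verbSum, Finset.sum_range_succ] at ih ⊢
    linarith

end IsOPUC

/-- The lower bound in Szegő's extremal problem. -/
def SzegoLower (μ : Measure ℝ) (G : ℝ) : Prop :=
  ∀ P : ℂ[X], G * ‖P.coeff 0‖ ^ 2 ≤ wNorm μ (onCirc P) ^ 2

/-- Near-minimizers in Szegő's extremal problem have coefficients close to those of `D`. -/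
def SzegoUpper (μ : Measure ℝ) (G : ℝ) (D : ℕ → ℂ) : Prop :=
  ∀ J : ℕ, ∀ ε : ℝ, 0 < ε → ∃ P : ℂ[X], P.coeff 0 = 1 ∧ wNorm μ (onCirc P) ^ 2 ≤ G + ε ∧
    ∀ j ≤ J, ‖P.coeff j - D j‖ ≤ ε

lemma exists_coeff_bound {μ : Measure ℝ} (hμ : ContInt μ) {G : ℝ} (hG : 0 < G)
    (hS : SzegoLower μ G) (j : ℕ) :
    ∃ K : ℝ, 0 ≤ K ∧ ∀ P : ℂ[X], ‖P.coeff j‖ ≤ K * wNorm μ (onCirc P) := by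
  have base : ∀ P : ℂ[X], ‖P.coeff 0‖ ≤ (√G)⁻¹ * wNorm μ (onCirc P) := by
    intro P
    have h1 := hS P
    have h2 : 0 < √G := Real.sqrt_pos.2 hG
    rw [← div_eq_inv_mul, le_div_iff₀ h2]
    refine abs_le_of_sq_le_sq' ?_ (wNorm_nonneg _) |>.2
    rw [mul_pow, Real.sq_sqrt hG.le]; linarith
  have h2 : 0 < √G := Real.sqrt_pos.2 hG
  induction j with
  | zero => exact ⟨_, by positivity, base⟩
  | succ j ih =>
    obtain ⟨K, hK0, hK⟩ := ih
    refine ⟨K * (1 + (√G)⁻¹ * wNorm μ (fun _ => 1)),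
      mul_nonneg hK0 (add_nonneg zero_le_one (mul_nonneg (by positivity) (wNorm_nonneg _))),
      fun P => ?_⟩
    have h3 : wNorm μ (onCirc P.divX) ≤ wNorm μ (onCirc P) + ‖P.coeff 0‖ * wNorm μ (fun _ => 1) := by
      have e1 : wNorm μ (onCirc P.divX) =
          wNorm μ (fun θ => onCirc P θ + onCirc (C (-P.coeff 0)) θ) := by
        rw [← wNorm_circExp_mul 1]
        congr 1; ext θ
        have := congrArg (fun P => onCirc P θ) P.divX_mul_X_add
        simp only [onCirc_add, onCirc_mul, onCirc_X, onCirc_C] at this ⊢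
        rw [← this]; ring
      have e2 : wNorm μ (onCirc (C (-P.coeff 0))) = ‖P.coeff 0‖ * wNorm μ (fun _ => 1) := by
        simp only [wNorm, onCirc_C, norm_neg, norm_one]
        rw [← Real.sqrt_sq (norm_nonneg (P.coeff 0)), ← Real.sqrt_mul (by positivity),
          ← integral_const_mul, Real.sqrt_sq (norm_nonneg _)]
        simp
      rw [e1, ← e2]
      exact wNorm_add_le hμ (by fun_prop) (by fun_prop)
    rw [← coeff_divX]
    refine (hK _).trans ?_
    rw [mul_assoc]
    refine mul_le_mul_of_nonneg_left ?_ hK0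
    refine h3.trans ?_
    have := mul_le_mul_of_nonneg_right (base P) (wNorm_nonneg (μ := μ) (fun _ => 1))
    linarith

namespace IsOPUC

variable {μ : Measure ℝ} {φ : ℕ → ℂ[X]} {κ : ℕ → ℝ}

lemma kappa_sq_le (H : IsOPUC μ φ κ) {G : ℝ} (hS : SzegoLower μ G) (n : ℕ) :
    G * κ n ^ 2 ≤ 1 := by
  have := hS (starPoly n (φ n))
  rwa [H.wNorm_star, H.star_coeff_zero, Complex.norm_real, Real.norm_eq_abs, sq_abs, one_pow] at this

lemma wNorm_sq_eq (H : IsOPUC μ φ κ) {n : ℕ} {P : ℂ[X]} (hP : P.natDegree ≤ n)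
    (h0 : P.coeff 0 = 1) :
    wNorm μ (onCirc P) ^ 2 = (κ n ^ 2)⁻¹ +
      wNorm μ (onCirc (P - C ((κ n : ℂ)⁻¹) * starPoly n (φ n))) ^ 2 := by
  have hμ := H.contInt
  have k0 : (κ n : ℂ) ≠ 0 := by exact_mod_cast (H.pos n).ne'
  set S := P - C ((κ n : ℂ)⁻¹) * starPoly n (φ n) with hSdef
  have hSdeg : S.natDegree ≤ n := by
    refine (natDegree_sub_le _ _).trans (max_le hP ?_)
    exact (natDegree_C_mul_le _ _).trans (natDegree_starPoly_le (H.deg n).le)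
  have hS0 : S.coeff 0 = 0 := by
    rw [hSdef, coeff_sub, coeff_C_mul, H.star_coeff_zero, h0]; field_simp; simp
  have hz : wInner μ (onCirc (starPoly n (φ n))) (onCirc S) = 0 := by
    rw [H.wInner_star_right hSdeg, hS0]; simp
  have h2 : onCirc P = fun θ => onCirc S θ + (κ n : ℂ)⁻¹ * onCirc (starPoly n (φ n)) θ := by
    ext θ
    have : P = S + C ((κ n : ℂ)⁻¹) * starPoly n (φ n) := by rw [hSdef]; ring
    conv_lhs => rw [this]
    simp [onCirc]
  have h3 := wInner_self (μ := μ) (onCirc P)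
  rw [h2, wInner_add_left hμ (by fun_prop) (by fun_prop) (by fun_prop), wInner_smul_left,
    wInner_add_right hμ (by fun_prop) (by fun_prop) (by fun_prop),
    wInner_add_right hμ (by fun_prop) (by fun_prop) (by fun_prop), wInner_smul_right,
    wInner_smul_right, wInner_self, wInner_self,
    H.wNorm_star, ← wInner_conj, hz, ← h2] at h3
  have h4 : ((wNorm μ (onCirc P) ^ 2 : ℝ) : ℂ) = (((κ n ^ 2)⁻¹ + wNorm μ (onCirc S) ^ 2 : ℝ) : ℂ) := by
    rw [← h3]; simp; ring
  exact_mod_cast h4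

lemma tendsto_kappa_sq (H : IsOPUC μ φ κ) {G : ℝ} (hG : 0 < G) (hS : SzegoLower μ G) {D : ℕ → ℂ}
    (hU : SzegoUpper μ G D) : Tendsto (fun n => κ n ^ 2) atTop (𝓝 G⁻¹) := by
  have h : Tendsto (fun n => (κ n ^ 2)⁻¹) atTop (𝓝 G) := by
    rw [Metric.tendsto_atTop]
    intro ε hε
    obtain ⟨P, h0, h1, -⟩ := hU 0 (ε / 2) (by linarith)
    refine ⟨P.natDegree, fun n hn => ?_⟩
    have h2 := H.wNorm_sq_eq hn h0
    have h3 := H.kappa_sq_le hS n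
    have h4 : G ≤ (κ n ^ 2)⁻¹ := by
      rw [← one_div, le_div_iff₀ (pow_pos (H.pos n) 2)]; exact h3
    rw [Real.dist_eq, abs_of_nonneg (by linarith)]
    nlinarith [sq_nonneg (wNorm μ (onCirc (P - C ((κ n : ℂ)⁻¹) * starPoly n (φ n))))]
  simpa using h.inv₀ hG.ne'

lemma tendsto_star_coeff (H : IsOPUC μ φ κ) {G : ℝ} (hG : 0 < G) (hS : SzegoLower μ G) {D : ℕ → ℂ}
    (hU : SzegoUpper μ G D) (i : ℕ) :
    Tendsto (fun n => (starPoly n (φ n)).coeff i) atTop (𝓝 ((√G⁻¹ : ℝ) * D i)) := by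
  have hκ : Tendsto κ atTop (𝓝 (√G⁻¹)) := by
    have := (H.tendsto_kappa_sq hG hS hU).sqrt
    simpa [Real.sqrt_sq (H.pos _).le] using this
  have hκ' : Tendsto (fun n => (κ n : ℂ)) atTop (𝓝 ((√G⁻¹ : ℝ) : ℂ)) :=
    (Complex.continuous_ofReal.tendsto _).comp hκ
  suffices h : Tendsto (fun n => (κ n : ℂ)⁻¹ * (starPoly n (φ n)).coeff i) atTop (𝓝 (D i)) by
    refine (hκ'.mul h).congr fun n => ?_
    have k0 : (κ n : ℂ) ≠ 0 := by exact_mod_cast (H.pos n).ne'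
    field_simp
  obtain ⟨K, hK0, hK⟩ := exists_coeff_bound H.contInt hG hS i
  rw [Metric.tendsto_atTop]
  intro ε hε
  obtain ⟨δ, hδ0, hδ⟩ : ∃ δ : ℝ, 0 < δ ∧ δ + K * √δ < ε := by
    have : Tendsto (fun δ : ℝ => δ + K * √δ) (𝓝[>] 0) (𝓝 (0 + K * √0)) := by
      refine Tendsto.mono_left ?_ nhdsWithin_le_nhds
      exact (by fun_prop : Continuous fun δ : ℝ => δ + K * √δ).tendsto 0
    simp only [Real.sqrt_zero, mul_zero, add_zero] at this
    have h1 := this.eventually (gt_mem_nhds hε)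
    obtain ⟨δ, h2, h3⟩ := (h1.and self_mem_nhdsWithin).exists
    exact ⟨δ, h3, h2⟩
  obtain ⟨P, h0, h1, h5⟩ := hU i δ hδ0
  refine ⟨P.natDegree, fun n hn => ?_⟩
  have h2 := H.wNorm_sq_eq hn h0
  have h3 := H.kappa_sq_le hS n
  have h4 : G ≤ (κ n ^ 2)⁻¹ := by
    rw [← one_div, le_div_iff₀ (pow_pos (H.pos n) 2)]; exact h3
  have h6 : wNorm μ (onCirc (P - C ((κ n : ℂ)⁻¹) * starPoly n (φ n))) ≤ √δ :=
    Real.le_sqrt_of_sq_le (by linarith)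
  have h7 := (hK (P - C ((κ n : ℂ)⁻¹) * starPoly n (φ n))).trans
    (mul_le_mul_of_nonneg_left h6 hK0)
  rw [coeff_sub, coeff_C_mul] at h7
  rw [dist_eq_norm]
  have h8 : (κ n : ℂ)⁻¹ * (starPoly n (φ n)).coeff i - D i =
    (P.coeff i - D i) - (P.coeff i - (κ n : ℂ)⁻¹ * (starPoly n (φ n)).coeff i) := by ring
  rw [h8]
  have := norm_sub_le (P.coeff i - D i) (P.coeff i - (κ n : ℂ)⁻¹ * (starPoly n (φ n)).coeff i)
  linarith [h5 i le_rfl]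

lemma tendsto_verb (H : IsOPUC μ φ κ) {G : ℝ} (hG : 0 < G) (hS : SzegoLower μ G) {D : ℕ → ℂ}
    (hU : SzegoUpper μ G D) : Tendsto (fun n => ‖verb μ φ n‖) atTop (𝓝 0) := by
  have h1 := H.tendsto_kappa_sq hG hS hU
  have h2 : Tendsto (fun n => √(1 - κ n ^ 2 / κ (n + 1) ^ 2)) atTop (𝓝 (√(1 - G⁻¹ / G⁻¹))) :=
    (tendsto_const_nhds.sub (h1.div (h1.comp (tendsto_add_atTop_nat 1))
      (inv_ne_zero hG.ne'))).sqrt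
  rw [div_self (inv_ne_zero hG.ne'), sub_self, Real.sqrt_zero] at h2
  refine h2.congr fun n => ?_
  have := H.rho_sq n
  rw [div_pow] at this
  rw [← Real.sqrt_sq (norm_nonneg (verb μ φ n))]
  congr 1; linarith

end IsOPUC

/-- Powers of `1 / n`, as a scale of asymptotic comparison. -/
noncomputable def invPow (k : ℕ) (n : ℕ) : ℝ := ((n : ℝ)⁻¹) ^ k

lemma invPow_nonneg (k n : ℕ) : 0 ≤ invPow k n := by unfold invPow; positivity

lemma isBigO_invPow {E : Type*} [Norm E] {f : ℕ → E} {k N : ℕ} {C : ℝ}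
    (h : ∀ n, N ≤ n → 1 ≤ n → ‖f n‖ ≤ C / (n : ℝ) ^ k) : f =O[atTop] invPow k := by
  refine Asymptotics.IsBigO.of_bound C ?_
  filter_upwards [eventually_ge_atTop N, eventually_ge_atTop 1] with n hn hn1
  rw [Real.norm_of_nonneg (invPow_nonneg k n), invPow, inv_pow, ← div_eq_mul_inv]
  exact h n hn hn1

lemma exists_bound_of_isBigO_invPow {E : Type*} [Norm E] {f : ℕ → E} {k : ℕ}
    (h : f =O[atTop] invPow k) :
    ∃ C > 0, ∃ N, 1 ≤ N ∧ ∀ n, N ≤ n → ‖f n‖ ≤ C / (n : ℝ) ^ k := by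
  obtain ⟨C, hC, h⟩ := h.exists_pos
  obtain ⟨N, hN⟩ := eventually_atTop.1 h.bound
  refine ⟨C, hC, max N 1, le_max_right _ _, fun n hn => ?_⟩
  have := hN n ((le_max_left _ _).trans hn)
  rwa [Real.norm_of_nonneg (invPow_nonneg k n), invPow, inv_pow, ← div_eq_mul_inv] at this

lemma isBigO_invPow_mul {E : Type*} [NormedRing E] {f g : ℕ → E} {i j : ℕ}
    (hf : f =O[atTop] invPow i) (hg : g =O[atTop] invPow j) :
    (fun n => f n * g n) =O[atTop] invPow (i + j) := by
  have := hf.mul hg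
  refine this.congr_right fun n => ?_
  simp [invPow, pow_add]

lemma isBigO_invPow_mono {E : Type*} [Norm E] {f : ℕ → E} {i j : ℕ} (hij : i ≤ j)
    (hf : f =O[atTop] invPow j) : f =O[atTop] invPow i := by
  refine hf.trans (Asymptotics.IsBigO.of_bound 1 ?_)
  filter_upwards [eventually_ge_atTop 1] with n hn
  rw [Real.norm_of_nonneg (invPow_nonneg _ _), Real.norm_of_nonneg (invPow_nonneg _ _), one_mul]
  exact pow_le_pow_of_le_one (by positivity) (inv_le_one_of_one_le₀ (by exact_mod_cast hn)) hij

lemma isBigO_invPow_zero {E : Type*} [Norm E] {f : ℕ → E} {C : ℝ} (h : ∀ n, ‖f n‖ ≤ C) :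
    f =O[atTop] invPow 0 := isBigO_invPow (N := 0) (C := C) fun n _ _ => by simpa using h n

lemma norm_sub_le_of_telescope {E : Type*} [NormedAddCommGroup E] {x : ℕ → E} {L : E} {h : ℕ → ℝ}
    {N : ℕ} (hx : Tendsto x atTop (𝓝 L)) (h0 : ∀ n, 0 ≤ h n)
    (hd : ∀ n, N ≤ n → ‖x (n + 1) - x n‖ ≤ h n - h (n + 1)) {n : ℕ} (hn : N ≤ n) :
    ‖x n - L‖ ≤ h n := by
  have key : ∀ k, ‖x n - x (k + n)‖ ≤ h n - h (k + n) := by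
    intro k
    induction k with
    | zero => simp
    | succ k ih =>
      have h1 := hd (k + n) (by omega)
      have h2 : x n - x (k + 1 + n) = (x n - x (k + n)) - (x (k + n + 1) - x (k + n)) := by
        rw [show k + 1 + n = k + n + 1 by ring]; abel
      rw [h2]
      refine (norm_sub_le _ _).trans ?_
      rw [show k + 1 + n = k + n + 1 by ring]; linarith
  have ht : Tendsto (fun k => ‖x n - x (k + n)‖) atTop (𝓝 ‖x n - L‖) :=
    (tendsto_const_nhds.sub ((tendsto_add_atTop_iff_nat n).2 hx)).norm
  exact le_of_tendsto ht (Eventually.of_forall fun k => (key k).trans (by linarith [h0 (k + n)]))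

lemma isBigO_sub_limit_one {E : Type*} [NormedAddCommGroup E] {x : ℕ → E} {L : E}
    (hx : Tendsto x atTop (𝓝 L)) (hd : (fun n => x (n + 1) - x n) =O[atTop] invPow 2) :
    (fun n => x n - L) =O[atTop] invPow 1 := by
  obtain ⟨C, hC, N, hN, h⟩ := exists_bound_of_isBigO_invPow hd
  refine isBigO_invPow (N := N) (C := 2 * C) fun n hn hn1 => ?_
  refine norm_sub_le_of_telescope (h := fun n : ℕ => 2 * C / (n : ℝ) ^ 1) (N := N) hx
    (fun n => by positivity) (fun n hn => (h n hn).trans ?_) hn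
  have : (1 : ℝ) ≤ n := by exact_mod_cast hN.trans hn
  push_cast
  rw [pow_one, pow_one, div_sub_div _ _ (by positivity) (by positivity),
    div_le_div_iff₀ (by positivity) (by positivity)]
  nlinarith [mul_nonneg hC.le (sub_nonneg.2 this), mul_nonneg (mul_nonneg hC.le (sub_nonneg.2 this)) (sub_nonneg.2 this)]

lemma isBigO_sub_limit_two {E : Type*} [NormedAddCommGroup E] {x : ℕ → E} {L : E}
    (hx : Tendsto x atTop (𝓝 L)) (hd : (fun n => x (n + 1) - x n) =O[atTop] invPow 3) :
    (fun n => x n - L) =O[atTop] invPow 2 := by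
  obtain ⟨C, hC, N, hN, h⟩ := exists_bound_of_isBigO_invPow hd
  refine isBigO_invPow (N := N) (C := 2 * C) fun n hn hn1 => ?_
  refine norm_sub_le_of_telescope (h := fun n : ℕ => 2 * C / (n : ℝ) ^ 2) (N := N) hx
    (fun n => by positivity) (fun n hn => (h n hn).trans ?_) hn
  have : (1 : ℝ) ≤ n := by exact_mod_cast hN.trans hn
  push_cast
  rw [div_sub_div _ _ (by positivity) (by positivity),
    div_le_div_iff₀ (by positivity) (by positivity)]
  have e : (2 * C * ((n : ℝ) + 1) ^ 2 - (n : ℝ) ^ 2 * (2 * C)) * (n : ℝ) ^ 3 -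
      C * ((n : ℝ) ^ 2 * ((n : ℝ) + 1) ^ 2) = C * (n : ℝ) ^ 2 * (3 * n ^ 2 - 1) := by ring
  have : 0 ≤ C * (n : ℝ) ^ 2 * (3 * n ^ 2 - 1) := mul_nonneg (by positivity) (by nlinarith)
  linarith

lemma exists_bound_of_bootstrap {b : ℕ → ℝ} (hb0 : ∀ n, 0 ≤ b n)
    (hb : Tendsto b atTop (𝓝 0)) {C : ℝ} {m N : ℕ} (hC : 0 ≤ C)
    (h : ∀ n, N ≤ n → n * b n ≤ C + C * n * (∑ i ∈ Finset.range (2 * m + 1), b (n - m + i)) ^ 2) :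
    b =O[atTop] invPow 1 := by
  set ε : ℝ := (4 * (C + 1) * (2 * m + 1) ^ 2)⁻¹ with hε
  have hε0 : 0 < ε := by positivity
  obtain ⟨N₀, hN₀⟩ := eventually_atTop.1 (hb.eventually_lt_const (lt_min hε0 one_pos))
  set N₁ := max N (max (N₀ + m) (2 * m + 1)) with hN₁
  have hN1 : N ≤ N₁ := le_max_left _ _
  have hN2 : N₀ + m ≤ N₁ := (le_max_left _ _).trans (le_max_right _ _)
  have hN3 : 2 * m + 1 ≤ N₁ := (le_max_right _ _).trans (le_max_right _ _)
  have step : ∀ n, N₁ ≤ n → ∀ M : ℝ, (∀ i, n ≤ i + m → i ≤ n + m → i * b i ≤ M) →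
      n * b n ≤ C + M / 2 := by
    intro n hn M hM
    set q := ∑ i ∈ Finset.range (2 * m + 1), b (n - m + i) with hq
    have q0 : 0 ≤ q := Finset.sum_nonneg fun _ _ => hb0 _
    have hq1 : q ≤ (2 * m + 1) * ε := by
      calc q ≤ ∑ i ∈ Finset.range (2 * m + 1), ε := Finset.sum_le_sum fun i _ =>
            ((hN₀ (n - m + i) (by omega)).trans_le (min_le_left _ _)).le
        _ = _ := by simp
    have hq2 : n * q ≤ (2 * m + 1) * (2 * M) := by
      calc n * q = ∑ i ∈ Finset.range (2 * m + 1), n * b (n - m + i) := by rw [hq, Finset.mul_sum]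
        _ ≤ ∑ i ∈ Finset.range (2 * m + 1), 2 * M := Finset.sum_le_sum fun i hi => by
            have hi := Finset.mem_range.1 hi
            have h1 := hM (n - m + i) (by omega) (by omega)
            have h2 : (n : ℝ) ≤ 2 * ((n - m + i : ℕ) : ℝ) := by
              exact_mod_cast (by omega : n ≤ 2 * (n - m + i))
            nlinarith [hb0 (n - m + i)]
        _ = _ := by simp
    have hM0 : 0 ≤ M := (mul_nonneg (Nat.cast_nonneg n) (hb0 n)).trans (hM n (by omega) (by omega))
    have h1 := h n (hN1.trans hn)
    have h2 : C * n * q ^ 2 ≤ M / 2 := by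
      calc C * n * q ^ 2 = C * (n * q) * q := by ring
        _ ≤ (C + 1) * ((2 * m + 1) * (2 * M)) * ((2 * m + 1) * ε) := by gcongr; linarith
        _ = M / 2 := by rw [hε]; field_simp; ring
    linarith
  have iter : ∀ K n : ℕ, N₁ + K * m ≤ n → n * b n ≤ 2 * C + (n + K * m) / 2 ^ K := by
    intro K
    induction K with
    | zero =>
      intro n hn
      have h1 := (hN₀ n (by omega)).trans_le (min_le_right _ _)
      have : (0 : ℝ) ≤ n := Nat.cast_nonneg n
      simp only [Nat.cast_zero, zero_mul, add_zero, pow_zero, div_one]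
      nlinarith [hb0 n]
    | succ K ih =>
      intro n hn
      have hn' : N₁ + K * m + m ≤ n := by rw [Nat.succ_mul] at hn; omega
      have := step n (by omega) (2 * C + (n + m + K * m) / 2 ^ K) fun i hi1 hi2 =>
        (ih i (by omega)).trans (by gcongr; exact_mod_cast hi2)
      refine this.trans (le_of_eq ?_)
      push_cast; rw [pow_succ]; field_simp; ring
  refine isBigO_invPow (N := N₁) (C := 2 * C + 2 * (N₁ + m + 1)) fun n hn hn1 => ?_
  rw [Real.norm_of_nonneg (hb0 n), pow_one, le_div_iff₀ (by positivity), mul_comm]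
  set K := (n - N₁) / (m + 1) with hK
  have e := Nat.div_add_mod (n - N₁) (m + 1)
  have e2 := Nat.mod_lt (n - N₁) (Nat.succ_pos m)
  rw [← hK] at e
  have hKm : K * m ≤ n - N₁ := by
    calc K * m ≤ (m + 1) * K := by nlinarith
      _ ≤ _ := by omega
  refine (iter K n (by omega)).trans ?_
  have h3 : (n : ℝ) ≤ (N₁ + m + 1) * (K + 1) := by
    have : n ≤ (N₁ + m + 1) * (K + 1) := by
      have : n ≤ N₁ + (m + 1) * K + (m + 1) := by
        simp only [Nat.succ_eq_add_one] at e2; omega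
      nlinarith
    exact_mod_cast this
  have h4 : (K * m : ℝ) ≤ n := by exact_mod_cast (by omega : K * m ≤ n)
  have h5 : (K + 1 : ℝ) ≤ 2 ^ K := by exact_mod_cast Nat.lt_two_pow_self
  have : ((n : ℝ) + K * m) / 2 ^ K ≤ 2 * (N₁ + m + 1) := by
    rw [div_le_iff₀ (by positivity)]
    have : (N₁ + m + 1 : ℝ) * (K + 1) ≤ (N₁ + m + 1) * 2 ^ K := by gcongr
    linarith
  linarith

lemma tendsto_zero_of_isBigO_invPow {E : Type*} [NormedAddCommGroup E] {f : ℕ → E} {k : ℕ}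
    (hk : 1 ≤ k) (hf : f =O[atTop] invPow k) : Tendsto f atTop (𝓝 0) := by
  refine (isBigO_invPow_mono hk hf).trans_tendsto ?_
  have : invPow 1 = fun n : ℕ => (n : ℝ)⁻¹ := by ext n; simp [invPow]
  rw [this]; exact tendsto_inv_atTop_nhds_zero_nat

/-- The complex number `1 / (n + 1)`. -/
noncomputable def invSucc (n : ℕ) : ℂ := ((n : ℂ) + 1)⁻¹

lemma norm_invSucc (n : ℕ) : ‖invSucc n‖ = ((n : ℝ) + 1)⁻¹ := by
  rw [invSucc, norm_inv]; congr 1; exact_mod_cast Complex.norm_natCast (n + 1)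

lemma invSucc_isBigO : invSucc =O[atTop] invPow 1 := by
  refine isBigO_invPow (N := 0) (C := 1) fun n _ hn => ?_
  have : (1 : ℝ) ≤ n := by exact_mod_cast hn
  rw [norm_invSucc, ← one_div, pow_one]; gcongr; linarith

lemma invSucc_succ_isBigO : (fun n => invSucc (n + 1)) =O[atTop] invPow 1 := by
  refine isBigO_invPow (N := 0) (C := 1) fun n _ hn => ?_
  have : (1 : ℝ) ≤ n := by exact_mod_cast hn
  rw [norm_invSucc, ← one_div, pow_one]; push_cast; gcongr; linarith

lemma invSucc_succ_sub (n : ℕ) : invSucc (n + 1) - invSucc n = -(invSucc n * invSucc (n + 1)) := by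
  have h1 : (n : ℂ) + 1 ≠ 0 := by exact_mod_cast n.succ_ne_zero
  have h2 : (n : ℂ) + 1 + 1 ≠ 0 := by exact_mod_cast (n + 1).succ_ne_zero
  simp only [invSucc]; push_cast; field_simp; ring

lemma invSucc_sub_isBigO : (fun n => invSucc (n + 1) - invSucc n) =O[atTop] invPow 2 := by
  simp only [invSucc_succ_sub]
  exact (isBigO_invPow_mul invSucc_isBigO invSucc_succ_isBigO).neg_left

lemma isBigO_invPow_conj {f : ℕ → ℂ} {k : ℕ} (h : f =O[atTop] invPow k) :
    (fun n => (starRingEnd ℂ) (f n)) =O[atTop] invPow k :=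
  Asymptotics.IsBigO.of_norm_left (by simpa using h.norm_left)

/-- If `v` is almost geometric with ratio `l ≠ 1` on the unit circle, then `v n / n ^ 2` is up to
`O(n ^ (-3))` a discrete derivative of a sequence of size `O(n ^ (-2))`. -/
lemma exists_primitive_of_almost_geometric {v : ℕ → ℂ} {l : ℂ} (hl : l ≠ 1)
    (hv : v =O[atTop] invPow 0) (hv' : (fun n => v (n + 1) - l * v n) =O[atTop] invPow 1) :
    ∃ y : ℕ → ℂ, y =O[atTop] invPow 2 ∧
      (fun n => y (n + 1) - y n - v n * invSucc n ^ 2) =O[atTop] invPow 3 := by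
  have hl' : l - 1 ≠ 0 := sub_ne_zero.2 hl
  have hsq : (fun n => invSucc n ^ 2) =O[atTop] invPow 2 := by
    simpa only [sq] using isBigO_invPow_mul invSucc_isBigO invSucc_isBigO
  refine ⟨fun n => (l - 1)⁻¹ * (v n * invSucc n ^ 2), ?_, ?_⟩
  · exact (isBigO_invPow_mul hv hsq).const_mul_left _
  · have e : ∀ n, (l - 1)⁻¹ * (v (n + 1) * invSucc (n + 1) ^ 2) - (l - 1)⁻¹ * (v n * invSucc n ^ 2)
        - v n * invSucc n ^ 2 = (l - 1)⁻¹ * ((v (n + 1) - l * v n) * invSucc (n + 1) ^ 2 +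
          l * (v n * ((invSucc (n + 1) - invSucc n) * (invSucc (n + 1) + invSucc n)))) := by
      intro n; field_simp; ring
    simp only [e]
    refine Asymptotics.IsBigO.const_mul_left (Asymptotics.IsBigO.add ?_ ?_) _
    · refine isBigO_invPow_mul (i := 1) (j := 2) hv' ?_
      simpa only [sq] using isBigO_invPow_mul invSucc_succ_isBigO invSucc_succ_isBigO
    · refine Asymptotics.IsBigO.const_mul_left ?_ _
      exact isBigO_invPow_mul (i := 0) (j := 3) hv
        (isBigO_invPow_mul (i := 2) (j := 1) invSucc_sub_isBigO
          (invSucc_succ_isBigO.add invSucc_isBigO))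

lemma asymptotics_of_oscillation {ι : Type*} [Fintype ι] {a : ι → ℂ} (ha : ∀ k, ‖a k‖ = 1)
    (ha' : Function.Injective a) (β : ι → ℝ) {u : ι → ℕ → ℂ} (hu : ∀ k n, ‖u k n‖ = 1)
    (hu' : ∀ k, (fun n => u k (n + 1) - a k * u k n) =O[atTop] invPow 1) {b : ℕ → ℂ}
    (hb : (fun n : ℕ => ((n : ℂ) + 1) * b n + ∑ k, β k * u k n) =O[atTop] invPow 1)
    {x : ℕ → ℝ} (hx : Tendsto x atTop (𝓝 1))
    (hxd : ∀ n, x (n + 1) - x n = x (n + 1) * ‖b n‖ ^ 2) :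
    (fun n : ℕ => ((x n - 1 + (∑ k, β k ^ 2) / (n + 1) : ℝ) : ℂ)) =O[atTop] invPow 2 := by
  classical
  set U : ℕ → ℂ := fun n => ∑ k, β k * u k n with hU
  set e : ℕ → ℂ := fun n => ((n : ℂ) + 1) * b n + U n with he
  have hne : ∀ n : ℕ, (n : ℂ) + 1 ≠ 0 := fun n => by exact_mod_cast n.succ_ne_zero
  have hbe : ∀ n, b n = invSucc n * (e n - U n) := by
    intro n; have := hne n; simp only [he, invSucc]; field_simp; ring
  have hU0 : U =O[atTop] invPow 0 := isBigO_invPow_zero (C := ∑ k, |β k|) fun n => by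
    refine (norm_sum_le _ _).trans (Finset.sum_le_sum fun k _ => ?_)
    simp [hu]
  have he0 : (fun n => e n - U n) =O[atTop] invPow 0 := (isBigO_invPow_mono (by norm_num) hb).sub hU0
  have hb1 : b =O[atTop] invPow 1 := by
    rw [funext hbe]; exact isBigO_invPow_mul (i := 1) (j := 0) invSucc_isBigO he0
  have hbsq : ∀ n, ((‖b n‖ ^ 2 : ℝ) : ℂ) = b n * (starRingEnd ℂ) (b n) := fun n => by
    rw [Complex.mul_conj, Complex.normSq_eq_norm_sq]
  have hb2 : (fun n => b n * (starRingEnd ℂ) (b n)) =O[atTop] invPow 2 :=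
    isBigO_invPow_mul hb1 (isBigO_invPow_conj hb1)
  have hb3 : (fun n => b n * (starRingEnd ℂ) (b n) - invSucc n ^ 2 * (U n * (starRingEnd ℂ) (U n)))
      =O[atTop] invPow 3 := by
    have : ∀ n, b n * (starRingEnd ℂ) (b n) - invSucc n ^ 2 * (U n * (starRingEnd ℂ) (U n)) =
        invSucc n * (invSucc n * (e n * (starRingEnd ℂ) (e n - U n) -
          U n * (starRingEnd ℂ) (e n))) := by
      intro n
      have hc : (starRingEnd ℂ) (invSucc n) = invSucc n := by simp [invSucc]
      rw [hbe n, map_mul, hc, map_sub]; ring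
    simp only [this]
    refine isBigO_invPow_mul (i := 1) (j := 2) invSucc_isBigO
      (isBigO_invPow_mul (i := 1) (j := 1) invSucc_isBigO (Asymptotics.IsBigO.sub ?_ ?_))
    · exact isBigO_invPow_mul (i := 1) (j := 0) hb (isBigO_invPow_conj he0)
    · exact isBigO_invPow_mul (i := 0) (j := 1) hU0 (isBigO_invPow_conj hb)
  -- the complex version of `x`
  set X : ℕ → ℂ := fun n => (x n : ℂ) with hX
  have hXd : ∀ n, X (n + 1) - X n = X (n + 1) * (b n * (starRingEnd ℂ) (b n)) := by
    intro n; rw [← hbsq]; simp only [hX]; exact_mod_cast hxd n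
  have hXt : Tendsto X atTop (𝓝 1) := by
    have := (Complex.continuous_ofReal.tendsto 1).comp hx
    rwa [Complex.ofReal_one] at this
  have hX0 : (fun n => X (n + 1)) =O[atTop] invPow 0 := by
    have h1 : (invPow 0) = fun _ => (1 : ℝ) := by ext n; simp [invPow]
    rw [h1]
    exact ((tendsto_add_atTop_iff_nat 1).2 hXt).isBigO_one ℝ
  have hXd2 : (fun n => X (n + 1) - X n) =O[atTop] invPow 2 := by
    simp only [hXd]; exact isBigO_invPow_mul (i := 0) (j := 2) hX0 hb2
  have hX1 : (fun n => X (n + 1) - 1) =O[atTop] invPow 1 := by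
    have := (isBigO_invPow_mono (i := 1) (by norm_num) hXd2).add (isBigO_sub_limit_one hXt hXd2)
    refine this.congr_left fun n => by ring
  -- discrete primitives of the terms of `|U n| ^ 2`
  have hprim : ∀ k l, ∃ y : ℕ → ℂ,
      (fun n => y n + if k = l then invSucc n else 0) =O[atTop] invPow 2 ∧
      (fun n => y (n + 1) - y n - (u k n * (starRingEnd ℂ) (u l n)) * invSucc n ^ 2)
        =O[atTop] invPow 3 := by
    intro k l
    by_cases hkl : k = l
    · subst hkl
      refine ⟨fun n => -invSucc n, ?_, ?_⟩
      · simp only [if_true, neg_add_cancel]; exact Asymptotics.isBigO_zero _ _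
      · have : ∀ n, -invSucc (n + 1) - -invSucc n -
            (u k n * (starRingEnd ℂ) (u k n)) * invSucc n ^ 2 =
            invSucc n * (invSucc (n + 1) - invSucc n) := by
          intro n
          rw [Complex.mul_conj, Complex.normSq_eq_norm_sq, hu]
          have := invSucc_succ_sub n
          push_cast
          linear_combination -this
        simp only [this]
        exact isBigO_invPow_mul (i := 1) (j := 2) invSucc_isBigO invSucc_sub_isBigO
    · have hlam : a k * (starRingEnd ℂ) (a l) ≠ 1 := by
        intro h
        have h1 : (starRingEnd ℂ) (a l) * a l = 1 := by
          rw [mul_comm, Complex.mul_conj, Complex.normSq_eq_norm_sq, ha]; simp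
        have : a k = a l := by
          calc a k = a k * ((starRingEnd ℂ) (a l) * a l) := by rw [h1, mul_one]
            _ = _ := by rw [← mul_assoc, h, one_mul]
        exact hkl (ha' this)
      have hu0 : ∀ k, u k =O[atTop] invPow 0 := fun k =>
        isBigO_invPow_zero (C := 1) fun n => (hu k n).le
      have hu1 : ∀ k, (fun n => u k (n + 1)) =O[atTop] invPow 0 := fun k =>
        isBigO_invPow_zero (C := 1) fun n => (hu k _).le
      obtain ⟨y, hy1, hy2⟩ := exists_primitive_of_almost_geometric hlam
        (v := fun n => u k n * (starRingEnd ℂ) (u l n))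
        (isBigO_invPow_mul (i := 0) (j := 0) (hu0 k) (isBigO_invPow_conj (hu0 l))) (by
          have : ∀ n, u k (n + 1) * (starRingEnd ℂ) (u l (n + 1)) -
              a k * (starRingEnd ℂ) (a l) * (u k n * (starRingEnd ℂ) (u l n)) =
              (u k (n + 1) - a k * u k n) * (starRingEnd ℂ) (u l (n + 1)) +
              a k * (u k n * (starRingEnd ℂ) (u l (n + 1) - a l * u l n)) := by
            intro n; rw [map_sub, map_mul]; ring
          simp only [this]
          refine Asymptotics.IsBigO.add ?_ (Asymptotics.IsBigO.const_mul_left ?_ _)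
          · exact isBigO_invPow_mul (i := 1) (j := 0) (hu' k) (isBigO_invPow_conj (hu1 l))
          · exact isBigO_invPow_mul (i := 0) (j := 1) (hu0 k) (isBigO_invPow_conj (hu' l)))
      exact ⟨y, by simpa [hkl] using hy1, hy2⟩
  choose y hy1 hy2 using hprim
  have hUU : ∀ n, U n * (starRingEnd ℂ) (U n) =
      ∑ k, ∑ l, (β k * β l : ℂ) * (u k n * (starRingEnd ℂ) (u l n)) := by
    intro n
    simp only [hU, map_sum, Finset.sum_mul_sum, map_mul, Complex.conj_ofReal]
    refine Finset.sum_congr rfl fun k _ => Finset.sum_congr rfl fun l _ => by ring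
  set Y : ℕ → ℂ := fun n => ∑ k, ∑ l, (β k * β l : ℂ) * y k l n with hY
  have hYS : (fun n => Y n + (∑ k, (β k : ℂ) ^ 2) * invSucc n) =O[atTop] invPow 2 := by
    have : ∀ n, Y n + (∑ k, (β k : ℂ) ^ 2) * invSucc n =
        ∑ k, ∑ l, (β k * β l : ℂ) * (y k l n + if k = l then invSucc n else 0) := by
      intro n
      simp only [hY, mul_add, Finset.sum_add_distrib, mul_ite, mul_zero, Finset.sum_ite_eq,
        Finset.mem_univ, if_true, Finset.sum_mul, sq]
    simp only [this]
    exact Asymptotics.IsBigO.fun_sum fun k _ => Asymptotics.IsBigO.fun_sum fun l _ =>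
      (hy1 k l).const_mul_left _
  have hY0 : Tendsto Y atTop (𝓝 0) := by
    have h1 := tendsto_zero_of_isBigO_invPow (by norm_num) hYS
    have h2 := (tendsto_zero_of_isBigO_invPow le_rfl invSucc_isBigO).const_mul
      (∑ k, (β k : ℂ) ^ 2)
    simpa using h1.sub h2
  have hz : (fun n => X n - Y n - 1) =O[atTop] invPow 2 := by
    refine isBigO_sub_limit_two (x := fun n => X n - Y n) (by simpa using hXt.sub hY0) ?_
    have : ∀ n, X (n + 1) - Y (n + 1) - (X n - Y n) =
        (X (n + 1) - 1) * (b n * (starRingEnd ℂ) (b n)) +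
        (b n * (starRingEnd ℂ) (b n) - invSucc n ^ 2 * (U n * (starRingEnd ℂ) (U n))) -
        ∑ k, ∑ l, (β k * β l : ℂ) *
          (y k l (n + 1) - y k l n - (u k n * (starRingEnd ℂ) (u l n)) * invSucc n ^ 2) := by
      intro n
      have h1 := hXd n
      have h2 : ∑ k, ∑ l, (β k * β l : ℂ) *
          (y k l (n + 1) - y k l n - (u k n * (starRingEnd ℂ) (u l n)) * invSucc n ^ 2) =
          Y (n + 1) - Y n - invSucc n ^ 2 * (U n * (starRingEnd ℂ) (U n)) := by
        simp only [hUU, hY, Finset.mul_sum, ← Finset.sum_sub_distrib]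
        refine Finset.sum_congr rfl fun k _ => Finset.sum_congr rfl fun l _ => by ring
      rw [h2]; linear_combination h1
    simp only [this]
    refine ((isBigO_invPow_mul (i := 1) (j := 2) hX1 hb2).add hb3).sub ?_
    exact Asymptotics.IsBigO.fun_sum fun k _ => Asymptotics.IsBigO.fun_sum fun l _ =>
      (hy2 k l).const_mul_left _
  refine (hz.add hYS).congr_left fun n => ?_
  simp only [hX, invSucc]; push_cast; ring

/-- Trigonometric polynomials. -/
def Trig (F : ℝ → ℂ) : Prop := F ∈ Algebra.adjoin ℂ {circExp 1, circExp (-1)}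

namespace Trig

lemma add {F G : ℝ → ℂ} (hF : Trig F) (hG : Trig G) : Trig fun θ => F θ + G θ :=
  Subalgebra.add_mem _ hF hG

lemma mul {F G : ℝ → ℂ} (hF : Trig F) (hG : Trig G) : Trig fun θ => F θ * G θ :=
  Subalgebra.mul_mem _ hF hG

lemma const (c : ℂ) : Trig fun _ => c := Subalgebra.algebraMap_mem _ c

lemma const_mul {F : ℝ → ℂ} (c : ℂ) (hF : Trig F) : Trig fun θ => c * F θ := (const c).mul hF

lemma sub {F G : ℝ → ℂ} (hF : Trig F) (hG : Trig G) : Trig fun θ => F θ - G θ :=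
  Subalgebra.sub_mem _ hF hG

lemma sum {ι : Type*} (s : Finset ι) {F : ι → ℝ → ℂ} (hF : ∀ i ∈ s, Trig (F i)) :
    Trig fun θ => ∑ i ∈ s, F i θ := by
  have := Subalgebra.sum_mem _ hF
  rwa [show ∑ i ∈ s, F i = fun θ => ∑ i ∈ s, F i θ from by ext; simp] at this

lemma prod {ι : Type*} (s : Finset ι) {F : ι → ℝ → ℂ} (hF : ∀ i ∈ s, Trig (F i)) :
    Trig fun θ => ∏ i ∈ s, F i θ := by
  have := Subalgebra.prod_mem _ hF
  rwa [show ∏ i ∈ s, F i = fun θ => ∏ i ∈ s, F i θ from by ext; simp] at this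

lemma circ_one : Trig (circExp 1) := Algebra.subset_adjoin (by simp)

lemma circ_neg_one : Trig (circExp (-1)) := Algebra.subset_adjoin (by simp)

lemma induct {p : (ℝ → ℂ) → Prop} (h1 : p (circExp 1)) (h2 : p (circExp (-1)))
    (hc : ∀ c : ℂ, p fun _ => c)
    (ha : ∀ F G, Trig F → Trig G → p F → p G → p fun θ => F θ + G θ)
    (hm : ∀ F G, Trig F → Trig G → p F → p G → p fun θ => F θ * G θ) {F : ℝ → ℂ} (hF : Trig F) :
    p F := by
  induction hF using Algebra.adjoin_induction with
  | mem x hx => rcases hx with rfl | rfl <;> assumption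
  | algebraMap r => exact hc r
  | add x y hx hy h h' => exact ha x y hx hy h h'
  | mul x y hx hy h h' => exact hm x y hx hy h h'

lemma circ (j : ℤ) : Trig (circExp j) := by
  have h : ∀ n : ℕ, Trig (circExp n) ∧ Trig (circExp (-n)) := by
    intro n
    induction n with
    | zero =>
      have : Trig (circExp 0) := by
        rw [show circExp 0 = fun _ => 1 from funext circExp_zero]; exact const 1
      exact ⟨by simpa using this, by simpa using this⟩
    | succ n ih =>
      constructor
      · rw [show circExp ((n + 1 : ℕ) : ℤ) = fun θ => circExp n θ * circExp 1 θ from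
          funext fun θ => by rw [← circExp_add]; simp]
        exact ih.1.mul circ_one
      · rw [show circExp (-((n + 1 : ℕ) : ℤ)) = fun θ => circExp (-n) θ * circExp (-1) θ from
          funext fun θ => by rw [← circExp_add]; push_cast; congr 1; ring]
        exact ih.2.mul circ_neg_one
  obtain ⟨n, rfl | rfl⟩ := j.eq_nat_or_neg
  exacts [(h n).1, (h n).2]

lemma onCirc (P : ℂ[X]) : Trig (onCirc P) := by
  rw [show _root_.onCirc P = fun θ => ∑ i ∈ Finset.range (P.natDegree + 1), P.coeff i * circExp i θ
    from funext fun θ => onCirc_eq_sum (Nat.lt_succ_self _) θ]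
  exact sum _ fun i _ => const_mul _ (circ i)

lemma conj {F : ℝ → ℂ} (hF : Trig F) : Trig fun θ => (starRingEnd ℂ) (F θ) := by
  refine induct (p := fun F => Trig fun θ => (starRingEnd ℂ) (F θ)) ?_ ?_ (fun c => const _)
    (fun F G _ _ h h' => ?_) (fun F G _ _ h h' => ?_) hF
  · simpa only [circExp_conj] using circ _
  · simpa only [circExp_conj] using circ _
  · simpa only [map_add] using h.add h'
  · simpa only [map_mul] using h.mul h'

lemma continuous {F : ℝ → ℂ} (hF : Trig F) : Continuous F := by
  exact induct (p := Continuous) (continuous_circExp _) (continuous_circExp _)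
    (fun c => continuous_const) (fun F G _ _ h h' => h.add h') (fun F G _ _ h h' => h.mul h') hF

end Trig

lemma hasDerivAt_circExp (j : ℤ) (θ : ℝ) :
    HasDerivAt (circExp j) (Complex.I * j * circExp j θ) θ := by
  have h : HasDerivAt (fun θ : ℝ => (j * θ * Complex.I : ℂ)) (j * 1 * Complex.I) θ :=
    ((Complex.ofRealCLM.hasDerivAt (x := θ)).const_mul (j : ℂ)).mul_const Complex.I
  have := h.cexp
  exact this.congr_deriv (by simp only [circExp]; ring)

lemma hasDerivAt_onCirc (P : ℂ[X]) (θ : ℝ) :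
    HasDerivAt (onCirc P) (Complex.I * onCirc (X * derivative P) θ) θ := by
  have h1 := hasDerivAt_circExp 1 θ
  have h2 := (P.hasDerivAt (circExp 1 θ)).comp θ h1
  exact h2.congr_deriv (by simp only [onCirc, eval_mul, eval_X]; push_cast; ring)

lemma hasDerivAt_conj {F : ℝ → ℂ} {F' : ℂ} {θ : ℝ} (h : HasDerivAt F F' θ) :
    HasDerivAt (fun θ => (starRingEnd ℂ) (F θ)) ((starRingEnd ℂ) F') θ :=
  (Complex.conjCLE.toContinuousLinearMap.hasFDerivAt.comp_hasDerivAt θ h)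

/-- Principal value functionals `C k` attached to a generalized Jacobi weight with singularities
`a k` of exponent `2 β k`, together with the integration by parts formula they satisfy. Here
`I * ∑ g j z ^ j` is the logarithmic derivative of the regular part of the weight. -/
structure IsPV {ι : Type*} [Fintype ι] (μ : Measure ℝ) (a : ι → ℂ) (β : ι → ℝ) (g : ℤ → ℂ)
    (Cf : ι → (ℝ → ℂ) → ℂ) : Prop where
  rule : ∀ k F₁ F₂ G c, Trig F₁ → Trig F₂ → Trig G →
    (∀ θ, F₁ θ = c * F₂ θ + (circExp 1 θ - a k) * G θ) →
    Cf k F₁ = c * Cf k F₂ + Complex.I * ∫ θ, (circExp 1 θ + a k) * G θ ∂μ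
  conj : ∀ k F, Trig F → Cf k (fun θ => (starRingEnd ℂ) (F θ)) = (starRingEnd ℂ) (Cf k F)
  ibp : ∀ F F', Trig F → Trig F' → (∀ θ, HasDerivAt F (F' θ) θ) →
    ∫ θ, F' θ ∂μ + Complex.I * ∑' j, g j * ∫ θ, F θ * circExp j θ ∂μ + ∑ k, β k * Cf k F = 0

/-- The trigonometric moments of `|φ n| ^ 2`. -/
noncomputable def sqMom (μ : Measure ℝ) (φ : ℕ → ℂ[X]) (n : ℕ) (j : ℤ) : ℂ :=
  ∫ θ, onCirc (φ n) θ * (starRingEnd ℂ) (onCirc (φ n) θ) * circExp j θ ∂μ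

/-- The trigonometric moments of `z ^ (1 - n) (φ n) ^ 2`. -/
noncomputable def verbMom (μ : Measure ℝ) (φ : ℕ → ℂ[X]) (n : ℕ) (j : ℤ) : ℂ :=
  ∫ θ, circExp (1 - n) θ * onCirc (φ n) θ ^ 2 * circExp j θ ∂μ

/-- The polynomial `z (φ n)' - n φ n`. -/
noncomputable def eulerDefect (φ : ℕ → ℂ[X]) (n : ℕ) : ℂ[X] :=
  X * derivative (φ n) - C (n : ℂ) * φ n

lemma eulerDefect_coeff (φ : ℕ → ℂ[X]) (n j : ℕ) :
    (eulerDefect φ n).coeff j = ((j : ℂ) - n) * (φ n).coeff j := by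
  rw [eulerDefect, coeff_sub, coeff_C_mul]
  cases j with
  | zero => simp
  | succ j => rw [coeff_X_mul, coeff_derivative]; push_cast; ring

lemma onCirc_X_add_C (a : ℂ) (θ : ℝ) : onCirc (X + C a) θ = circExp 1 θ + a := by simp [onCirc]

lemma exists_sub_eq_mul (P : ℂ[X]) (a : ℂ) : ∃ q : ℂ[X], P - C (P.eval a) = (X - C a) * q := by
  obtain ⟨q, hq⟩ := dvd_iff_isRoot.2 (show (P - C (P.eval a)).IsRoot a by simp [IsRoot])
  exact ⟨q, hq⟩

lemma natDegree_coeff_of_X_sub_C_mul {q : ℂ[X]} {a : ℂ} {n : ℕ} (hn : 1 ≤ n)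
    (h : ((X - C a) * q).natDegree = n) :
    q.natDegree = n - 1 ∧ q.coeff (n - 1) = ((X - C a) * q).coeff n := by
  have hq : q ≠ 0 := by rintro rfl; simp at h; omega
  rw [(monic_X_sub_C a).natDegree_mul' hq, natDegree_X_sub_C] at h
  refine ⟨by omega, ?_⟩
  obtain ⟨s, rfl⟩ : ∃ s, n = s + 1 := ⟨n - 1, by omega⟩
  rw [sub_mul, coeff_sub, coeff_X_mul, coeff_C_mul, coeff_eq_zero_of_natDegree_lt (n := s + 1)
    (by omega)]
  simp

section

variable {ι : Type*} [Fintype ι] {μ : Measure ℝ} {φ : ℕ → ℂ[X]} {κ : ℕ → ℝ} {a : ι → ℂ}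
  {β : ι → ℝ} {g : ℤ → ℂ} {Cf : ι → (ℝ → ℂ) → ℂ}

/-- The principal value of `|φ n| ^ 2`. -/
noncomputable def pvSq (φ : ℕ → ℂ[X]) (Cf : ι → (ℝ → ℂ) → ℂ) (n : ℕ) (k : ι) : ℂ :=
  Cf k fun θ => onCirc (φ n) θ * (starRingEnd ℂ) (onCirc (φ n) θ)

lemma trig_sq (P : ℂ[X]) : Trig fun θ => onCirc P θ * (starRingEnd ℂ) (onCirc P θ) :=
  (Trig.onCirc P).mul (Trig.onCirc P).conj

lemma IsPV.pvSq_conj (hC : IsPV μ a β g Cf) (n : ℕ) (k : ι) :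
    (starRingEnd ℂ) (pvSq φ Cf n k) = pvSq φ Cf n k := by
  rw [pvSq, ← hC.conj k _ (trig_sq _)]
  congr 1; ext θ; simp [mul_comm]

lemma circExp_neg_one_eq {a : ℂ} (ha : ‖a‖ = 1) (θ : ℝ) :
    (starRingEnd ℂ) (circExp 1 θ - a) = (circExp 1 θ - a) * (-a⁻¹ * circExp (-1) θ) := by
  have h0 : a ≠ 0 := by rintro rfl; simp at ha
  have h1 : (starRingEnd ℂ) a = a⁻¹ := by
    rw [Complex.inv_def, Complex.normSq_eq_norm_sq, ha]; simp
  rw [map_sub, circExp_conj, h1]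
  have := circExp_neg_mul 1 θ
  field_simp
  linear_combination this

lemma IsOPUC.conj_eval_mul_pv (H : IsOPUC μ φ κ) (hC : IsPV μ a β g Cf) (ha : ∀ k, ‖a k‖ = 1)
    {n : ℕ} (hn : 1 ≤ n) (k : ι) :
    (starRingEnd ℂ) ((φ n).eval (a k)) * Cf k (onCirc (φ n)) = pvSq φ Cf n k + Complex.I := by
  have h0 : a k ≠ 0 := by intro h; have := ha k; simp [h] at this
  have hca : (starRingEnd ℂ) (a k) = (a k)⁻¹ := by
    rw [Complex.inv_def, Complex.normSq_eq_norm_sq, ha]; simp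
  obtain ⟨q, hq⟩ := exists_sub_eq_mul (φ n) (a k)
  have hdeg : ((X - C (a k)) * q).natDegree = n := by rw [← hq, natDegree_sub_C, H.deg]
  obtain ⟨hqd, hqc⟩ := natDegree_coeff_of_X_sub_C_mul hn hdeg
  rw [← hq, coeff_sub, coeff_C, if_neg (by omega), sub_zero, H.lead] at hqc
  have hev : ∀ θ, onCirc (φ n) θ = (φ n).eval (a k) + (circExp 1 θ - a k) * onCirc q θ := by
    intro θ
    have := congrArg (fun P => onCirc P θ) hq
    simp only [onCirc_sub, onCirc_mul, onCirc_C, onCirc_X] at this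
    linear_combination this
  have hr := hC.rule k (fun θ => onCirc (φ n) θ * (starRingEnd ℂ) (onCirc (φ n) θ)) (onCirc (φ n))
    (fun θ => (-(a k)⁻¹ * circExp (-1) θ) * (starRingEnd ℂ) (onCirc q θ) * onCirc (φ n) θ)
    ((starRingEnd ℂ) ((φ n).eval (a k))) (trig_sq _) (Trig.onCirc _)
    (((Trig.circ _).const_mul _ |>.mul (Trig.onCirc _).conj).mul (Trig.onCirc _)) (by
      intro θ
      have h1 := circExp_neg_one_eq (ha k) θ
      nth_rw 2 [hev θ]
      rw [map_add, map_mul, h1]; ring)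
  have hint : ∫ θ, (circExp 1 θ + a k) * ((-(a k)⁻¹ * circExp (-1) θ) *
      (starRingEnd ℂ) (onCirc q θ) * onCirc (φ n) θ) ∂μ = -1 := by
    have h2 := H.wInner_right_eq (P := (X + C (a k)) * q) (n := n) (by
      refine natDegree_mul_le.trans ?_
      rw [natDegree_X_add_C, hqd]; omega)
    have h3 : ((X + C (a k)) * q).coeff n = (κ n : ℂ) := by
      obtain ⟨s, rfl⟩ : ∃ s, n = s + 1 := ⟨n - 1, by omega⟩
      rw [add_mul, coeff_add, coeff_X_mul, coeff_C_mul,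
        coeff_eq_zero_of_natDegree_lt (n := s + 1) (by omega)]
      simpa using hqc
    have hk : (κ n : ℂ) ≠ 0 := by exact_mod_cast (H.pos n).ne'
    rw [h3, Complex.conj_ofReal, div_self hk] at h2
    rw [← h2, wInner, ← integral_neg]
    congr 1; ext θ
    rw [onCirc_mul, onCirc_X_add_C, map_mul, map_add, circExp_conj, hca]
    have := circExp_neg_mul 1 θ
    field_simp
    linear_combination (-onCirc (φ n) θ * (starRingEnd ℂ) (onCirc q θ)) * this
  rw [hint] at hr
  rw [pvSq, hr]; ring

lemma IsOPUC.eval_ne_zero (H : IsOPUC μ φ κ) (hC : IsPV μ a β g Cf) (ha : ∀ k, ‖a k‖ = 1)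
    {n : ℕ} (hn : 1 ≤ n) (k : ι) : (φ n).eval (a k) ≠ 0 := by
  intro h
  have h1 := H.conj_eval_mul_pv hC ha hn k
  have h2 := hC.pvSq_conj (φ := φ) n k
  rw [h, map_zero, zero_mul] at h1
  have h3 : pvSq φ Cf n k = -Complex.I := by linear_combination -h1
  rw [h3] at h2
  have h4 := congrArg Complex.im h2
  norm_num at h4

/-- The unimodular numbers `a ^ (1 - n) φ n (a) / conj (φ n (a))`. -/
noncomputable def phase (φ : ℕ → ℂ[X]) (a : ι → ℂ) (k : ι) (n : ℕ) : ℂ :=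
  (a k) ^ (1 - n : ℤ) * ((φ n).eval (a k) / (starRingEnd ℂ) ((φ n).eval (a k)))

lemma IsOPUC.pv_verb (H : IsOPUC μ φ κ) (hC : IsPV μ a β g Cf) (ha : ∀ k, ‖a k‖ = 1)
    {n : ℕ} (hn : 1 ≤ n) (k : ι) :
    Cf k (fun θ => circExp (1 - n) θ * onCirc (φ n) θ ^ 2) =
      Complex.I * verb μ φ n + phase φ a k n * (Complex.I + pvSq φ Cf n k) := by
  have h0 : a k ≠ 0 := by intro h; have := ha k; simp [h] at this
  obtain ⟨s, rfl⟩ : ∃ s, n = s + 1 := ⟨n - 1, by omega⟩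
  have hphi := H.eval_ne_zero hC ha hn k
  set c : ℂ := ((a k) ^ s)⁻¹ * (φ (s + 1)).eval (a k) with hc
  obtain ⟨q, hq⟩ := exists_sub_eq_mul (φ (s + 1) - C c * X ^ s) (a k)
  have hz : (φ (s + 1) - C c * X ^ s).eval (a k) = 0 := by
    simp only [eval_sub, eval_mul, eval_C, eval_pow, eval_X, hc]
    have := pow_ne_zero s h0
    field_simp; ring
  rw [hz, C_0, sub_zero] at hq
  have hlt : (C c * X ^ s : ℂ[X]).natDegree ≤ s := (natDegree_C_mul_le _ _).trans (by simp)
  have hdeg : ((X - C (a k)) * q).natDegree = s + 1 := by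
    rw [← hq, natDegree_sub_eq_left_of_natDegree_lt (by rw [H.deg]; omega), H.deg]
  obtain ⟨hqd, hqc⟩ := natDegree_coeff_of_X_sub_C_mul hn hdeg
  rw [← hq, coeff_sub, coeff_eq_zero_of_natDegree_lt (p := C c * X ^ s) (by omega), sub_zero, H.lead,
    Nat.add_sub_cancel] at hqc
  rw [Nat.add_sub_cancel] at hqd
  have he : (1 - ((s + 1 : ℕ) : ℤ)) = -(s : ℤ) := by push_cast; ring
  have hr := hC.rule k (fun θ => circExp (1 - ((s + 1 : ℕ) : ℤ)) θ * onCirc (φ (s + 1)) θ ^ 2)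
    (onCirc (φ (s + 1))) (fun θ => circExp (-s) θ * onCirc q θ * onCirc (φ (s + 1)) θ) c
    (by simp only [sq]; exact (Trig.circ _).mul ((Trig.onCirc _).mul (Trig.onCirc _)))
    (Trig.onCirc _) (((Trig.circ _).mul (Trig.onCirc _)).mul (Trig.onCirc _)) (by
      intro θ
      have h1 := congrArg (fun P => onCirc P θ) hq
      simp only [onCirc_sub, onCirc_mul, onCirc_C, onCirc_X, onCirc_X_pow] at h1
      have h2 := circExp_neg_mul s θ
      rw [he]
      linear_combination (circExp (-s) θ * onCirc (φ (s + 1)) θ) * h1 + c * onCirc (φ (s + 1)) θ * h2)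
  have hint : ∫ θ, (circExp 1 θ + a k) * (circExp (-s) θ * onCirc q θ * onCirc (φ (s + 1)) θ) ∂μ =
      verb μ φ (s + 1) := by
    have h1 := H.integral_mul_circExp_neg_mul (s := s) (n := s + 1) (by omega)
      (g := (X + C (a k)) * q - φ (s + 1)) (by
        refine natDegree_le_iff_coeff_eq_zero.2 fun j hj => ?_
        rcases Nat.eq_or_lt_of_le (Nat.succ_le_of_lt hj) with rfl | hj
        · rw [coeff_sub, add_mul, coeff_add, coeff_X_mul, coeff_C_mul,
            coeff_eq_zero_of_natDegree_lt (n := s + 1) (by omega), H.lead, hqc]; simp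
        · refine coeff_eq_zero_of_natDegree_lt (lt_of_le_of_lt (natDegree_sub_le _ _) ?_)
          refine max_lt (lt_of_le_of_lt natDegree_mul_le ?_) (by rw [H.deg]; omega)
          rw [natDegree_X_add_C, hqd]; omega)
    rw [verb, ← sub_eq_zero, ← integral_sub (H.contInt _ (by fun_prop)) (H.contInt _ (by fun_prop)),
      ← h1]
    congr 1; ext θ
    rw [he, onCirc_sub, onCirc_mul, onCirc_X_add_C]; ring
  rw [hint] at hr
  have hA := H.conj_eval_mul_pv hC ha hn k
  have hcp : c = phase φ a k (s + 1) * (starRingEnd ℂ) ((φ (s + 1)).eval (a k)) := by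
    have : (starRingEnd ℂ) ((φ (s + 1)).eval (a k)) ≠ 0 := by simpa using hphi
    rw [phase, he, zpow_neg, zpow_natCast, hc]
    field_simp
  rw [hr, hcp, mul_assoc, hA]; ring

lemma IsOPUC.verb_identity (H : IsOPUC μ φ κ) (hC : IsPV μ a β g Cf) (ha : ∀ k, ‖a k‖ = 1)
    {n : ℕ} (hn : 1 ≤ n) :
    ((n : ℂ) + 1) * verb μ φ n + ∑ k, β k * phase φ a k n =
      -(∑' j, g j * verbMom μ φ n j) - ∑ k, β k * verb μ φ n +
        Complex.I * ∑ k, phase φ a k n * (β k * pvSq φ Cf n k) := by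
  obtain ⟨s, rfl⟩ : ∃ s, n = s + 1 := ⟨n - 1, by omega⟩
  have he : (1 - ((s + 1 : ℕ) : ℤ)) = -(s : ℤ) := by push_cast; ring
  have hib := hC.ibp (fun θ => circExp (1 - ((s + 1 : ℕ) : ℤ)) θ * onCirc (φ (s + 1)) θ ^ 2)
    (fun θ => Complex.I * ((s + 2) * (circExp (1 - ((s + 1 : ℕ) : ℤ)) θ * onCirc (φ (s + 1)) θ ^ 2)
      + 2 * (onCirc (φ (s + 1)) θ * (circExp (-s) θ * onCirc (eulerDefect φ (s + 1)) θ))))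
    (by simp only [sq]; exact (Trig.circ _).mul ((Trig.onCirc _).mul (Trig.onCirc _)))
    (by
      simp only [sq]
      exact Trig.const_mul _ (Trig.add (Trig.const_mul _
        ((Trig.circ _).mul ((Trig.onCirc _).mul (Trig.onCirc _))))
        (Trig.const_mul _ ((Trig.onCirc _).mul ((Trig.circ _).mul (Trig.onCirc _))))))
    (by
      intro θ
      have h1 := (hasDerivAt_circExp (1 - ((s + 1 : ℕ) : ℤ)) θ).mul
        ((hasDerivAt_onCirc (φ (s + 1)) θ).pow 2)
      refine h1.congr_deriv ?_
      simp only [he, eulerDefect, onCirc_sub, onCirc_mul, onCirc_C, Pi.pow_apply]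
      push_cast; ring)
  have h1 : ∫ θ, Complex.I * ((s + 2) * (circExp (1 - ((s + 1 : ℕ) : ℤ)) θ *
      onCirc (φ (s + 1)) θ ^ 2) +
      2 * (onCirc (φ (s + 1)) θ * (circExp (-s) θ * onCirc (eulerDefect φ (s + 1)) θ))) ∂μ =
      Complex.I * ((s + 2) * verb μ φ (s + 1)) := by
    rw [integral_const_mul, integral_add (H.contInt _ (by fun_prop)) (H.contInt _ (by fun_prop)),
      integral_const_mul, integral_const_mul, H.integral_mul_circExp_neg_mul (by omega), verb]
    · ring
    · refine natDegree_le_iff_coeff_eq_zero.2 fun j hj => ?_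
      rw [eulerDefect_coeff]
      rcases Nat.eq_or_lt_of_le (Nat.succ_le_of_lt hj) with rfl | hj
      · simp
      · rw [coeff_eq_zero_of_natDegree_lt (by rw [H.deg]; omega), mul_zero]
  rw [h1] at hib
  simp only [H.pv_verb hC ha hn] at hib
  change _ + Complex.I * ∑' j, g j * verbMom μ φ (s + 1) j + _ = 0 at hib
  have h2 : ∑ k, (β k : ℂ) * (Complex.I * verb μ φ (s + 1) + phase φ a k (s + 1) *
      (Complex.I + pvSq φ Cf (s + 1) k)) = Complex.I * ∑ k, β k * verb μ φ (s + 1) +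
      Complex.I * ∑ k, β k * phase φ a k (s + 1) +
      ∑ k, phase φ a k (s + 1) * (β k * pvSq φ Cf (s + 1) k) := by
    simp only [Finset.mul_sum, ← Finset.sum_add_distrib]
    refine Finset.sum_congr rfl fun k _ => by ring
  rw [h2] at hib
  push_cast
  linear_combination (-Complex.I) * hib + (((s : ℂ) + 2) * verb μ φ (s + 1) +
    (∑' j, g j * verbMom μ φ (s + 1) j) + ∑ k, β k * verb μ φ (s + 1) +
    ∑ k, β k * phase φ a k (s + 1)) * Complex.I_sq

end

section

variable {ι : Type*} [Fintype ι] {μ : Measure ℝ} {φ : ℕ → ℂ[X]} {κ : ℕ → ℝ} {a : ι → ℂ}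
  {β : ι → ℝ} {g : ℤ → ℂ} {Cf : ι → (ℝ → ℂ) → ℂ}

/-- The right-hand side of the linear system satisfied by the principal values of `|φ n| ^ 2`. -/
noncomputable def pvRhs (μ : Measure ℝ) (φ : ℕ → ℂ[X]) (a : ι → ℂ) (β : ι → ℝ) (g : ℤ → ℂ)
    (n l : ℕ) : ℂ :=
  l * sqMom μ φ n l + wInner μ (onCirc (X ^ l * eulerDefect φ n)) (onCirc (φ n)) -
    wInner μ (onCirc (X ^ l * φ n)) (onCirc (eulerDefect φ n)) +
    ∑' j, g j * sqMom μ φ n (l + j) +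
    ∑ k, β k * ∑ i ∈ Finset.range l,
      a k ^ (l - 1 - i) * (sqMom μ φ n (i + 1) + a k * sqMom μ φ n i)

lemma IsOPUC.pvSq_system (H : IsOPUC μ φ κ) (hC : IsPV μ a β g Cf) (n l : ℕ) :
    ∑ k, (β k * pvSq φ Cf n k) * a k ^ l = -Complex.I * pvRhs μ φ a β g n l := by
  have hib := hC.ibp
    (fun θ => onCirc (φ n) θ * (starRingEnd ℂ) (onCirc (φ n) θ) * circExp l θ)
    (fun θ => Complex.I * (l * (onCirc (φ n) θ * (starRingEnd ℂ) (onCirc (φ n) θ) * circExp l θ) +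
      (onCirc (X ^ l * eulerDefect φ n) θ * (starRingEnd ℂ) (onCirc (φ n) θ) -
      onCirc (X ^ l * φ n) θ * (starRingEnd ℂ) (onCirc (eulerDefect φ n) θ))))
    ((trig_sq _).mul (Trig.circ _))
    (Trig.const_mul _ (((trig_sq _).mul (Trig.circ _)).const_mul _ |>.add
      (((Trig.onCirc _).mul (Trig.onCirc _).conj).sub ((Trig.onCirc _).mul (Trig.onCirc _).conj))))
    (by
      intro θ
      have h1 := ((hasDerivAt_onCirc (φ n) θ).mul (hasDerivAt_conj (hasDerivAt_onCirc (φ n) θ))).mul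
        (hasDerivAt_circExp l θ)
      refine h1.congr_deriv ?_
      simp only [eulerDefect, onCirc_sub, onCirc_mul, onCirc_C, Pi.mul_apply, onCirc_X_pow]
      simp only [map_mul, map_sub, Complex.conj_I, map_natCast]
      push_cast; ring)
  have h1 : ∫ θ, Complex.I * (l * (onCirc (φ n) θ * (starRingEnd ℂ) (onCirc (φ n) θ) *
      circExp l θ) + (onCirc (X ^ l * eulerDefect φ n) θ * (starRingEnd ℂ) (onCirc (φ n) θ) -
      onCirc (X ^ l * φ n) θ * (starRingEnd ℂ) (onCirc (eulerDefect φ n) θ))) ∂μ =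
      Complex.I * (l * sqMom μ φ n l + (wInner μ (onCirc (X ^ l * eulerDefect φ n)) (onCirc (φ n)) -
        wInner μ (onCirc (X ^ l * φ n)) (onCirc (eulerDefect φ n)))) := by
    rw [integral_const_mul, integral_add (H.contInt _ (by fun_prop)) (H.contInt _ (by fun_prop)),
      integral_const_mul, integral_sub (H.contInt _ (by fun_prop)) (H.contInt _ (by fun_prop)),
      wInner, wInner, sqMom]
  have h2 : ∀ j : ℤ, ∫ θ, onCirc (φ n) θ * (starRingEnd ℂ) (onCirc (φ n) θ) * circExp l θ *
      circExp j θ ∂μ = sqMom μ φ n (l + j) := by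
    intro j; rw [sqMom]; congr 1; ext θ; rw [circExp_add]; ring
  have h3 : ∀ k, Cf k (fun θ => onCirc (φ n) θ * (starRingEnd ℂ) (onCirc (φ n) θ) * circExp l θ) =
      a k ^ l * pvSq φ Cf n k + Complex.I * ∑ i ∈ Finset.range l,
        a k ^ (l - 1 - i) * (sqMom μ φ n (i + 1) + a k * sqMom μ φ n i) := by
    intro k
    have hr := hC.rule k
      (fun θ => onCirc (φ n) θ * (starRingEnd ℂ) (onCirc (φ n) θ) * circExp l θ)
      (fun θ => onCirc (φ n) θ * (starRingEnd ℂ) (onCirc (φ n) θ))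
      (fun θ => (∑ i ∈ Finset.range l, a k ^ (l - 1 - i) * circExp i θ) *
        (onCirc (φ n) θ * (starRingEnd ℂ) (onCirc (φ n) θ))) (a k ^ l)
      ((trig_sq _).mul (Trig.circ _)) (trig_sq _)
      ((Trig.sum _ fun i _ => Trig.const_mul _ (Trig.circ _)).mul (trig_sq _)) (by
        intro θ
        have := geom_sum₂_mul (circExp 1 θ) (a k) l
        simp only [circExp_natCast]
        rw [Finset.sum_congr rfl fun i _ => mul_comm (a k ^ (l - 1 - i)) (circExp 1 θ ^ i)]
        linear_combination (-onCirc (φ n) θ * (starRingEnd ℂ) (onCirc (φ n) θ)) * this)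
    rw [hr]
    unfold pvSq
    congr 2
    have e : ∀ θ, (circExp 1 θ + a k) * ((∑ i ∈ Finset.range l, a k ^ (l - 1 - i) * circExp i θ) *
        (onCirc (φ n) θ * (starRingEnd ℂ) (onCirc (φ n) θ))) = ∑ i ∈ Finset.range l,
          a k ^ (l - 1 - i) *
          (onCirc (φ n) θ * (starRingEnd ℂ) (onCirc (φ n) θ) * circExp (i + 1) θ +
            a k * (onCirc (φ n) θ * (starRingEnd ℂ) (onCirc (φ n) θ) * circExp i θ)) := by
      intro θ
      rw [Finset.sum_mul, Finset.mul_sum]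
      refine Finset.sum_congr rfl fun i _ => ?_
      rw [circExp_add]; ring
    simp only [e]
    rw [integral_finsetSum _ fun i _ => H.contInt _ (by fun_prop)]
    refine Finset.sum_congr rfl fun i _ => ?_
    rw [integral_const_mul, integral_add (H.contInt _ (by fun_prop)) (H.contInt _ (by fun_prop)),
      integral_const_mul, sqMom, sqMom]
  rw [h1] at hib
  simp only [h2, h3] at hib
  have h4 : ∑ k, (β k : ℂ) * (a k ^ l * pvSq φ Cf n k + Complex.I * ∑ i ∈ Finset.range l,
      a k ^ (l - 1 - i) * (sqMom μ φ n (i + 1) + a k * sqMom μ φ n i)) =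
      ∑ k, (β k * pvSq φ Cf n k) * a k ^ l + Complex.I * ∑ k, (β k : ℂ) * ∑ i ∈ Finset.range l,
      a k ^ (l - 1 - i) * (sqMom μ φ n (i + 1) + a k * sqMom μ φ n i) := by
    rw [Finset.mul_sum Finset.univ, ← Finset.sum_add_distrib]
    refine Finset.sum_congr rfl fun k _ => by ring
  rw [h4] at hib
  rw [pvRhs]
  linear_combination hib

/-- Nonzero-index trigonometric moments of the top. -/
noncomputable def topMom (μ : Measure ℝ) (φ : ℕ → ℂ[X]) (n i : ℕ) : ℂ :=
  wInner μ (onCirc (X ^ (n + i))) (onCirc (φ n))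

lemma IsOPUC.wInner_eq_sum_topMom (H : IsOPUC μ φ κ) {n l : ℕ} {Q : ℂ[X]}
    (hQ : Q.natDegree < n + l) :
    wInner μ (onCirc Q) (onCirc (φ n)) = ∑ j ∈ Finset.range l, Q.coeff (n + j) * topMom μ φ n j := by
  have h1 : onCirc Q = fun θ => ∑ i ∈ Finset.range (n + l), Q.coeff i * onCirc (X ^ i) θ := by
    ext θ; simp only [onCirc_eq_sum hQ, onCirc_X_pow]
  rw [h1, wInner_sum_left H.contInt _ (fun i _ => by fun_prop) (by fun_prop), Finset.sum_range_add]
  rw [Finset.sum_eq_zero, zero_add]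
  · exact Finset.sum_congr rfl fun j _ => wInner_smul_left _ _ _
  · intro i hi
    rw [wInner_smul_left, ← wInner_conj, H.orth_of_lt (by simpa using hi), map_zero, mul_zero]

lemma IsOPUC.norm_topMom_le (H : IsOPUC μ φ κ) (n i : ℕ) :
    ‖topMom μ φ n i‖ ≤ wNorm μ fun _ => 1 := by
  refine (norm_wInner_le H.contInt (by fun_prop) (by fun_prop)).trans ?_
  rw [H.wNorm_eq_one, mul_one]
  refine (wNorm_congr fun θ => ?_).le
  rw [onCirc_X_pow, norm_circExp, norm_one]

lemma IsOPUC.sqMom_eq_sum (H : IsOPUC μ φ κ) {n l : ℕ} (hl : l ≤ n) :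
    sqMom μ φ n l = ∑ p ∈ Finset.HasAntidiagonal.antidiagonal l,
      (φ n).coeff (n - p.1) * topMom μ φ n p.2 := by
  have h := H.wInner_eq_sum_topMom (n := n) (l := l + 1) (Q := X ^ l * φ n) (by
    refine lt_of_le_of_lt natDegree_mul_le ?_
    rw [H.deg, natDegree_X_pow]; omega)
  have h2 : sqMom μ φ n l = wInner μ (onCirc (X ^ l * φ n)) (onCirc (φ n)) := by
    rw [sqMom, wInner]; congr 1; ext θ; rw [onCirc_mul, onCirc_X_pow]; ring
  rw [h2, h, ← Finset.sum_range_reflect, Finset.Nat.sum_antidiagonal_eq_sum_range_succ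
    (fun i j => (φ n).coeff (n - i) * topMom μ φ n j)]
  refine Finset.sum_congr rfl fun j hj => ?_
  have hj := Finset.mem_range.1 hj
  rw [show l + 1 - 1 - j = l - j by omega, coeff_X_pow_mul', if_pos (by omega)]
  congr 2; omega

lemma IsOPUC.wInner_eulerDefect (H : IsOPUC μ φ κ) {n l : ℕ} (hl : l < n) :
    wInner μ (onCirc (X ^ (l + 1) * eulerDefect φ n)) (onCirc (φ n)) =
      -∑ p ∈ Finset.HasAntidiagonal.antidiagonal l,
        ((p.1 + 1 : ℕ) : ℂ) * (φ n).coeff (n - (p.1 + 1)) * topMom μ φ n p.2 := by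
  have hdeg : (eulerDefect φ n).natDegree ≤ n - 1 := by
    refine natDegree_le_iff_coeff_eq_zero.2 fun j hj => ?_
    rw [eulerDefect_coeff]
    rcases Nat.eq_or_lt_of_le (by omega : n ≤ j) with rfl | hj
    · simp
    · rw [coeff_eq_zero_of_natDegree_lt (by rw [H.deg]; omega), mul_zero]
  have h := H.wInner_eq_sum_topMom (n := n) (l := l + 1) (Q := X ^ (l + 1) * eulerDefect φ n) (by
    refine lt_of_le_of_lt natDegree_mul_le ?_
    rw [natDegree_X_pow]; omega)
  rw [h, ← Finset.sum_range_reflect, Finset.Nat.sum_antidiagonal_eq_sum_range_succ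
    (fun i j => ((i + 1 : ℕ) : ℂ) * (φ n).coeff (n - (i + 1)) * topMom μ φ n j),
    ← Finset.sum_neg_distrib]
  refine Finset.sum_congr rfl fun j hj => ?_
  have hj := Finset.mem_range.1 hj
  rw [show l + 1 - 1 - j = l - j by omega, coeff_X_pow_mul', if_pos (by omega), eulerDefect_coeff,
    show n + (l - j) - (l + 1) = n - (j + 1) by omega, Nat.cast_sub (by omega : j + 1 ≤ n)]
  ring

end

section

variable {μ : Measure ℝ} {φ : ℕ → ℂ[X]} {κ : ℕ → ℝ}

lemma verbSum_eq_Ico (n i : ℕ) :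
    verbSum μ φ n i = ∑ j ∈ Finset.Ico n (n + i), ‖verb μ φ j‖ := by
  rw [Finset.sum_Ico_eq_sum_range, verbSum, Nat.add_sub_cancel_left]

lemma verbSum_mono {n i n' i' : ℕ} (h1 : n' ≤ n) (h2 : n + i ≤ n' + i') :
    verbSum μ φ n i ≤ verbSum μ φ n' i' := by
  rw [verbSum_eq_Ico, verbSum_eq_Ico]
  exact Finset.sum_le_sum_of_subset_of_nonneg (Finset.Ico_subset_Ico h1 h2)
    fun _ _ _ => norm_nonneg _

lemma sqMom_neg (n : ℕ) (j : ℤ) : sqMom μ φ n (-j) = (starRingEnd ℂ) (sqMom μ φ n j) := by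
  rw [sqMom, sqMom, ← integral_conj]
  congr 1; ext θ; simp only [map_mul, Complex.conj_conj, circExp_conj]; ring

namespace IsOPUC

lemma sqMom_zero (H : IsOPUC μ φ κ) (n : ℕ) : sqMom μ φ n 0 = 1 := by
  have := H.orth n n
  rw [if_pos rfl] at this
  rw [← this, sqMom, wInner]
  congr 1; ext θ; rw [circExp_zero, mul_one]

lemma norm_integral_le_one (H : IsOPUC μ φ κ) {n : ℕ} {f : ℝ → ℂ}
    (hf : ∀ θ, ‖f θ‖ = ‖onCirc (φ n) θ‖ ^ 2) : ‖∫ θ, f θ ∂μ‖ ≤ 1 := by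
  refine (norm_integral_le_integral_norm _).trans ?_
  simp only [hf]
  rw [← wNorm_sq, H.wNorm_eq_one, one_pow]

lemma norm_sqMom_le_one (H : IsOPUC μ φ κ) (n : ℕ) (j : ℤ) : ‖sqMom μ φ n j‖ ≤ 1 :=
  H.norm_integral_le_one (n := n) fun θ => by simp [norm_circExp, sq]

lemma norm_verbMom_le_one (H : IsOPUC μ φ κ) (n : ℕ) (j : ℤ) : ‖verbMom μ φ n j‖ ≤ 1 :=
  H.norm_integral_le_one (n := n) fun θ => by simp [norm_circExp]

lemma norm_integral_sub_mul_le (H : IsOPUC μ φ κ) (n i : ℕ) {f : ℝ → ℂ} (hf : Continuous f) :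
    ‖∫ θ, (onCirc (φ (n + i)) θ - circExp i θ * onCirc (φ n) θ) * f θ ∂μ‖ ≤
      2 * verbSum μ φ n i * wNorm μ f := by
  have h := norm_wInner_le H.contInt
    (f := fun θ => onCirc (φ (n + i)) θ - circExp i θ * onCirc (φ n) θ)
    (g := fun θ => (starRingEnd ℂ) (f θ)) (by fun_prop) (by fun_prop)
  simp only [wInner, Complex.conj_conj] at h
  refine h.trans ?_
  rw [wNorm_congr (f := fun θ => (starRingEnd ℂ) (f θ)) (g := f) fun θ => by simp]
  exact mul_le_mul_of_nonneg_right (H.wNorm_add_sub n i) (wNorm_nonneg _)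

lemma norm_sqMom_le (H : IsOPUC μ φ κ) (n : ℕ) {i : ℕ} (hi : 0 < i) :
    ‖sqMom μ φ n i‖ ≤ 2 * verbSum μ φ n i := by
  have h := H.norm_integral_sub_mul_le n i (f := fun θ => (starRingEnd ℂ) (onCirc (φ n) θ))
    (by fun_prop)
  rw [wNorm_congr (g := onCirc (φ n)) fun θ => by simp, H.wNorm_eq_one, mul_one] at h
  refine le_of_eq_of_le ?_ h
  simp only [sub_mul]
  rw [integral_sub (H.contInt _ (by fun_prop)) (H.contInt _ (by fun_prop))]
  have h0 := H.orth (n + i) n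
  rw [if_neg (by omega), wInner] at h0
  rw [h0, zero_sub, norm_neg, sqMom]
  congr 2; ext θ; ring

lemma norm_sqMom_le_natAbs (H : IsOPUC μ φ κ) (n : ℕ) {j : ℤ} (hj : j ≠ 0) :
    ‖sqMom μ φ n j‖ ≤ 2 * verbSum μ φ n j.natAbs := by
  obtain ⟨i, rfl | rfl⟩ := j.eq_nat_or_neg
  · exact H.norm_sqMom_le n (by omega)
  · rw [sqMom_neg, RCLike.norm_conj, Int.natAbs_neg, Int.natAbs_natCast]
    exact H.norm_sqMom_le n (by omega)

lemma norm_verbMom_le (H : IsOPUC μ φ κ) (n j : ℕ) :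
    ‖verbMom μ φ n j‖ ≤ 2 * verbSum μ φ n (j + 1) := by
  have h := H.norm_integral_sub_mul_le n (j + 1) (f := fun θ => circExp (-n) θ * onCirc (φ n) θ)
    (by fun_prop)
  rw [wNorm_circExp_mul, H.wNorm_eq_one, mul_one] at h
  refine le_of_eq_of_le ?_ h
  simp only [sub_mul]
  rw [integral_sub (H.contInt _ (by fun_prop)) (H.contInt _ (by fun_prop)),
    H.integral_mul_circExp_neg_mul (by omega) (H.deg n).le, zero_sub, norm_neg, verbMom]
  congr 2; ext θ
  have : circExp (1 - n) θ * circExp j θ = circExp ((j + 1 : ℕ) : ℤ) θ * circExp (-n) θ := by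
    rw [← circExp_add, ← circExp_add]; congr 1; push_cast; ring
  linear_combination onCirc (φ n) θ ^ 2 * this

lemma norm_verbMom_neg_le (H : IsOPUC μ φ κ) {n i : ℕ} (hi : i + 1 ≤ n) :
    ‖verbMom μ φ n (-(i + 1 : ℕ))‖ ≤ 2 * verbSum μ φ (n - (i + 1)) (i + 1) := by
  obtain ⟨p, rfl⟩ := Nat.exists_eq_add_of_le' hi
  rw [Nat.add_sub_cancel]
  have h := H.norm_integral_sub_mul_le p (i + 1)
    (f := fun θ => circExp (-(p + 2 * i + 1 : ℕ)) θ * onCirc (φ (p + (i + 1))) θ)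
    (by fun_prop)
  rw [wNorm_circExp_mul, H.wNorm_eq_one, mul_one] at h
  refine le_of_eq_of_le ?_ h
  simp only [sub_mul]
  rw [integral_sub (H.contInt _ (by fun_prop)) (H.contInt _ (by fun_prop))]
  have h0 := H.integral_mul_circExp_neg_mul (s := p + i) (n := p + (i + 1)) (by omega)
    (g := φ p) (by rw [H.deg]; omega)
  have e : ∫ θ, circExp ((i + 1 : ℕ) : ℤ) θ * onCirc (φ p) θ *
      (circExp (-(p + 2 * i + 1 : ℕ)) θ * onCirc (φ (p + (i + 1))) θ) ∂μ = 0 := by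
    rw [← h0]; congr 1; ext θ
    have : circExp ((i + 1 : ℕ) : ℤ) θ * circExp (-(p + 2 * i + 1 : ℕ)) θ =
        circExp (-(p + i : ℕ)) θ := by rw [← circExp_add]; congr 1; push_cast; ring
    linear_combination onCirc (φ p) θ * onCirc (φ (p + (i + 1))) θ * this
  rw [e, sub_zero, verbMom]
  congr 2; ext θ
  have : circExp (1 - (p + (i + 1) : ℕ)) θ * circExp (-(i + 1 : ℕ)) θ =
      circExp (-(p + 2 * i + 1 : ℕ)) θ := by rw [← circExp_add]; congr 1; push_cast; ring
  linear_combination onCirc (φ (p + (i + 1))) θ ^ 2 * this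

lemma norm_coeff_le (H : IsOPUC μ φ κ) {G : ℝ} (hG : 0 < G) (hS : SzegoLower μ G) (j : ℕ) :
    ∃ K : ℝ, 0 ≤ K ∧ ∀ n, j < n →
      ‖(φ n).coeff j‖ ≤ K * verbSum μ φ (n - (j + 1)) (j + 1) := by
  obtain ⟨K, hK, h⟩ := exists_coeff_bound H.contInt hG hS j
  refine ⟨K * 2, by positivity, fun n hn => ?_⟩
  obtain ⟨p, rfl⟩ := Nat.exists_eq_add_of_le' (Nat.succ_le_of_lt hn)
  have h1 := h (φ (p + (j + 1)) - X ^ (j + 1) * φ p)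
  rw [coeff_sub, coeff_X_pow_mul', if_neg (by omega), sub_zero] at h1
  have h2 := H.wNorm_add_sub p (j + 1)
  rw [Nat.succ_eq_add_one, Nat.add_sub_cancel, mul_assoc]
  refine h1.trans (mul_le_mul_of_nonneg_left (le_of_eq_of_le (wNorm_congr fun θ => ?_) h2) hK)
  rw [onCirc_sub, onCirc_mul, onCirc_X_pow]

lemma norm_integral_circExp_mul_le (H : IsOPUC μ φ κ) {n : ℕ} (hn : 1 ≤ n) (i : ℕ) :
    ‖∫ θ, circExp i θ * onCirc (φ n) θ ∂μ‖ ≤ 2 * verbSum μ φ n i * wNorm μ fun _ => 1 := by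
  have h := H.norm_integral_sub_mul_le n i (f := fun _ => 1) (by fun_prop)
  refine le_of_eq_of_le ?_ h
  simp only [mul_one]
  have h0 := H.integral_mul_circExp_neg (j := 0) (n := n + i) (by omega)
  simp only [Nat.cast_zero, neg_zero, circExp_zero, mul_one] at h0
  rw [integral_sub (H.contInt _ (by fun_prop)) (H.contInt _ (by fun_prop)), h0, zero_sub, norm_neg]

lemma norm_wInner_eulerDefect_right_le (H : IsOPUC μ φ κ) {G : ℝ} (hG : 0 < G)
    (hS : SzegoLower μ G) (l : ℕ) :
    ∃ K : ℝ, 0 ≤ K ∧ ∀ n, l < n → ∀ m, l ≤ m → m ≤ n →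
      ‖wInner μ (onCirc (X ^ l * φ n)) (onCirc (eulerDefect φ n))‖ ≤
        K * n * verbSum μ φ (n - m) (2 * m + 1) ^ 2 := by
  choose K hK0 hK using fun j => H.norm_coeff_le hG hS j
  set B := wNorm μ fun _ => 1
  have hB : 0 ≤ B := wNorm_nonneg _
  refine ⟨∑ j ∈ Finset.range l, 2 * K j * B,
    Finset.sum_nonneg fun j _ => by have := hK0 j; positivity, fun n hn m hlm hmn => ?_⟩
  set q := verbSum μ φ (n - m) (2 * m + 1)
  have hq : 0 ≤ q := verbSum_nonneg _ _
  have hdeg : (eulerDefect φ n).natDegree < n + 1 := by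
    refine Nat.lt_succ_of_le (natDegree_le_iff_coeff_eq_zero.2 fun j hj => ?_)
    rw [eulerDefect_coeff, coeff_eq_zero_of_natDegree_lt (by rw [H.deg]; omega), mul_zero]
  have h1 : onCirc (eulerDefect φ n) =
      fun θ => ∑ j ∈ Finset.range (n + 1), (eulerDefect φ n).coeff j * circExp j θ := by
    ext θ; exact onCirc_eq_sum hdeg θ
  rw [h1, wInner_sum_right H.contInt _ (fun i _ => by fun_prop) (by fun_prop)]
  simp only [wInner_smul_right]
  rw [← Finset.sum_subset (Finset.range_mono (by omega : l ≤ n + 1)), Finset.sum_mul, Finset.sum_mul]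
  · refine (norm_sum_le _ _).trans (Finset.sum_le_sum fun j hj => ?_)
    have hj := Finset.mem_range.1 hj
    rw [norm_mul, RCLike.norm_conj, eulerDefect_coeff, norm_mul]
    have e1 : ‖(j : ℂ) - n‖ ≤ n := by
      have : (j : ℂ) - n = -((n - j : ℕ) : ℂ) := by rw [Nat.cast_sub (by omega)]; ring
      rw [this, norm_neg, Complex.norm_natCast]; exact_mod_cast Nat.sub_le _ _
    have e2 : ‖(φ n).coeff j‖ ≤ K j * q := (hK j n (by omega)).trans
      (mul_le_mul_of_nonneg_left (verbSum_mono (by omega) (by omega)) (hK0 j))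
    have e3 : ‖wInner μ (onCirc (X ^ l * φ n)) (circExp j)‖ ≤ 2 * q * B := by
      have := H.norm_integral_circExp_mul_le (n := n) (by omega) (l - j)
      refine le_of_eq_of_le ?_ (this.trans (mul_le_mul_of_nonneg_right
        (mul_le_mul_of_nonneg_left (verbSum_mono (by omega) (by omega)) (by norm_num)) hB))
      rw [wInner]; congr 2; ext θ
      rw [onCirc_mul, onCirc_X_pow, circExp_conj]
      have : circExp l θ * circExp (-j) θ = circExp (l - j : ℕ) θ := by
        rw [← circExp_add]; congr 1; omega
      linear_combination onCirc (φ n) θ * this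
    have e4 : 0 ≤ n * (K j * q) := mul_nonneg n.cast_nonneg (mul_nonneg (hK0 j) hq)
    calc _ ≤ (n * (K j * q)) * (2 * q * B) := by gcongr
      _ = _ := by ring
  · intro j hj hj'
    have hj := Finset.mem_range.1 hj
    have hj' : l ≤ j := by simpa using hj'
    rcases Nat.eq_or_lt_of_le (Nat.le_of_lt_succ hj) with rfl | hjn
    · rw [eulerDefect_coeff]; simp
    have h0 := H.integral_mul_circExp_neg (j := j - l) (n := n) (by omega)
    have : wInner μ (onCirc (X ^ l * φ n)) (circExp j) = 0 := by
      rw [← h0, wInner]; congr 1; ext θ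
      rw [onCirc_mul, onCirc_X_pow, circExp_conj]
      have : circExp l θ * circExp (-j) θ = circExp (-(j - l : ℕ)) θ := by
        rw [← circExp_add]; congr 1; omega
      linear_combination onCirc (φ n) θ * this
    rw [this, mul_zero]

/-- Recursion for the coefficients of `φ n` counted from the top. -/
lemma coeff_top_recursion (H : IsOPUC μ φ κ) {n i : ℕ} (hi : i < n) :
    ((κ n / κ (n + 1) : ℝ) : ℂ) * (φ (n + 1)).coeff (n + 1 - (i + 1)) =
      (φ n).coeff (n - (i + 1)) - verb μ φ n * (starRingEnd ℂ) ((φ n).coeff i) := by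
  have h := congrArg (fun P => P.coeff (n - i)) (H.recursion n)
  simp only [coeff_sub, coeff_C_mul] at h
  rw [show n + 1 - (i + 1) = n - i by omega, ← h, starPoly_coeff _ (by omega),
    show n - (n - i) = i by omega]
  obtain ⟨p, hp⟩ : ∃ p, n - i = p + 1 := ⟨n - i - 1, by omega⟩
  rw [hp, coeff_X_mul, show n - (i + 1) = p by omega]

end IsOPUC

end

section

variable {μ : Measure ℝ} {φ : ℕ → ℂ[X]} {κ : ℕ → ℝ}

/-- Associativity of Cauchy products. -/
lemma sum_antidiagonal_assoc {R : Type*} [CommRing R] (t d e : ℕ → R) (l : ℕ) :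
    ∑ p ∈ Finset.HasAntidiagonal.antidiagonal l,
        t p.1 * ∑ q ∈ Finset.HasAntidiagonal.antidiagonal p.2, d q.1 * e q.2 =
      ∑ p ∈ Finset.HasAntidiagonal.antidiagonal l,
        (∑ q ∈ Finset.HasAntidiagonal.antidiagonal p.1, t q.1 * d q.2) * e p.2 := by
  have h := congrArg (PowerSeries.coeff l)
    (mul_assoc (PowerSeries.mk t) (PowerSeries.mk d) (PowerSeries.mk e))
  simpa only [PowerSeries.coeff_mul, PowerSeries.coeff_mk] using h.symm

/-- The deviation of the trigonometric moments of `|φ n| ^ 2` from those of Lebesgue measure. -/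
noncomputable def sqDev (μ : Measure ℝ) (φ : ℕ → ℂ[X]) (n : ℕ) (j : ℤ) : ℂ :=
  sqMom μ φ n j - if j = 0 then 1 else 0

lemma invPow_zero : invPow 0 = fun _ => 1 := by ext; simp [invPow]

lemma isBigO_invPow_congr {f g : ℕ → ℂ} {k N : ℕ} (h : ∀ n, N ≤ n → f n = g n)
    (hg : g =O[atTop] invPow k) : f =O[atTop] invPow k :=
  hg.congr' (eventually_atTop.2 ⟨N, fun n hn => (h n hn).symm⟩) EventuallyEq.rfl

lemma isBigO_invPow_const_mul {f : ℕ → ℂ} {k : ℕ} (c : ℂ) (hf : f =O[atTop] invPow k) :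
    (fun n => c * f n) =O[atTop] invPow k := hf.const_mul_left c

section Rhs

variable {ι : Type*} [Fintype ι] {a : ι → ℂ} {β : ι → ℝ} {g : ℤ → ℂ} {T d : ℕ → ℂ} {k : ℕ} {C : ℝ}

lemma wInner_eulerDefect_zero (H : IsOPUC μ φ κ) (n : ℕ) :
    wInner μ (onCirc (eulerDefect φ n)) (onCirc (φ n)) = 0 := by
  have hc : ∀ j, n ≤ j → (eulerDefect φ n).coeff j = 0 := fun j hj => by
    rw [eulerDefect_coeff]
    rcases hj.eq_or_lt with rfl | hj
    · simp
    · rw [coeff_eq_zero_of_natDegree_lt (by rw [H.deg]; omega), mul_zero]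
  rcases Nat.eq_zero_or_pos n with rfl | hn
  · have : eulerDefect φ 0 = 0 := by ext j; simpa using hc j (Nat.zero_le _)
    simp [this, wInner, onCirc]
  · have hd : (eulerDefect φ n).natDegree < n + 0 :=
      (Nat.lt_iff_le_pred hn).2 (natDegree_le_iff_coeff_eq_zero.2 fun j hj => hc j (by omega))
    rw [H.wInner_eq_sum_topMom hd]; simp

/-- Main estimate for the right-hand side of the linear system for the principal values. -/
lemma IsOPUC.pvRhs_add_isBigO (H : IsOPUC μ φ κ)
    (hg : Summable fun j : ℤ => ‖g j‖ * (1 + |(j : ℝ)|))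
    (hT : ∀ l : ℕ, T (l + 1) = ∑ k, β k * a k ^ (l + 1) + g (-(l + 1 : ℕ)))
    (hg0 : g 0 = 0)
    (hd : ∀ i : ℕ, ((i + 1 : ℕ) : ℂ) * d (i + 1) =
      ∑ q ∈ Finset.HasAntidiagonal.antidiagonal i, T (q.1 + 1) * d q.2)
    (hφd : ∀ i, (fun n => (φ n).coeff (n - i) - d i) =O[atTop] invPow k)
    (hs : ∀ n, 1 ≤ n → ∀ j : ℤ, ‖sqDev μ φ n j‖ ≤ C * (1 + |(j : ℝ)|) * invPow k n) (l : ℕ) :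
    (fun n => pvRhs μ φ a β g n l +
      wInner μ (onCirc (X ^ l * φ n)) (onCirc (eulerDefect φ n))) =O[atTop] invPow k := by
  have hs1 : ∀ j, (fun n => sqDev μ φ n j) =O[atTop] invPow k := fun j => by
    refine Asymptotics.IsBigO.of_bound (C * (1 + |(j : ℝ)|)) ?_
    filter_upwards [eventually_ge_atTop 1] with n hn
    rw [Real.norm_of_nonneg (invPow_nonneg _ _)]; exact hs n hn j
  have hgs : Summable fun j => ‖g j‖ :=
    hg.of_nonneg_of_le (fun _ => norm_nonneg _) fun j =>
      le_mul_of_one_le_right (norm_nonneg _) (by linarith [abs_nonneg (j : ℝ)])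
  have hsum : ∀ n, Summable fun j => g j * sqMom μ φ n (l + j) := fun n =>
    Summable.of_norm (hgs.of_nonneg_of_le (fun _ => norm_nonneg _) fun j => by
      rw [norm_mul]; exact mul_le_of_le_one_right (norm_nonneg _) (H.norm_sqMom_le_one _ _))
  have hts : ∀ n, ∑' j, g j * sqMom μ φ n (l + j) = ∑' j, g j * sqDev μ φ n (l + j) + g (-l) := by
    intro n
    have h1 : ∀ j, g j * sqDev μ φ n (l + j) = g j * sqMom μ φ n (l + j) -
        if j = -l then g (-l) else 0 := fun j => by
      rw [sqDev]
      by_cases hj : j = -l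
      · subst hj; simp [mul_sub]
      · rw [if_neg hj, if_neg (by omega)]; simp
    simp only [h1]
    rw [(hsum n).tsum_sub (hasSum_ite_eq _ _).summable, tsum_ite_eq]; ring
  have htsO : (fun n => ∑' j, g j * sqDev μ φ n (l + j)) =O[atTop] invPow k := by
    refine Asymptotics.IsBigO.of_bound (∑' j, ‖g j‖ * (1 + |(j : ℝ)|) * (C * (1 + l))) ?_
    filter_upwards [eventually_ge_atTop 1] with n hn
    rw [Real.norm_of_nonneg (invPow_nonneg _ _), ← tsum_mul_right]
    have hCi : 0 ≤ C * invPow k n := by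
      have := (norm_nonneg _).trans (hs n hn 0); simpa using this
    refine tsum_of_norm_bounded ((hg.mul_right _).mul_right _).hasSum fun j => ?_
    rw [norm_mul]
    have h2 : (1 + |((l + j : ℤ) : ℝ)|) ≤ (1 + l) * (1 + |(j : ℝ)|) := by
      push_cast
      have := abs_add_le (l : ℝ) j
      rw [Nat.abs_cast] at this
      nlinarith [abs_nonneg (j : ℝ), (Nat.cast_nonneg l : (0 : ℝ) ≤ l),
        mul_nonneg (Nat.cast_nonneg l : (0 : ℝ) ≤ l) (abs_nonneg (j : ℝ))]
    calc _ ≤ ‖g j‖ * (C * (1 + |((l + j : ℤ) : ℝ)|) * invPow k n) := by gcongr; exact hs n hn _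
      _ = ‖g j‖ * ((C * invPow k n) * (1 + |((l + j : ℤ) : ℝ)|)) := by ring
      _ ≤ ‖g j‖ * ((C * invPow k n) * ((1 + l) * (1 + |(j : ℝ)|))) := by gcongr
      _ = _ := by ring
  cases l with
  | zero =>
    refine isBigO_invPow_congr (N := 0) (fun n _ => ?_) htsO
    rw [pvRhs, hts n]
    simp only [pow_zero, one_mul, wInner_eulerDefect_zero H]
    simp [hg0]
  | succ l =>
    set Err : ℕ → ℕ → ℂ := fun i n => ((i + 1 : ℕ) : ℂ) * (φ n).coeff (n - (i + 1)) -
      ∑ q ∈ Finset.HasAntidiagonal.antidiagonal i, T (q.1 + 1) * (φ n).coeff (n - q.2) with hErr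
    have hErrO : ∀ i, Err i =O[atTop] invPow k := fun i => by
      have : Err i = fun n => ((i + 1 : ℕ) : ℂ) * ((φ n).coeff (n - (i + 1)) - d (i + 1)) -
          ∑ q ∈ Finset.HasAntidiagonal.antidiagonal i,
            T (q.1 + 1) * ((φ n).coeff (n - q.2) - d q.2) := by
        ext n; simp only [hErr, mul_sub, Finset.sum_sub_distrib, hd i]; ring
      rw [this]
      exact (isBigO_invPow_const_mul _ (hφd _)).sub
        (Asymptotics.IsBigO.fun_sum fun q _ => isBigO_invPow_const_mul _ (hφd _))
    have htop : ∀ i, (fun n => topMom μ φ n i) =O[atTop] invPow 0 := fun i =>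
      isBigO_invPow_zero fun n => H.norm_topMom_le n i
    have hmain : (fun n => ((l + 1 : ℕ) : ℂ) * sqDev μ φ n ((l + 1 : ℕ) : ℤ) -
        ∑ p ∈ Finset.HasAntidiagonal.antidiagonal l, Err p.1 n * topMom μ φ n p.2 +
        ∑' j, g j * sqDev μ φ n ((l + 1 : ℕ) + j) +
        ∑ k, (β k : ℂ) * ∑ i ∈ Finset.range (l + 1),
          a k ^ (l - i) * (sqDev μ φ n (i + 1) + a k * sqDev μ φ n i) -
        ∑ p ∈ Finset.HasAntidiagonal.antidiagonal l, T (p.1 + 1) * sqDev μ φ n p.2) =O[atTop]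
          invPow k := by
      refine ((((isBigO_invPow_const_mul _ (hs1 _)).sub (Asymptotics.IsBigO.fun_sum fun p _ => ?_)).add
        htsO).add (Asymptotics.IsBigO.fun_sum fun k _ => isBigO_invPow_const_mul _
          (Asymptotics.IsBigO.fun_sum fun i _ => isBigO_invPow_const_mul _
            ((hs1 _).add (isBigO_invPow_const_mul _ (hs1 _)))))).sub
        (Asymptotics.IsBigO.fun_sum fun p _ => isBigO_invPow_const_mul _ (hs1 _))
      simpa using isBigO_invPow_mul (hErrO p.1) (htop p.2)
    refine isBigO_invPow_congr (N := l + 1) (fun n hn => ?_) hmain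
    have hsq : ∀ j, sqMom μ φ n j = sqDev μ φ n j + if j = 0 then 1 else 0 := fun j => by
      rw [sqDev]; ring
    have e1 : ∑ p ∈ Finset.HasAntidiagonal.antidiagonal l, T (p.1 + 1) * sqMom μ φ n p.2 =
        ∑ p ∈ Finset.HasAntidiagonal.antidiagonal l,
          (∑ q ∈ Finset.HasAntidiagonal.antidiagonal p.1, T (q.1 + 1) * (φ n).coeff (n - q.2)) *
            topMom μ φ n p.2 := by
      rw [← sum_antidiagonal_assoc (fun i => T (i + 1)) (fun i => (φ n).coeff (n - i))]
      refine Finset.sum_congr rfl fun p hp => ?_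
      have := Finset.HasAntidiagonal.mem_antidiagonal.1 hp
      rw [H.sqMom_eq_sum (by omega)]
    have e2 : ∑ p ∈ Finset.HasAntidiagonal.antidiagonal l, T (p.1 + 1) * sqMom μ φ n p.2 =
        ∑ p ∈ Finset.HasAntidiagonal.antidiagonal l, T (p.1 + 1) * sqDev μ φ n p.2 + T (l + 1) := by
      simp only [hsq, mul_add, Finset.sum_add_distrib, add_right_inj]
      rw [Finset.sum_eq_single (l, 0)]
      · simp
      · rintro ⟨p, q⟩ hp hne
        have := Finset.HasAntidiagonal.mem_antidiagonal.1 hp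
        rw [if_neg, mul_zero]
        rintro hq
        apply hne
        simp only at this hq
        ext <;> simp <;> omega
      · intro h; exact absurd (Finset.HasAntidiagonal.mem_antidiagonal.2 (add_zero l)) h
    have e3 : ∀ k, ∑ i ∈ Finset.range (l + 1), a k ^ (l - i) *
          (sqMom μ φ n (i + 1) + a k * sqMom μ φ n i) =
        ∑ i ∈ Finset.range (l + 1), a k ^ (l - i) *
          (sqDev μ φ n (i + 1) + a k * sqDev μ φ n i) + a k ^ (l + 1) := fun k => by
      rw [← sub_eq_iff_eq_add', ← Finset.sum_sub_distrib, Finset.sum_eq_single 0]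
      · rw [hsq, hsq ((0 : ℕ) : ℤ), if_neg (by simp), if_pos (by simp), Nat.sub_zero]; ring
      · intro i _ hi
        rw [hsq, hsq i, if_neg (by omega), if_neg (by omega)]; ring
      · simp
    rw [pvRhs, hts n, H.wInner_eulerDefect (by omega)]
    have e4 : ∑ k, (β k : ℂ) * ∑ i ∈ Finset.range (l + 1), a k ^ (l - i) *
          (sqMom μ φ n (i + 1) + a k * sqMom μ φ n i) =
        ∑ k, (β k : ℂ) * ∑ i ∈ Finset.range (l + 1), a k ^ (l - i) *
          (sqDev μ φ n (i + 1) + a k * sqDev μ φ n i) + ∑ k, β k * a k ^ (l + 1) := by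
      rw [← Finset.sum_add_distrib]
      exact Finset.sum_congr rfl fun k _ => by rw [e3, mul_add]
    rw [Nat.add_sub_cancel, e4]
    rw [hsq ((l + 1 : ℕ) : ℤ), if_neg (by omega)]
    simp only [hErr, sub_mul, Finset.sum_sub_distrib]
    rw [← e1, e2, hT l]
    ring

end Rhs

end

section

variable {μ : Measure ℝ} {φ : ℕ → ℂ[X]} {κ : ℕ → ℝ}
variable {ι : Type*} [Fintype ι] {a : ι → ℂ} {β : ι → ℝ} {g : ℤ → ℂ} {Cf : ι → (ℝ → ℂ) → ℂ}
  {G : ℝ} {T d : ℕ → ℂ}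

lemma exists_vandermonde_dual (ha : Function.Injective a) :
    ∃ (N : ℕ) (c : ι → ℕ → ℂ), ∀ (y : ι → ℂ) k,
      y k = ∑ l ∈ Finset.range N, c k l * ∑ j, y j * a j ^ l := by
  classical
  refine ⟨(Finset.univ.sup fun k => (Lagrange.basis Finset.univ a k).natDegree) + 1,
    fun k l => (Lagrange.basis Finset.univ a k).coeff l, fun y k => ?_⟩
  have h : ∀ j, ∑ l ∈ Finset.range ((Finset.univ.sup fun k =>
      (Lagrange.basis Finset.univ a k).natDegree) + 1),
      (Lagrange.basis Finset.univ a k).coeff l * a j ^ l = if k = j then 1 else 0 := fun j => by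
    rw [← eval_eq_sum_range' (Nat.lt_succ_of_le (Finset.le_sup
      (f := fun k => (Lagrange.basis Finset.univ a k).natDegree) (Finset.mem_univ k)))]
    split_ifs with hkj
    · subst hkj; exact Lagrange.eval_basis_self ha.injOn (Finset.mem_univ _)
    · exact Lagrange.eval_basis_of_ne hkj (Finset.mem_univ _)
  simp only [Finset.mul_sum]
  rw [Finset.sum_comm]
  have h2 : ∀ j, ∑ l ∈ Finset.range ((Finset.univ.sup fun k =>
      (Lagrange.basis Finset.univ a k).natDegree) + 1),
      (Lagrange.basis Finset.univ a k).coeff l * (y j * a j ^ l) = if k = j then y j else 0 :=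
    fun j => by
      simp only [mul_left_comm, ← Finset.mul_sum, h]; split_ifs <;> simp
  simp only [h2, Finset.sum_ite_eq, Finset.mem_univ, if_true]

/-- The analytic input for the asymptotics of the leading coefficients. -/
structure SzegoData (μ : Measure ℝ) (φ : ℕ → ℂ[X]) (κ : ℕ → ℝ) (a : ι → ℂ) (β : ι → ℝ) (g : ℤ → ℂ)
    (Cf : ι → (ℝ → ℂ) → ℂ) (G : ℝ) (T d : ℕ → ℂ) : Prop where
  opuc : IsOPUC μ φ κ
  pv : IsPV μ a β g Cf
  norm_a : ∀ k, ‖a k‖ = 1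
  inj : Function.Injective a
  summable : Summable fun j : ℤ => ‖g j‖ * (1 + |(j : ℝ)|)
  g_zero : g 0 = 0
  G_pos : 0 < G
  lower : SzegoLower μ G
  upper : SzegoUpper μ G fun i => (starRingEnd ℂ) (d i)
  T_eq : ∀ l : ℕ, T (l + 1) = ∑ k, β k * a k ^ (l + 1) + g (-(l + 1 : ℕ))
  rec_d : ∀ i : ℕ, ((i + 1 : ℕ) : ℂ) * d (i + 1) =
      ∑ q ∈ Finset.HasAntidiagonal.antidiagonal i, T (q.1 + 1) * d q.2

namespace SzegoData

lemma summable_norm (S : SzegoData μ φ κ a β g Cf G T d) : Summable fun j => ‖g j‖ :=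
  S.summable.of_nonneg_of_le (fun _ => norm_nonneg _) fun j =>
    le_mul_of_one_le_right (norm_nonneg _) (by linarith [abs_nonneg (j : ℝ)])

lemma eval_ne_zero (S : SzegoData μ φ κ a β g Cf G T d) (n : ℕ) (k : ι) :
    (φ n).eval (a k) ≠ 0 := by
  rcases Nat.eq_zero_or_pos n with rfl | hn
  · rw [eq_C_of_natDegree_eq_zero (S.opuc.deg 0), eval_C, S.opuc.lead]
    exact_mod_cast (S.opuc.pos 0).ne'
  · exact S.opuc.eval_ne_zero S.pv S.norm_a hn k

lemma norm_phase (S : SzegoData μ φ κ a β g Cf G T d) (k : ι) (n : ℕ) : ‖phase φ a k n‖ = 1 := by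
  rw [phase, norm_mul, norm_zpow, S.norm_a, one_zpow, one_mul, norm_div, RCLike.norm_conj,
    div_self (norm_ne_zero_iff.2 (S.eval_ne_zero n k))]

lemma tendsto_coeff (S : SzegoData μ φ κ a β g Cf G T d) (i : ℕ) :
    Tendsto (fun n => (φ n).coeff (n - i)) atTop (𝓝 ((√G⁻¹ : ℝ) * d i)) := by
  have h := S.opuc.tendsto_star_coeff S.G_pos S.lower S.upper i
  have h2 := (Complex.continuous_conj.tendsto _).comp h
  simp only [map_mul, Complex.conj_conj, Complex.conj_ofReal] at h2
  refine h2.congr' ?_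
  filter_upwards [eventually_ge_atTop i] with n hn
  simp [starPoly_coeff _ hn]

lemma rec_smul (S : SzegoData μ φ κ a β g Cf G T d) (i : ℕ) :
    ((i + 1 : ℕ) : ℂ) * ((√G⁻¹ : ℝ) * d (i + 1)) =
      ∑ q ∈ Finset.HasAntidiagonal.antidiagonal i, T (q.1 + 1) * ((√G⁻¹ : ℝ) * d q.2) := by
  simp only [mul_left_comm _ ((√G⁻¹ : ℝ) : ℂ), ← Finset.mul_sum, S.rec_d i]

/-- The deviation of the right-hand side, given a rate for the moments and the coefficients. -/
lemma pvRhs_add_isBigO (S : SzegoData μ φ κ a β g Cf G T d) {k : ℕ} {C : ℝ}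
    (hφd : ∀ i, (fun n => (φ n).coeff (n - i) - (√G⁻¹ : ℝ) * d i) =O[atTop] invPow k)
    (hs : ∀ n, 1 ≤ n → ∀ j : ℤ, ‖sqDev μ φ n j‖ ≤ C * (1 + |(j : ℝ)|) * invPow k n) (l : ℕ) :
    (fun n => pvRhs μ φ a β g n l +
      wInner μ (onCirc (X ^ l * φ n)) (onCirc (eulerDefect φ n))) =O[atTop] invPow k :=
  S.opuc.pvRhs_add_isBigO S.summable S.T_eq S.g_zero S.rec_smul hφd hs l

lemma norm_sqDev_zero (S : SzegoData μ φ κ a β g Cf G T d) (n : ℕ) : sqDev μ φ n 0 = 0 := by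
  rw [sqDev, S.opuc.sqMom_zero, if_pos rfl, sub_self]

lemma sqDev_of_ne {n : ℕ} {j : ℤ} (hj : j ≠ 0) : sqDev μ φ n j = sqMom μ φ n j := by
  rw [sqDev, if_neg hj, sub_zero]

lemma exists_pvRhs_le (S : SzegoData μ φ κ a β g Cf G T d) (m : ℕ) :
    ∃ (C : ℝ) (N : ℕ), 0 ≤ C ∧ ∀ n, N ≤ n → ∀ l ≤ m,
      ‖pvRhs μ φ a β g n l‖ ≤ C + C * n * verbSum μ φ (n - m) (2 * m + 1) ^ 2 := by
  have h0 : ∀ l, ∃ (C : ℝ) (N : ℕ), 0 ≤ C ∧ ∀ n, N ≤ n → l ≤ m →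
      ‖pvRhs μ φ a β g n l‖ ≤ C + C * n * verbSum μ φ (n - m) (2 * m + 1) ^ 2 := fun l => by
    have h1 := S.pvRhs_add_isBigO (k := 0) (C := 1)
      (fun i => by
        rw [invPow_zero]
        exact ((S.tendsto_coeff i).sub_const _).isBigO_one ℝ) (fun n _ j => by
        rw [invPow_zero, one_mul, mul_one]
        by_cases hj : j = 0
        · subst hj; rw [S.norm_sqDev_zero]; simp
        · rw [sqDev_of_ne hj]
          exact (S.opuc.norm_sqMom_le_one n j).trans (by linarith [abs_nonneg (j : ℝ)])) l
    obtain ⟨C, hC, N, hN, h⟩ := exists_bound_of_isBigO_invPow h1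
    obtain ⟨K, hK, h2⟩ := S.opuc.norm_wInner_eulerDefect_right_le S.G_pos S.lower l
    refine ⟨C + K, N + m + 1, by positivity, fun n hn hl => ?_⟩
    have e1 := h n (by omega)
    rw [pow_zero, div_one] at e1
    have e2 := h2 n (by omega) m hl (by omega)
    have e3 := norm_sub_le (pvRhs μ φ a β g n l +
      wInner μ (onCirc (X ^ l * φ n)) (onCirc (eulerDefect φ n)))
      (wInner μ (onCirc (X ^ l * φ n)) (onCirc (eulerDefect φ n)))
    rw [add_sub_cancel_right] at e3
    have : 0 ≤ C * n * verbSum μ φ (n - m) (2 * m + 1) ^ 2 := by positivity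
    nlinarith
  choose C N hC h using h0
  refine ⟨∑ l ∈ Finset.range (m + 1), C l, ∑ l ∈ Finset.range (m + 1), N l,
    Finset.sum_nonneg fun l _ => hC l, fun n hn l hl => ?_⟩
  have e1 : C l ≤ ∑ l ∈ Finset.range (m + 1), C l :=
    Finset.single_le_sum (fun l _ => hC l) (Finset.mem_range.2 (by omega))
  have e2 : N l ≤ ∑ l ∈ Finset.range (m + 1), N l :=
    Finset.single_le_sum (fun l _ => Nat.zero_le _) (Finset.mem_range.2 (by omega))
  refine (h l n (e2.trans hn) hl).trans ?_
  gcongr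

lemma norm_tsum_mul_le (S : SzegoData μ φ κ a β g Cf G T d) {f : ℤ → ℂ} {C : ℝ}
    (hf : ∀ j, ‖f j‖ ≤ C * (1 + |(j : ℝ)|)) :
    ‖∑' j, g j * f j‖ ≤ (∑' j, ‖g j‖ * (1 + |(j : ℝ)|)) * C := by
  rw [← tsum_mul_right]
  refine tsum_of_norm_bounded (S.summable.mul_right _).hasSum fun j => ?_
  rw [norm_mul, mul_assoc, mul_comm _ C]
  exact mul_le_mul_of_nonneg_left (hf j) (norm_nonneg _)

lemma verb_isBigO (S : SzegoData μ φ κ a β g Cf G T d) :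
    (fun n => ‖verb μ φ n‖) =O[atTop] invPow 1 := by
  obtain ⟨m, c, hc⟩ := exists_vandermonde_dual S.inj
  obtain ⟨C, N, hC, h⟩ := S.exists_pvRhs_le m
  set A := ∑ k, |β k|
  have hA : 0 ≤ A := Finset.sum_nonneg fun _ _ => abs_nonneg _
  set B := ∑' j, ‖g j‖ * (1 + |(j : ℝ)|)
  have hB : 0 ≤ B := tsum_nonneg fun j => by positivity
  set M := ∑ k, ∑ l ∈ Finset.range m, ‖c k l‖
  have hM : 0 ≤ M := Finset.sum_nonneg fun _ _ => Finset.sum_nonneg fun _ _ => norm_nonneg _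
  refine exists_bound_of_bootstrap (m := m) (N := N + 1) (C := A + A + B + M * C)
    (fun n => norm_nonneg _) (S.opuc.tendsto_verb S.G_pos S.lower S.upper) (by positivity)
    fun n hn => ?_
  change _ ≤ _ + _ * n * verbSum μ φ (n - m) (2 * m + 1) ^ 2
  set q := verbSum μ φ (n - m) (2 * m + 1)
  have hid := S.opuc.verb_identity S.pv S.norm_a (n := n) (by omega)
  have e0 : ∀ u : ι → ℂ, (∀ k, ‖u k‖ ≤ 1) → ‖∑ k, (β k : ℂ) * u k‖ ≤ A := fun u hu => by
    refine (norm_sum_le _ _).trans (Finset.sum_le_sum fun k _ => ?_)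
    rw [norm_mul, Complex.norm_real, Real.norm_eq_abs]
    exact mul_le_of_le_one_right (abs_nonneg _) (hu k)
  have e1 := e0 (fun k => phase φ a k n) fun k => (S.norm_phase k n).le
  have e2 := e0 (fun _ => verb μ φ n) fun _ => (S.opuc.norm_verb_lt_one n).le
  have e3 := S.norm_tsum_mul_le (f := verbMom μ φ n) (C := 1) fun j =>
    (S.opuc.norm_verbMom_le_one n j).trans (by linarith [abs_nonneg (j : ℝ)])
  have e4 : ‖∑ k, phase φ a k n * (β k * pvSq φ Cf n k)‖ ≤ M * (C + C * n * q ^ 2) := by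
    rw [Finset.sum_mul]
    refine (norm_sum_le _ _).trans (Finset.sum_le_sum fun k _ => ?_)
    rw [norm_mul, S.norm_phase, one_mul, hc (fun k => β k * pvSq φ Cf n k) k, Finset.sum_mul]
    refine (norm_sum_le _ _).trans (Finset.sum_le_sum fun l hl => ?_)
    rw [S.opuc.pvSq_system S.pv, norm_mul, norm_mul, norm_neg, Complex.norm_I, one_mul]
    exact mul_le_mul_of_nonneg_left (h n (by omega) l (Finset.mem_range.1 hl).le) (norm_nonneg _)
  have e5 : ‖((n : ℂ) + 1) * verb μ φ n‖ ≤ A + (B * 1 + A + M * (C + C * n * q ^ 2)) := by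
    rw [show ((n : ℂ) + 1) * verb μ φ n = -(∑ k, β k * phase φ a k n) +
      (-(∑' j, g j * verbMom μ φ n j) - ∑ k, β k * verb μ φ n +
        Complex.I * ∑ k, phase φ a k n * (β k * pvSq φ Cf n k)) by linear_combination hid]
    refine (norm_add_le _ _).trans (add_le_add (by rwa [norm_neg]) ((norm_add_le _ _).trans
      (add_le_add ((norm_sub_le _ _).trans (add_le_add (by rwa [norm_neg]) e2)) ?_)))
    rwa [norm_mul, Complex.norm_I, one_mul]
  rw [norm_mul, show ((n : ℂ) + 1) = ((n + 1 : ℕ) : ℂ) by push_cast; ring, Complex.norm_natCast] at e5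
  push_cast at e5
  have : 0 ≤ (A + A + B) * (n * q ^ 2) := by positivity
  nlinarith [norm_nonneg (verb μ φ n)]

lemma exists_verb_le (S : SzegoData μ φ κ a β g Cf G T d) :
    ∃ C : ℝ, 0 ≤ C ∧ ∀ n, 1 ≤ n → ∀ i, verbSum μ φ n i ≤ C * i / n := by
  obtain ⟨C, hC, N, hN, h⟩ := exists_bound_of_isBigO_invPow S.verb_isBigO
  have hb : ∀ n, 1 ≤ n → ‖verb μ φ n‖ ≤ (C + N) / n := fun n hn => by
    have hn' : (0 : ℝ) < n := by exact_mod_cast hn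
    rcases le_total N n with h1 | h1
    · have := h n h1
      rw [norm_norm, pow_one] at this
      refine this.trans ?_
      gcongr; simp
    · refine (S.opuc.norm_verb_lt_one n).le.trans ?_
      rw [one_le_div hn']
      have : (n : ℝ) ≤ N := by exact_mod_cast h1
      linarith
  refine ⟨C + N, by positivity, fun n hn i => ?_⟩
  have hn' : (0 : ℝ) < n := by exact_mod_cast hn
  refine (Finset.sum_le_card_nsmul _ _ ((C + N) / n) fun j _ => (hb (n + j) (by omega)).trans ?_).trans ?_
  · gcongr; simp
  · simp only [Finset.card_range, nsmul_eq_mul]; exact le_of_eq (by ring)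

lemma exists_verbSum_sub_le (S : SzegoData μ φ κ a β g Cf G T d) (m i : ℕ) :
    (fun n => verbSum μ φ (n - m) i) =O[atTop] invPow 1 := by
  obtain ⟨C, hC, h⟩ := S.exists_verb_le
  refine isBigO_invPow (N := 2 * m + 1) (C := 2 * C * i) fun n hn hn1 => ?_
  rw [Real.norm_of_nonneg (verbSum_nonneg _ _), pow_one]
  refine (h (n - m) (by omega) i).trans ?_
  have h1 : (0 : ℝ) < n := by exact_mod_cast hn1
  have h2 : (n : ℝ) ≤ 2 * (n - m : ℕ) := by exact_mod_cast (by omega : n ≤ 2 * (n - m))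
  rw [div_le_div_iff₀ (by linarith) h1]
  nlinarith [mul_nonneg hC (Nat.cast_nonneg i : (0 : ℝ) ≤ i)]

end SzegoData

end

section

variable {μ : Measure ℝ} {φ : ℕ → ℂ[X]} {κ : ℕ → ℝ}
variable {ι : Type*} [Fintype ι] {a : ι → ℂ} {β : ι → ℝ} {g : ℤ → ℂ} {Cf : ι → (ℝ → ℂ) → ℂ}
  {G : ℝ} {T d : ℕ → ℂ}

lemma eval_starPoly {n : ℕ} {P : ℂ[X]} (hP : P.natDegree ≤ n) {z : ℂ} (hz : ‖z‖ = 1) :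
    (starPoly n P).eval z = z ^ n * (starRingEnd ℂ) (P.eval z) := by
  have h : circExp 1 z.arg = z := by
    rw [circExp_one]; have := Complex.norm_mul_exp_arg_mul_I z; rwa [hz, Complex.ofReal_one, one_mul] at this
  have := onCirc_starPoly hP z.arg
  rw [onCirc, onCirc, h] at this
  have h3 : circExp n z.arg = z ^ n := by rw [circExp_eq_zpow, h, zpow_natCast]
  rw [this, h3]

namespace SzegoData

lemma phase_succ (S : SzegoData μ φ κ a β g Cf G T d) (k : ι) (n : ℕ) :
    phase φ a k (n + 1) * (1 - (starRingEnd ℂ) (verb μ φ n) * phase φ a k n) =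
      a k * (phase φ a k n - verb μ φ n) := by
  have h0 : a k ≠ 0 := by intro h; have := S.norm_a k; simp [h] at this
  have hca : (starRingEnd ℂ) (a k) = (a k)⁻¹ := by
    rw [Complex.inv_def, Complex.normSq_eq_norm_sq, S.norm_a]; simp
  have hr := congrArg (fun P => P.eval (a k)) (S.opuc.recursion n)
  simp only [eval_sub, eval_mul, eval_X, eval_C] at hr
  rw [eval_starPoly (S.opuc.deg n).le (S.norm_a k)] at hr
  set r := κ n / κ (n + 1) with hrdef
  have hr0 : (r : ℂ) ≠ 0 := by
    exact_mod_cast (div_pos (S.opuc.pos n) (S.opuc.pos (n + 1))).ne'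
  set P := (φ n).eval (a k)
  set P' := (φ (n + 1)).eval (a k)
  have hP : P ≠ 0 := S.eval_ne_zero n k
  have hP' : P' ≠ 0 := S.eval_ne_zero (n + 1) k
  have hr' := congrArg (starRingEnd ℂ) hr
  simp only [map_sub, map_mul, map_pow, Complex.conj_conj, hca, Complex.conj_ofReal] at hr'
  set Q := (starRingEnd ℂ) P
  set Q' := (starRingEnd ℂ) P'
  have hQ : Q ≠ 0 := (_root_.map_ne_zero _).2 hP
  have hQ' : Q' ≠ 0 := (_root_.map_ne_zero _).2 hP'
  have e1 : (a k) ^ (1 - (n : ℤ)) = a k * (a k ^ n)⁻¹ := by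
    rw [zpow_sub₀ h0, zpow_one, zpow_natCast, div_eq_mul_inv]
  have e2 : (a k) ^ (1 - ((n + 1 : ℕ) : ℤ)) = (a k ^ n)⁻¹ := by
    rw [show (1 - ((n + 1 : ℕ) : ℤ)) = -(n : ℤ) by push_cast; ring, zpow_neg, zpow_natCast]
  have key : (r : ℂ) * (P' * (Q - (starRingEnd ℂ) (verb μ φ n) * (a k * (a k ^ n)⁻¹ * P))) =
      r * (a k * Q' * (a k * P - verb μ φ n * (a k ^ n * Q))) := by
    rw [hr, show (starRingEnd ℂ) (verb μ φ n) * (a k * (a k ^ n)⁻¹ * P) =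
      a k * ((starRingEnd ℂ) (verb μ φ n) * ((a k)⁻¹ ^ n * P)) by rw [inv_pow]; ring]
    have : Q = a k * ((a k)⁻¹ * Q) := by field_simp
    linear_combination r * P' * this + r * P' * a k * hr'
  have key2 := mul_left_cancel₀ hr0 key
  have hz : (a k) ^ n ≠ 0 := pow_ne_zero _ h0
  rw [phase, phase, e1, e2]
  set z := a k ^ n
  change z⁻¹ * (P' / Q') * (1 - (starRingEnd ℂ) (verb μ φ n) * (a k * z⁻¹ * (P / Q))) =
    a k * (a k * z⁻¹ * (P / Q) - verb μ φ n)
  have l1 : z⁻¹ * (P' / Q') * (1 - (starRingEnd ℂ) (verb μ φ n) * (a k * z⁻¹ * (P / Q))) =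
      (z * Q * Q')⁻¹ * (P' * (Q - (starRingEnd ℂ) (verb μ φ n) * (a k * z⁻¹ * P))) := by
    field_simp
  rw [l1, key2]
  field_simp

lemma phase_isBigO (S : SzegoData μ φ κ a β g Cf G T d) (k : ι) :
    (fun n => phase φ a k (n + 1) - a k * phase φ a k n) =O[atTop] invPow 1 := by
  refine Asymptotics.IsBigO.trans (Asymptotics.IsBigO.of_bound 2 (Eventually.of_forall fun n => ?_))
    S.verb_isBigO
  have h := S.phase_succ k n
  have : phase φ a k (n + 1) - a k * phase φ a k n = phase φ a k (n + 1) *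
      (starRingEnd ℂ) (verb μ φ n) * phase φ a k n - a k * verb μ φ n := by linear_combination h
  rw [this, norm_norm]
  refine (norm_sub_le _ _).trans ?_
  rw [norm_mul, norm_mul, norm_mul, S.norm_phase, S.norm_phase, S.norm_a, RCLike.norm_conj]
  linarith

lemma exists_sqDev_le (S : SzegoData μ φ κ a β g Cf G T d) :
    ∃ C : ℝ, ∀ n, 1 ≤ n → ∀ j : ℤ, ‖sqDev μ φ n j‖ ≤ C * (1 + |(j : ℝ)|) * invPow 1 n := by
  obtain ⟨C, hC, h⟩ := S.exists_verb_le
  refine ⟨2 * C, fun n hn j => ?_⟩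
  have hi := invPow_nonneg 1 n
  by_cases hj : j = 0
  · subst hj; rw [S.norm_sqDev_zero, norm_zero]; positivity
  rw [sqDev_of_ne hj]
  refine (S.opuc.norm_sqMom_le_natAbs n hj).trans ?_
  have h1 := h n hn j.natAbs
  rw [Nat.cast_natAbs, Int.cast_abs] at h1
  have h2 : C * |(j : ℝ)| / n = C * |(j : ℝ)| * invPow 1 n := by rw [invPow, pow_one, div_eq_mul_inv]
  rw [h2] at h1
  have := mul_nonneg hC hi
  nlinarith

lemma exists_verbMom_le (S : SzegoData μ φ κ a β g Cf G T d) :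
    ∃ C : ℝ, ∀ n, 1 ≤ n → ∀ j : ℤ, ‖verbMom μ φ n j‖ ≤ C / n * (1 + |(j : ℝ)|) := by
  obtain ⟨C, hC, h⟩ := S.exists_verb_le
  refine ⟨4 * C + 2, fun n hn j => ?_⟩
  have hn0 : (0 : ℝ) < n := by exact_mod_cast hn
  obtain ⟨i, rfl | rfl⟩ := j.eq_nat_or_neg
  · refine (S.opuc.norm_verbMom_le n i).trans ?_
    have h1 := h n hn (i + 1)
    push_cast at h1 ⊢
    rw [Nat.abs_cast, div_mul_eq_mul_div, le_div_iff₀ hn0]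
    rw [le_div_iff₀ hn0] at h1
    nlinarith [mul_nonneg hC (Nat.cast_nonneg i : (0 : ℝ) ≤ i), (Nat.cast_nonneg i : (0 : ℝ) ≤ i)]
  · have habs : |((-(i : ℤ) : ℤ) : ℝ)| = i := by push_cast; rw [abs_neg, Nat.abs_cast]
    rw [habs, div_mul_eq_mul_div, le_div_iff₀ hn0]
    rcases le_or_gt n (2 * i) with h1 | h1
    · have e1 := S.opuc.norm_verbMom_le_one n (-(i : ℤ))
      have e2 : (n : ℝ) ≤ 2 * i := by exact_mod_cast h1
      nlinarith [norm_nonneg (verbMom μ φ n (-(i : ℤ))),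
        mul_nonneg hC (Nat.cast_nonneg i : (0 : ℝ) ≤ i)]
    cases i with
    | zero =>
      have e1 := S.opuc.norm_verbMom_le n 0
      have e2 := h n hn 1
      rw [Nat.cast_zero] at e1
      rw [le_div_iff₀ hn0] at e2
      simp only [Nat.cast_zero, neg_zero]
      simp only [Nat.cast_one, zero_add] at e1 e2
      nlinarith
    | succ i =>
      have e1 := S.opuc.norm_verbMom_neg_le (n := n) (i := i) (by omega)
      have e2 := h (n - (i + 1)) (by omega) (i + 1)
      have e3 : (n : ℝ) ≤ 2 * (n - (i + 1) : ℕ) := by exact_mod_cast (by omega : n ≤ 2 * (n - (i + 1)))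
      rw [le_div_iff₀ (by linarith)] at e2
      have hv := verbSum_nonneg (μ := μ) (φ := φ) (n - (i + 1)) (i + 1)
      have hc := mul_nonneg hC (Nat.cast_nonneg (i + 1) : (0 : ℝ) ≤ (i + 1 : ℕ))
      nlinarith [(Nat.cast_nonneg (i + 1) : (0 : ℝ) ≤ (i + 1 : ℕ))]

lemma verb_isBigO' (S : SzegoData μ φ κ a β g Cf G T d) :
    (fun n => verb μ φ n) =O[atTop] invPow 1 := S.verb_isBigO.of_norm_left

lemma one_sub_rho_isBigO (S : SzegoData μ φ κ a β g Cf G T d) :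
    (fun n => 1 - ((κ n / κ (n + 1) : ℝ) : ℂ)) =O[atTop] invPow 2 := by
  refine Asymptotics.IsBigO.trans (Asymptotics.IsBigO.of_bound 1 (Eventually.of_forall fun n => ?_))
    (isBigO_invPow_mul S.verb_isBigO S.verb_isBigO)
  rw [← Complex.ofReal_one, ← Complex.ofReal_sub, Complex.norm_real,
    Real.norm_of_nonneg (sub_nonneg.2 (S.opuc.rho_le_one n)), one_mul, norm_mul, norm_norm, ← sq]
  exact S.opuc.one_sub_rho_le n

lemma coeff_sub_isBigO (S : SzegoData μ φ κ a β g Cf G T d) (i : ℕ) :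
    (fun n => (φ n).coeff (n - i) - (√G⁻¹ : ℝ) * d i) =O[atTop] invPow 1 := by
  refine isBigO_sub_limit_one (S.tendsto_coeff i) ?_
  have hbd : (fun n => (φ (n + 1)).coeff (n + 1 - i)) =O[atTop] invPow 0 := by
    rw [invPow_zero]
    exact ((S.tendsto_coeff i).comp (tendsto_add_atTop_nat 1)).isBigO_one ℝ
  have h1 := isBigO_invPow_mul S.one_sub_rho_isBigO hbd
  cases i with
  | zero =>
    refine isBigO_invPow_congr (N := 0) (fun n _ => ?_) h1
    simp only [Nat.sub_zero, S.opuc.lead]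
    have : ((κ n / κ (n + 1) : ℝ) : ℂ) * κ (n + 1) = κ n := by
      rw [← Complex.ofReal_mul, div_mul_cancel₀ _ (S.opuc.pos _).ne']
    linear_combination this
  | succ i =>
    have hc : (fun n => (φ n).coeff i) =O[atTop] invPow 1 := by
      obtain ⟨K, hK, h⟩ := S.opuc.norm_coeff_le S.G_pos S.lower i
      refine Asymptotics.IsBigO.trans (Asymptotics.IsBigO.of_bound K ?_)
        (S.exists_verbSum_sub_le (i + 1) (i + 1))
      filter_upwards [eventually_gt_atTop i] with n hn
      rw [Real.norm_of_nonneg (verbSum_nonneg _ _)]; exact h n hn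
    have h2 := isBigO_invPow_mul S.verb_isBigO' (isBigO_invPow_conj hc)
    refine isBigO_invPow_congr (N := i + 1) (fun n hn => ?_) (h1.sub h2)
    have := S.opuc.coeff_top_recursion (n := n) (i := i) (by omega)
    linear_combination this

lemma pvRhs_isBigO (S : SzegoData μ φ κ a β g Cf G T d) (l : ℕ) :
    (fun n => pvRhs μ φ a β g n l) =O[atTop] invPow 1 := by
  obtain ⟨C, hs⟩ := S.exists_sqDev_le
  have h1 := S.pvRhs_add_isBigO S.coeff_sub_isBigO hs l
  obtain ⟨K, hK, h⟩ := S.opuc.norm_wInner_eulerDefect_right_le S.G_pos S.lower l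
  have h2 : (fun n => wInner μ (onCirc (X ^ l * φ n)) (onCirc (eulerDefect φ n))) =O[atTop]
      invPow 1 := by
    have hq := S.exists_verbSum_sub_le l (2 * l + 1)
    obtain ⟨A, hA, N, hN, hq⟩ := exists_bound_of_isBigO_invPow (isBigO_invPow_mul hq hq)
    refine isBigO_invPow (N := N + l + 1) (C := K * A) fun n hn hn1 => ?_
    have hn0 : (0 : ℝ) < n := by exact_mod_cast hn1
    refine (h n (by omega) l le_rfl (by omega)).trans ?_
    have := hq n (by omega)
    rw [← sq, Real.norm_of_nonneg (sq_nonneg _)] at this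
    calc _ ≤ K * n * (A / n ^ 2) := by gcongr
      _ = _ := by field_simp
  refine isBigO_invPow_congr (N := 0) (fun n _ => ?_) (h1.sub h2)
  ring

lemma pvSq_isBigO (S : SzegoData μ φ κ a β g Cf G T d) (k : ι) :
    (fun n => β k * pvSq φ Cf n k) =O[atTop] invPow 1 := by
  obtain ⟨m, c, hc⟩ := exists_vandermonde_dual S.inj
  refine isBigO_invPow_congr (N := 0) (fun n _ => hc (fun k => β k * pvSq φ Cf n k) k) ?_
  refine Asymptotics.IsBigO.fun_sum fun l _ => isBigO_invPow_const_mul _ ?_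
  simp only [S.opuc.pvSq_system S.pv]
  exact isBigO_invPow_const_mul _ (S.pvRhs_isBigO l)

lemma verb_add_isBigO (S : SzegoData μ φ κ a β g Cf G T d) :
    (fun n : ℕ => ((n : ℂ) + 1) * verb μ φ n + ∑ k, β k * phase φ a k n) =O[atTop] invPow 1 := by
  obtain ⟨C, h⟩ := S.exists_verbMom_le
  have h1 : (fun n => ∑' j, g j * verbMom μ φ n j) =O[atTop] invPow 1 := by
    refine isBigO_invPow (N := 1) (C := (∑' j, ‖g j‖ * (1 + |(j : ℝ)|)) * C) fun n _ hn => ?_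
    rw [pow_one, mul_div_assoc]
    exact S.norm_tsum_mul_le (h n hn)
  have h2 : (fun n => ∑ k, phase φ a k n * (β k * pvSq φ Cf n k)) =O[atTop] invPow 1 :=
    Asymptotics.IsBigO.fun_sum fun k _ => by
      simpa using isBigO_invPow_mul (isBigO_invPow_zero (C := 1) fun n => (S.norm_phase k n).le)
        (S.pvSq_isBigO k)
  refine isBigO_invPow_congr (N := 1)
    (fun n hn => S.opuc.verb_identity S.pv S.norm_a hn) ?_
  exact (h1.neg_left.sub (Asymptotics.IsBigO.fun_sum fun k _ =>
    isBigO_invPow_const_mul _ S.verb_isBigO')).add (isBigO_invPow_const_mul _ h2)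

/-- The asymptotic expansion of the leading coefficients. -/
lemma kappa_isBigO (S : SzegoData μ φ κ a β g Cf G T d) :
    (fun n : ℕ => ((G * κ n ^ 2 - 1 + (∑ k, β k ^ 2) / (n + 1) : ℝ) : ℂ)) =O[atTop] invPow 2 := by
  refine asymptotics_of_oscillation (x := fun n => G * κ n ^ 2) S.norm_a S.inj β S.norm_phase
    S.phase_isBigO S.verb_add_isBigO ?_ fun n => ?_
  · have := (S.opuc.tendsto_kappa_sq S.G_pos S.lower S.upper).const_mul G
    rwa [mul_inv_cancel₀ S.G_pos.ne'] at this
  · have h := S.opuc.rho_sq n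
    have h1 : κ (n + 1) ≠ 0 := (S.opuc.pos _).ne'
    field_simp at h
    linear_combination -G * h

end SzegoData

end

lemma circExp_eq_one_arg {a : ℂ} (ha : ‖a‖ = 1) : circExp 1 a.arg = a := by
  rw [circExp_one]
  simpa [ha] using Complex.norm_mul_exp_arg_mul_I a

lemma norm_circExp_sub_node {a : ℂ} (ha : ‖a‖ = 1) (θ : ℝ) :
    ‖circExp 1 θ - a‖ = 2 * |Real.sin ((θ - a.arg) / 2)| := by
  have h1 : circExp 1 θ - a = a * (Complex.exp (Complex.I * ((θ - a.arg : ℝ) : ℂ)) - 1) := by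
    nth_rw 1 2 [← circExp_eq_one_arg ha]
    rw [circExp_one, circExp_one, mul_sub, ← Complex.exp_add, mul_one]
    congr 2; push_cast; ring
  rw [h1, norm_mul, ha, one_mul, Complex.norm_exp_I_mul_ofReal_sub_one]
  simp

lemma circExp_periodic (j : ℤ) : Function.Periodic (circExp j) (2 * π) := by
  intro θ
  unfold circExp
  rw [Complex.exp_eq_exp_iff_exists_int]
  exact ⟨j, by push_cast; ring⟩

lemma countable_node (a : ℂ) : {θ : ℝ | circExp 1 θ = a}.Countable := by
  rcases Set.eq_empty_or_nonempty {θ : ℝ | circExp 1 θ = a} with h | ⟨θ₀, h₀⟩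
  · rw [h]; exact Set.countable_empty
  · refine (Set.countable_range fun n : ℤ => θ₀ + n * (2 * π)).mono fun θ hθ => ?_
    have h : circExp 1 θ = circExp 1 θ₀ := Eq.trans hθ (Eq.symm h₀)
    rw [circExp_one, circExp_one, Complex.exp_eq_exp_iff_exists_int] at h
    obtain ⟨n, hn⟩ := h
    refine ⟨n, ?_⟩
    have h2 : (θ : ℂ) = θ₀ + n * (2 * π) := by
      have := congrArg (· * (-Complex.I)) hn
      simp only [mul_assoc, add_mul] at this
      simp at this
      linear_combination this
    have : θ = θ₀ + n * (2 * π) := by exact_mod_cast h2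
    exact this.symm

lemma rpow_two_abs_sin_le {s t : ℝ} (ht : |t| ≤ π) :
    (2 * |Real.sin (t / 2)|) ^ s ≤ 2 ^ |s| + (2 / π) ^ s * |t| ^ s := by
  have hπ := Real.pi_pos
  have h1 : 2 / π * |t| ≤ 2 * |Real.sin (t / 2)| := by
    have := Real.mul_abs_le_abs_sin (x := t / 2) (by rw [abs_div]; norm_num; linarith)
    rw [abs_div] at this; norm_num at this
    rw [show 2 / π * |t| = 2 * (|t| / π) by ring]; linarith
  have h2 : 2 * |Real.sin (t / 2)| ≤ 2 := by linarith [Real.abs_sin_le_one (t / 2)]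
  have h0 : 0 ≤ (2 / π) ^ s * |t| ^ s := by positivity
  rcases le_or_gt 0 s with hs | hs
  · have := Real.rpow_le_rpow (by positivity) h2 hs
    rw [abs_of_nonneg hs]; linarith
  · rcases eq_or_ne t 0 with rfl | ht0
    · simp [Real.zero_rpow hs.ne]; positivity
    · rw [← Real.mul_rpow (by positivity) (by positivity)]
      have h3 := Real.rpow_le_rpow_of_nonpos (by positivity) h1 hs.le
      have : (0:ℝ) ≤ 2 ^ |s| := by positivity
      linarith

lemma intervalIntegrable_abs_rpow {s : ℝ} (hs : -1 < s) {c : ℝ} :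
    IntervalIntegrable (fun t : ℝ => |t| ^ s) volume (-c) c := by
  have h : ∀ c : ℝ, 0 ≤ c → IntervalIntegrable (fun t : ℝ => |t| ^ s) volume 0 c := by
    intro c hc
    refine (intervalIntegral.intervalIntegrable_rpow' (a := 0) (b := c) hs).congr ?_
    intro t ht
    rw [uIoc_of_le hc] at ht
    simp [abs_of_pos ht.1]
  have h' : ∀ c : ℝ, 0 ≤ c → IntervalIntegrable (fun t : ℝ => |t| ^ s) volume (-c) c := by
    intro c hc
    refine IntervalIntegrable.trans (b := 0) ?_ (h c hc)
    have := (IntervalIntegrable.iff_comp_neg (f := fun t : ℝ => |t| ^ s) (a := 0) (b := c)).1 (h c hc)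
    simpa using this.symm
  rcases le_total 0 c with hc | hc
  · exact h' c hc
  · simpa using (h' (-c) (by linarith)).symm

lemma intervalIntegrable_node {a : ℂ} (ha : ‖a‖ = 1) {s : ℝ} (hs : -1 < s) (x y : ℝ) :
    IntervalIntegrable (fun θ => ‖circExp 1 θ - a‖ ^ s) volume x y := by
  have hper : Function.Periodic (fun θ => ‖circExp 1 θ - a‖ ^ s) (2 * π) := fun θ => by
    simp only [circExp_periodic 1 θ]
  have h1 : IntervalIntegrable (fun t : ℝ => (2 * |Real.sin (t / 2)|) ^ s) volume (-π) π := by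
    refine IntervalIntegrable.mono_fun
      ((intervalIntegrable_const (c := (2 : ℝ) ^ |s|)).add
        ((intervalIntegrable_abs_rpow (c := π) hs).const_mul ((2 / π) ^ s))) ?_ ?_
    · exact Measurable.aestronglyMeasurable (by fun_prop)
    · refine (ae_restrict_iff' measurableSet_uIoc).2 (Eventually.of_forall fun t ht => ?_)
      rw [uIoc_of_le (by linarith [Real.pi_pos])] at ht
      have h := rpow_two_abs_sin_le (s := s) (t := t) (abs_le.2 ⟨ht.1.le, ht.2⟩)
      beta_reduce
      rw [Real.norm_of_nonneg (by positivity)]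
      exact h.trans (le_abs_self _)
  have h2 := h1.comp_sub_right a.arg
  refine hper.intervalIntegrable (t := -π + a.arg) (by positivity) ?_ x y
  rw [show -π + a.arg + 2 * π = π + a.arg by ring]
  simp only [norm_circExp_sub_node ha]
  exact h2

lemma exists_separation {ι : Type*} [Finite ι] {a : ι → ℂ} (hinj : Function.Injective a) :
    ∃ δ > 0, ∀ k j, k ≠ j → δ < ‖a k - a j‖ := by
  have : ∀ᶠ δ in 𝓝[>] (0 : ℝ), ∀ k j, k ≠ j → δ < ‖a k - a j‖ := by
    refine eventually_all.2 fun k => eventually_all.2 fun j => ?_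
    rcases eq_or_ne k j with rfl | h
    · simp
    · have h0 : 0 < ‖a k - a j‖ := norm_pos_iff.2 (sub_ne_zero.2 (hinj.ne h))
      filter_upwards [nhdsWithin_le_nhds (gt_mem_nhds h0)] with δ hδ _ using hδ
  obtain ⟨δ, h1, h2⟩ := (this.and self_mem_nhdsWithin).exists
  exact ⟨δ, h2, h1⟩

lemma norm_circExp_sub_le_two {a : ℂ} (ha : ‖a‖ = 1) (θ : ℝ) : ‖circExp 1 θ - a‖ ≤ 2 := by
  refine (norm_sub_le _ _).trans ?_
  rw [norm_circExp, ha]; norm_num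

lemma exists_prod_rpow_le {ι : Type*} [Fintype ι] {a : ι → ℂ} (ha : ∀ k, ‖a k‖ = 1)
    (hinj : Function.Injective a) (s : ι → ℝ) :
    ∃ B : ℝ, 0 ≤ B ∧ ∀ θ, ∏ k, ‖circExp 1 θ - a k‖ ^ s k ≤
      B * (1 + ∑ k, ‖circExp 1 θ - a k‖ ^ s k) := by
  classical
  obtain ⟨δ, hδ, hsep⟩ := exists_separation hinj
  set B : ℝ := 1 + ∑ k, (2 ^ s k + (δ / 2) ^ s k) with hB
  have hB1 : 1 ≤ B := by
    have : 0 ≤ ∑ k, ((2:ℝ) ^ s k + (δ / 2) ^ s k) := Finset.sum_nonneg fun k _ => by positivity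
    linarith
  have hBk : ∀ k, (2:ℝ) ^ s k + (δ / 2) ^ s k ≤ B := fun k => by
    have := Finset.single_le_sum (f := fun k => (2:ℝ) ^ s k + (δ / 2) ^ s k)
      (fun k _ => by positivity) (Finset.mem_univ k)
    linarith
  have hx : ∀ k (x : ℝ), δ / 2 ≤ x → x ≤ 2 → x ^ s k ≤ B := by
    intro k x h1 h2
    refine le_trans ?_ (hBk k)
    rcases le_or_gt 0 (s k) with h | h
    · have := Real.rpow_le_rpow (by linarith) h2 h
      have : 0 ≤ (δ / 2) ^ s k := by positivity
      linarith
    · have := Real.rpow_le_rpow_of_nonpos (by positivity) h1 h.le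
      have : (0:ℝ) ≤ 2 ^ s k := by positivity
      linarith
  refine ⟨B ^ Fintype.card ι, by positivity, fun θ => ?_⟩
  by_cases hk : ∃ k, ‖circExp 1 θ - a k‖ < δ / 2
  · obtain ⟨k, hk⟩ := hk
    have hother : ∀ j ∈ Finset.univ.erase k, ‖circExp 1 θ - a j‖ ^ s j ≤ B := by
      intro j hj
      refine hx j _ ?_ (norm_circExp_sub_le_two (ha j) θ)
      have h1 := hsep k j (Finset.ne_of_mem_erase hj).symm
      have h2 : ‖a k - a j‖ ≤ ‖circExp 1 θ - a j‖ + ‖circExp 1 θ - a k‖ := by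
        rw [show a k - a j = (circExp 1 θ - a j) - (circExp 1 θ - a k) by ring]
        exact norm_sub_le _ _
      linarith
    rw [← Finset.mul_prod_erase _ _ (Finset.mem_univ k)]
    have h1 : ∏ j ∈ Finset.univ.erase k, ‖circExp 1 θ - a j‖ ^ s j ≤ B ^ Fintype.card ι := by
      refine (Finset.prod_le_prod (fun j _ => by positivity) hother).trans ?_
      rw [Finset.prod_const]
      exact pow_le_pow_right₀ hB1 (Finset.card_le_univ _)
    have h2 : ‖circExp 1 θ - a k‖ ^ s k ≤ 1 + ∑ k, ‖circExp 1 θ - a k‖ ^ s k := by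
      have := Finset.single_le_sum (f := fun k => ‖circExp 1 θ - a k‖ ^ s k)
        (fun k _ => by positivity) (Finset.mem_univ k)
      linarith
    rw [mul_comm]
    gcongr
  · push Not at hk
    have h1 : ∏ j, ‖circExp 1 θ - a j‖ ^ s j ≤ B ^ Fintype.card ι := by
      refine (Finset.prod_le_prod (fun j _ => by positivity)
        (fun j _ => hx j _ (hk j) (norm_circExp_sub_le_two (ha j) θ))).trans ?_
      rw [Finset.prod_const, Finset.card_univ]
    have h2 : 0 ≤ ∑ k, ‖circExp 1 θ - a k‖ ^ s k := Finset.sum_nonneg fun k _ => by positivity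
    refine h1.trans (le_mul_of_one_le_right (by positivity) (by linarith))

lemma intervalIntegrable_prod_node {ι : Type*} [Fintype ι] {a : ι → ℂ} (ha : ∀ k, ‖a k‖ = 1)
    (hinj : Function.Injective a) {s : ι → ℝ} (hs : ∀ k, -1 < s k) (x y : ℝ) :
    IntervalIntegrable (fun θ => ∏ k, ‖circExp 1 θ - a k‖ ^ s k) volume x y := by
  obtain ⟨B, hB, h⟩ := exists_prod_rpow_le ha hinj s
  have hsum : IntervalIntegrable (fun θ => ∑ k, ‖circExp 1 θ - a k‖ ^ s k) volume x y := by
    have := IntervalIntegrable.sum Finset.univ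
      (f := fun k θ => ‖circExp 1 θ - a k‖ ^ s k) (μ := volume) (a := x) (b := y)
      fun k _ => intervalIntegrable_node (ha k) (hs k) x y
    simpa [Finset.sum_fn] using this
  refine IntervalIntegrable.mono_fun
      (((intervalIntegrable_const (c := (1 : ℝ))).add hsum).const_mul B) ?_ ?_
  · exact Measurable.aestronglyMeasurable (Finset.measurable_fun_prod _ fun k _ =>
      ((((continuous_circExp 1).sub continuous_const).norm).measurable.pow_const _))
  · refine Eventually.of_forall fun θ => ?_
    beta_reduce
    rw [Real.norm_of_nonneg (Finset.prod_nonneg fun k _ => by positivity)]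
    exact (h θ).trans (le_abs_self _)

/-- The generalized Jacobi density `v θ * ∏ |e^{iθ} - a k| ^ (2 β k)`. -/
noncomputable def jacobiDensity {ι : Type*} [Fintype ι] (a : ι → ℂ) (β : ι → ℝ) (v : ℝ → ℝ)
    (θ : ℝ) : ℝ := v θ * ∏ k, ‖circExp 1 θ - a k‖ ^ (2 * β k)

/-- The measure on `(0, 2π]` with a generalized Jacobi density. -/
noncomputable def jacobiMeasure {ι : Type*} [Fintype ι] (a : ι → ℂ) (β : ι → ℝ) (v : ℝ → ℝ) :
    Measure ℝ :=
  (volume.restrict (Ioc 0 (2 * π))).withDensity fun θ => ENNReal.ofReal (jacobiDensity a β v θ)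

/-- Admissible parameters of a generalized Jacobi weight: `v` is a smooth positive periodic
function whose logarithmic derivative `γ` has the Fourier coefficients `I * g j`. -/
structure IsJacobi {ι : Type*} [Fintype ι] (a : ι → ℂ) (β : ι → ℝ) (v γ : ℝ → ℝ) (g : ℤ → ℂ) :
    Prop where
  norm_a : ∀ k, ‖a k‖ = 1
  inj : Function.Injective a
  beta_lt : ∀ k, -(1 / 2) < β k
  v_pos : ∀ θ, 0 < v θ
  v_periodic : Function.Periodic v (2 * π)
  v_deriv : ∀ θ, HasDerivAt v (v θ * γ θ) θ
  summable : Summable fun j : ℤ => ‖g j‖ * (1 + |(j : ℝ)|)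
  gamma_eq : ∀ θ, (γ θ : ℂ) = Complex.I * ∑' j, g j * circExp j θ

namespace IsJacobi

variable {ι : Type*} [Fintype ι] {a : ι → ℂ} {β : ι → ℝ} {v γ : ℝ → ℝ} {g : ℤ → ℂ}

lemma v_continuous (H : IsJacobi a β v γ g) : Continuous v :=
  continuous_iff_continuousAt.2 fun θ => (H.v_deriv θ).continuousAt

lemma summable_norm (H : IsJacobi a β v γ g) : Summable fun j : ℤ => ‖g j‖ :=
  H.summable.of_nonneg_of_le (fun _ => norm_nonneg _) fun j =>
    le_mul_of_one_le_right (norm_nonneg _) (by linarith [abs_nonneg (j : ℝ)])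

lemma gamma_continuous (H : IsJacobi a β v γ g) : Continuous γ := by
  have h : Continuous fun θ => Complex.I * ∑' j, g j * circExp j θ :=
    continuous_const.mul (continuous_tsum (fun j => continuous_const.mul (continuous_circExp j))
      H.summable_norm fun j θ => by rw [norm_mul, norm_circExp, mul_one])
  have : γ = fun θ => (Complex.I * ∑' j, g j * circExp j θ).re := by
    ext θ; rw [← H.gamma_eq θ, Complex.ofReal_re]
  rw [this]; exact Complex.continuous_re.comp h

lemma density_nonneg (H : IsJacobi a β v γ g) (θ : ℝ) : 0 ≤ jacobiDensity a β v θ :=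
  mul_nonneg (H.v_pos θ).le (Finset.prod_nonneg fun k _ => by positivity)

lemma density_measurable (H : IsJacobi a β v γ g) : Measurable (jacobiDensity a β v) :=
  H.v_continuous.measurable.mul (Finset.measurable_fun_prod _ fun _ _ =>
      ((((continuous_circExp 1).sub continuous_const).norm).measurable.pow_const _))

lemma density_integrable (H : IsJacobi a β v γ g) (x y : ℝ) :
    IntervalIntegrable (jacobiDensity a β v) volume x y :=
  (intervalIntegrable_prod_node H.norm_a H.inj
    (fun k => by linarith [H.beta_lt k]) x y).continuousOn_mul H.v_continuous.continuousOn

lemma integral_eq (H : IsJacobi a β v γ g) {E : Type*} [NormedAddCommGroup E] [NormedSpace ℝ E]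
    (F : ℝ → E) :
    ∫ θ, F θ ∂(jacobiMeasure a β v) = ∫ θ in (0 : ℝ)..(2 * π), jacobiDensity a β v θ • F θ := by
  rw [jacobiMeasure, integral_withDensity_eq_integral_toReal_smul
    H.density_measurable.ennreal_ofReal (by simp), intervalIntegral.integral_of_le (by positivity)]
  simp only [ENNReal.toReal_ofReal (H.density_nonneg _)]

lemma integrable_iff (H : IsJacobi a β v γ g) {E : Type*} [NormedAddCommGroup E] [NormedSpace ℝ E]
    (F : ℝ → E) :
    Integrable F (jacobiMeasure a β v) ↔
      IntervalIntegrable (fun θ => jacobiDensity a β v θ • F θ) volume 0 (2 * π) := by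
  rw [jacobiMeasure, MeasureTheory.integrable_withDensity_iff_integrable_smul'
    H.density_measurable.ennreal_ofReal (by simp),
    intervalIntegrable_iff_integrableOn_Ioc_of_le (by positivity), IntegrableOn]
  simp only [ENNReal.toReal_ofReal (H.density_nonneg _)]

lemma integrable_of_continuous (H : IsJacobi a β v γ g) {E : Type*} [NormedAddCommGroup E]
    [NormedSpace ℝ E] {F : ℝ → E} (hF : Continuous F) : Integrable F (jacobiMeasure a β v) := by
  rw [H.integrable_iff]
  exact (H.density_integrable _ _).smul_continuousOn hF.continuousOn

lemma contInt (H : IsJacobi a β v γ g) : ContInt (jacobiMeasure a β v) :=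
  fun _ hf => H.integrable_of_continuous hf

lemma countable_nodes (a : ι → ℂ) : {θ : ℝ | ∃ k, circExp 1 θ = a k}.Countable := by
  rw [Set.ofPred_exists]
  exact Set.countable_iUnion fun k => countable_node (a k)

lemma ae_ne : ∀ᵐ θ ∂(jacobiMeasure a β v), ∀ k, circExp 1 θ ≠ a k := by
  refine (withDensity_absolutelyContinuous _ _).ae_le ?_
  refine ae_restrict_of_ae ?_
  have := (countable_nodes a).ae_notMem volume
  filter_upwards [this] with θ hθ k hk using hθ ⟨k, hk⟩

end IsJacobi

/-- The derivative of `2 log |e^{iθ} - a|`. -/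
noncomputable def cotKernel (a : ℂ) (θ : ℝ) : ℝ :=
  (Complex.I * (circExp 1 θ + a) / (circExp 1 θ - a)).re

lemma cotKernel_eq {a : ℂ} (ha : ‖a‖ = 1) {θ : ℝ} (h : circExp 1 θ ≠ a) :
    (circExp 1 θ - a) * cotKernel a θ = Complex.I * (circExp 1 θ + a) := by
  set z := circExp 1 θ with hz
  have hz1 : ‖z‖ = 1 := norm_circExp 1 θ
  have hz0 : z ≠ 0 := norm_ne_zero_iff.1 (by rw [hz1]; norm_num)
  have ha0 : a ≠ 0 := norm_ne_zero_iff.1 (by rw [ha]; norm_num)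
  have hza : z - a ≠ 0 := sub_ne_zero.2 h
  have hcz : (starRingEnd ℂ) z = z⁻¹ := (Complex.inv_eq_conj hz1).symm
  have hca : (starRingEnd ℂ) a = a⁻¹ := (Complex.inv_eq_conj ha).symm
  have hreal : (starRingEnd ℂ) (Complex.I * (z + a) / (z - a)) = Complex.I * (z + a) / (z - a) := by
    have h2 : z⁻¹ - a⁻¹ ≠ 0 := sub_ne_zero.2 fun e => h (inv_injective e)
    simp only [map_div₀, map_mul, map_add, map_sub, Complex.conj_I, hcz, hca]
    rw [div_eq_div_iff h2 hza]
    field_simp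
    ring
  have : (cotKernel a θ : ℂ) = Complex.I * (z + a) / (z - a) := by
    rw [cotKernel, ← hz]; exact Complex.conj_eq_iff_re.1 hreal
  rw [this]; field_simp

lemma hasDerivAt_norm_rpow_node {a : ℂ} (ha : ‖a‖ = 1) {θ : ℝ} (h : circExp 1 θ ≠ a) (b : ℝ) :
    HasDerivAt (fun θ => ‖circExp 1 θ - a‖ ^ (2 * b))
      (‖circExp 1 θ - a‖ ^ (2 * b) * (b * cotKernel a θ)) θ := by
  have hx : 0 < ‖circExp 1 θ - a‖ := norm_pos_iff.2 (sub_ne_zero.2 h)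
  have h1 : HasDerivAt (fun θ => circExp 1 θ - a) (Complex.I * circExp 1 θ) θ := by
    simpa using (hasDerivAt_circExp 1 θ).sub_const a
  have h2 := h1.norm_sq
  have h3 := h2.rpow_const (p := b) (Or.inl (by simpa using hx.ne'))
  have key : 2 * inner ℝ (circExp 1 θ - a) (Complex.I * circExp 1 θ) =
      ‖circExp 1 θ - a‖ ^ 2 * cotKernel a θ := by
    have hk := cotKernel_eq ha h
    set z := circExp 1 θ with hz
    have hz1 : ‖z‖ = 1 := norm_circExp 1 θ
    have hcz : (starRingEnd ℂ) z * z = 1 := by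
      rw [mul_comm, Complex.mul_conj, Complex.normSq_eq_norm_sq, hz1]; norm_num
    have hca : (starRingEnd ℂ) a * a = 1 := by
      rw [mul_comm, Complex.mul_conj, Complex.normSq_eq_norm_sq, ha]; norm_num
    have e1 : ((‖z - a‖ ^ 2 * cotKernel a θ : ℝ) : ℂ) =
        (starRingEnd ℂ) (z - a) * (Complex.I * (z + a)) := by
      rw [← hk, ← mul_assoc, ← Complex.normSq_eq_conj_mul_self, Complex.normSq_eq_norm_sq]
      push_cast; ring
    have e2 := congrArg Complex.re e1
    rw [Complex.ofReal_re] at e2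
    rw [e2, Complex.inner]
    have e3 : (starRingEnd ℂ) (z - a) * (Complex.I * (z + a)) =
        Complex.I * ((starRingEnd ℂ) z * a) - Complex.I * ((starRingEnd ℂ) a * z) := by
      rw [map_sub]; linear_combination Complex.I * hcz - Complex.I * hca
    have e4 : Complex.I * z * (starRingEnd ℂ) (z - a) =
        Complex.I - Complex.I * ((starRingEnd ℂ) a * z) := by
      rw [map_sub]; linear_combination Complex.I * hcz
    rw [e3, e4]
    simp
    ring
  have h4 : HasDerivAt (fun θ => ‖circExp 1 θ - a‖ ^ (2 * b))
      (2 * inner ℝ (circExp 1 θ - a) (Complex.I * circExp 1 θ) * b *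
        (‖circExp 1 θ - a‖ ^ 2) ^ (b - 1)) θ := by
    refine h3.congr_of_eventuallyEq (Eventually.of_forall fun t => ?_)
    beta_reduce
    rw [Real.rpow_mul (norm_nonneg _)]; norm_num
  refine h4.congr_deriv ?_
  rw [key, Real.rpow_sub_one (by positivity), Real.rpow_mul hx.le]
  norm_num
  field_simp

namespace Trig

lemma periodic {F : ℝ → ℂ} (hF : Trig F) : Function.Periodic F (2 * π) :=
  induct (p := fun F => Function.Periodic F (2 * π)) (circExp_periodic _) (circExp_periodic _)
    (fun c _ => rfl) (fun F G _ _ h h' θ => by simp only [h θ, h' θ])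
    (fun F G _ _ h h' θ => by simp only [h θ, h' θ]) hF

lemma exists_hasDerivAt {F : ℝ → ℂ} (hF : Trig F) :
    ∃ F', Trig F' ∧ ∀ θ, HasDerivAt F (F' θ) θ := by
  refine induct (p := fun F => ∃ F', Trig F' ∧ ∀ θ, HasDerivAt F (F' θ) θ)
    ⟨_, const_mul _ circ_one, hasDerivAt_circExp 1⟩
    ⟨_, const_mul _ circ_neg_one, hasDerivAt_circExp (-1)⟩
    (fun c => ⟨_, const 0, fun θ => hasDerivAt_const θ c⟩) ?_ ?_ hF
  · rintro F G - - ⟨F', hF, hF'⟩ ⟨G', hG, hG'⟩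
    exact ⟨_, hF.add hG, fun θ => (hF' θ).add (hG' θ)⟩
  · rintro F G hF0 hG0 ⟨F', hF, hF'⟩ ⟨G', hG, hG'⟩
    exact ⟨_, (hF.mul hG0).add (hF0.mul hG), fun θ => (hF' θ).mul (hG' θ)⟩

lemma exists_quotient {a : ℂ} (ha : ‖a‖ = 1) {F : ℝ → ℂ} (hF : Trig F) :
    ∃ G, Trig G ∧ ∀ θ, F θ - F a.arg = (circExp 1 θ - a) * G θ := by
  refine induct (p := fun F => ∃ G, Trig G ∧ ∀ θ, F θ - F a.arg = (circExp 1 θ - a) * G θ)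
    ⟨_, const 1, fun θ => by rw [circExp_eq_one_arg ha, mul_one]⟩
    ⟨_, const_mul (-(starRingEnd ℂ) a) circ_neg_one, fun θ => ?_⟩
    (fun c => ⟨_, const 0, fun θ => by simp⟩) ?_ ?_ hF
  · have h1 : circExp (-1) a.arg = (starRingEnd ℂ) a := by
      rw [← circExp_conj, circExp_eq_one_arg ha]
    have h2 : circExp 1 θ * circExp (-1) θ = 1 := by
      rw [← circExp_add]; simp [circExp_zero]
    have h3 : (starRingEnd ℂ) a * a = 1 := by
      rw [mul_comm, Complex.mul_conj, Complex.normSq_eq_norm_sq, ha]; norm_num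
    rw [h1]
    linear_combination (starRingEnd ℂ) a * h2 - circExp (-1) θ * h3
  · rintro F G - - ⟨F', hF, hF'⟩ ⟨G', hG, hG'⟩
    exact ⟨_, hF.add hG, fun θ => by linear_combination hF' θ + hG' θ⟩
  · rintro F G hF0 hG0 ⟨F', hF, hF'⟩ ⟨G', hG, hG'⟩
    exact ⟨_, (hF.mul hG0).add ((const (F a.arg)).mul hG), fun θ => by
      linear_combination (G θ) * hF' θ + F a.arg * hG' θ⟩

lemma exists_factor {ι : Type*} {a : ι → ℂ} (ha : ∀ k, ‖a k‖ = 1) (hinj : Function.Injective a)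
    (s : Finset ι) {F : ℝ → ℂ} (hF : Trig F) (h0 : ∀ k ∈ s, F (a k).arg = 0) :
    ∃ G, Trig G ∧ ∀ θ, F θ = (∏ k ∈ s, (circExp 1 θ - a k)) * G θ := by
  classical
  induction s using Finset.induction_on with
  | empty => exact ⟨F, hF, fun θ => by simp⟩
  | insert k s hk ih =>
    obtain ⟨G, hG, h⟩ := ih fun j hj => h0 j (Finset.mem_insert_of_mem hj)
    obtain ⟨G₁, hG₁, h₁⟩ := hG.exists_quotient (ha k)
    refine ⟨G₁, hG₁, fun θ => ?_⟩
    have hz : G (a k).arg = 0 := by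
      have h2 := h (a k).arg
      rw [h0 k (Finset.mem_insert_self _ _), circExp_eq_one_arg (ha k)] at h2
      refine (mul_eq_zero.1 h2.symm).resolve_left (Finset.prod_ne_zero_iff.2 fun j hj => ?_)
      exact sub_ne_zero.2 (hinj.ne fun e => hk (e ▸ hj))
    rw [Finset.prod_insert hk, h θ, show G θ = _ from by simpa [hz] using h₁ θ]
    ring

lemma exists_interpolant {ι : Type*} [Fintype ι] [DecidableEq ι] {a : ι → ℂ}
    (ha : ∀ k, ‖a k‖ = 1) (hinj : Function.Injective a) (k : ι) :
    ∃ τ, Trig τ ∧ (∀ θ, (starRingEnd ℂ) (τ θ) = τ θ) ∧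
      ∀ j, τ (a j).arg = if j = k then 1 else 0 := by
  set l : ℝ → ℂ := fun θ => ∏ j ∈ Finset.univ.erase k, ((circExp 1 θ - a j) * (a k - a j)⁻¹) with hl
  have hlT : Trig l := prod _ fun j _ => (circ_one.sub (const (a j))).mul (const _)
  refine ⟨_, hlT.mul hlT.conj, fun θ => ?_, fun j => ?_⟩
  · rw [map_mul, Complex.conj_conj, mul_comm]
  · split_ifs with h
    · have : l (a j).arg = 1 := by
        subst h
        simp only [hl, circExp_eq_one_arg (ha j)]
        refine Finset.prod_eq_one fun i hi => mul_inv_cancel₀ (sub_ne_zero.2 ?_)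
        exact hinj.ne (Finset.ne_of_mem_erase hi).symm
      rw [this]; simp
    · have : l (a j).arg = 0 := by
        simp only [hl, circExp_eq_one_arg (ha j)]
        exact Finset.prod_eq_zero (Finset.mem_erase.2 ⟨h, Finset.mem_univ j⟩) (by simp)
      rw [this]; simp

end Trig

lemma continuous_mul_norm_rpow {s : ℝ} (hs : -1 < s) : Continuous fun w : ℂ => w * (‖w‖ ^ s : ℝ) := by
  refine continuous_iff_continuousAt.2 fun w => ?_
  rcases eq_or_ne w 0 with rfl | hw
  · rw [ContinuousAt, zero_mul, tendsto_zero_iff_norm_tendsto_zero]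
    have h1 : Tendsto (fun w : ℂ => ‖w‖ ^ (1 + s)) (𝓝 0) (𝓝 0) := by
      have : Tendsto (fun w : ℂ => ‖w‖ ^ (1 + s)) (𝓝 0) (𝓝 (‖(0:ℂ)‖ ^ (1 + s))) :=
        (continuous_norm.tendsto 0).rpow_const (Or.inr (by linarith))
      rwa [norm_zero, Real.zero_rpow (by linarith)] at this
    refine squeeze_zero (fun _ => norm_nonneg _) (fun w => ?_) h1
    rw [norm_mul, Complex.norm_real, Real.norm_of_nonneg (by positivity)]
    rcases eq_or_ne w 0 with rfl | hw
    · simp; positivity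
    · rw [Real.rpow_add (norm_pos_iff.2 hw), Real.rpow_one]
  · exact continuousAt_id.mul (Complex.continuous_ofReal.continuousAt.comp
      (continuous_norm.continuousAt.rpow_const (Or.inl (norm_ne_zero_iff.2 hw))))

namespace IsJacobi

variable {ι : Type*} [Fintype ι] {a : ι → ℂ} {β : ι → ℝ} {v γ : ℝ → ℝ} {g : ℤ → ℂ}

lemma ae_kernel (H : IsJacobi a β v γ g) (k : ι) {F G : ℝ → ℂ} {c : ℂ}
    (h : ∀ θ, F θ - c = (circExp 1 θ - a k) * G θ) :
    (fun θ => (F θ - c) * cotKernel (a k) θ) =ᵐ[jacobiMeasure a β v]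
      fun θ => Complex.I * ((circExp 1 θ + a k) * G θ) := by
  filter_upwards [ae_ne] with θ hθ
  rw [h θ]
  linear_combination G θ * cotKernel_eq (H.norm_a k) (hθ k)

lemma integrable_kernel (H : IsJacobi a β v γ g) (k : ι) {F : ℝ → ℂ} (hF : Trig F) :
    Integrable (fun θ => (F θ - F (a k).arg) * cotKernel (a k) θ) (jacobiMeasure a β v) := by
  obtain ⟨G, hG, h⟩ := hF.exists_quotient (H.norm_a k)
  refine (integrable_congr (H.ae_kernel k h)).2 (H.contInt _ ?_)
  exact ((Trig.const _).mul ((Trig.circ_one.add (Trig.const _)).mul hG)).continuous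

lemma hasDerivAt_density (H : IsJacobi a β v γ g) {θ : ℝ} (hθ : ∀ k, circExp 1 θ ≠ a k) :
    HasDerivAt (jacobiDensity a β v)
      (jacobiDensity a β v θ * (γ θ + ∑ k, β k * cotKernel (a k) θ)) θ := by
  classical
  have h1 := HasDerivAt.fun_finsetProd (u := Finset.univ) fun k _ =>
    hasDerivAt_norm_rpow_node (H.norm_a k) (hθ k) (β k)
  refine ((H.v_deriv θ).mul h1).congr_deriv ?_
  have : ∀ k, (∏ j ∈ Finset.univ.erase k, ‖circExp 1 θ - a j‖ ^ (2 * β j)) •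
      (‖circExp 1 θ - a k‖ ^ (2 * β k) * (β k * cotKernel (a k) θ)) =
      (∏ j, ‖circExp 1 θ - a j‖ ^ (2 * β j)) * (β k * cotKernel (a k) θ) := fun k => by
    rw [← Finset.mul_prod_erase _ _ (Finset.mem_univ k), smul_eq_mul]; ring
  simp only [this, ← Finset.mul_sum, jacobiDensity]
  ring

end IsJacobi

/-- The integrand of the (regularized) integration by parts formula. -/
noncomputable def pvIntegrand {ι : Type*} [Fintype ι] (a : ι → ℂ) (β : ι → ℝ) (γ : ℝ → ℝ)
    (F F' : ℝ → ℂ) (θ : ℝ) : ℂ :=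
  F' θ + γ θ * F θ + ∑ k, β k * ((F θ - F (a k).arg) * cotKernel (a k) θ)

namespace IsJacobi

variable {ι : Type*} [Fintype ι] {a : ι → ℂ} {β : ι → ℝ} {v γ : ℝ → ℝ} {g : ℤ → ℂ}

lemma gamma_mul_integrable (H : IsJacobi a β v γ g) {F : ℝ → ℂ} (hF : Continuous F) :
    Integrable (fun θ => γ θ * F θ) (jacobiMeasure a β v) :=
  H.contInt _ ((Complex.continuous_ofReal.comp H.gamma_continuous).mul hF)

lemma pvIntegrand_integrable (H : IsJacobi a β v γ g) {F F' : ℝ → ℂ} (hF : Trig F)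
    (hF' : Trig F') : Integrable (pvIntegrand a β γ F F') (jacobiMeasure a β v) :=
  ((H.contInt _ hF'.continuous).add (H.gamma_mul_integrable hF.continuous)).add
    (integrable_finsetSum _ fun k _ => (H.integrable_kernel k hF).const_mul _)

lemma integral_pvIntegrand (H : IsJacobi a β v γ g) {F F' : ℝ → ℂ} (hF : Trig F)
    (hF' : Trig F') :
    ∫ θ, pvIntegrand a β γ F F' θ ∂(jacobiMeasure a β v) =
      ∫ θ, F' θ ∂(jacobiMeasure a β v) + ∫ θ, γ θ * F θ ∂(jacobiMeasure a β v) +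
      ∑ k, β k * ∫ θ, (F θ - F (a k).arg) * cotKernel (a k) θ ∂(jacobiMeasure a β v) := by
  have h1 := H.contInt _ hF'.continuous
  have h2 := H.gamma_mul_integrable hF.continuous
  have h3 : ∀ k ∈ Finset.univ, Integrable (fun θ => (β k : ℂ) *
      ((F θ - F (a k).arg) * cotKernel (a k) θ)) (jacobiMeasure a β v) :=
    fun k _ => (H.integrable_kernel k hF).const_mul _
  have h12 : Integrable (fun θ => F' θ + γ θ * F θ) (jacobiMeasure a β v) := h1.add h2
  simp only [pvIntegrand]
  rw [integral_add h12 (integrable_finsetSum _ h3), integral_add h1 h2,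
    integral_finsetSum _ h3]
  simp only [integral_const_mul]

lemma gamma_integral (H : IsJacobi a β v γ g) {F : ℝ → ℂ} (hF : Continuous F) :
    ∫ θ, γ θ * F θ ∂(jacobiMeasure a β v) =
      Complex.I * ∑' j, g j * ∫ θ, F θ * circExp j θ ∂(jacobiMeasure a β v) := by
  have hint : ∀ j : ℤ, Integrable (fun θ => g j * (F θ * circExp j θ)) (jacobiMeasure a β v) :=
    fun j => H.contInt _ (continuous_const.mul (hF.mul (continuous_circExp j)))
  have hn : ∀ j : ℤ, ∫ θ, ‖g j * (F θ * circExp j θ)‖ ∂(jacobiMeasure a β v) =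
      ‖g j‖ * ∫ θ, ‖F θ‖ ∂(jacobiMeasure a β v) := fun j => by
    simp only [norm_mul, norm_circExp, mul_one, integral_const_mul]
  have h := hasSum_integral_of_summable_integral_norm hint (by
    simp only [hn]; exact H.summable_norm.mul_right _)
  simp only [integral_const_mul] at h
  rw [h.tsum_eq, ← integral_const_mul]
  refine integral_congr_ae (Eventually.of_forall fun θ => ?_)
  beta_reduce
  rw [H.gamma_eq, mul_assoc, ← tsum_mul_right]
  congr 2
  ext j; ring

lemma integral_pvIntegrand_eq_zero (H : IsJacobi a β v γ g) {F F' : ℝ → ℂ} (hF : Trig F)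
    (hF' : Trig F') (hd : ∀ θ, HasDerivAt F (F' θ) θ) (h0 : ∀ k, F (a k).arg = 0) :
    ∫ θ, pvIntegrand a β γ F F' θ ∂(jacobiMeasure a β v) = 0 := by
  have hI := H.pvIntegrand_integrable hF hF'
  rw [H.integrable_iff] at hI
  rw [H.integral_eq]
  have hcont : Continuous fun θ => (jacobiDensity a β v θ : ℂ) * F θ := by
    obtain ⟨G, hG, h⟩ := hF.exists_factor H.norm_a H.inj Finset.univ fun k _ => h0 k
    have e : (fun θ => (jacobiDensity a β v θ : ℂ) * F θ) = fun θ => (v θ : ℂ) * G θ *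
        ∏ k, ((circExp 1 θ - a k) * (‖circExp 1 θ - a k‖ ^ (2 * β k) : ℝ)) := by
      ext θ
      rw [h θ, jacobiDensity, Finset.prod_mul_distrib]
      push_cast; ring
    rw [e]
    refine ((Complex.continuous_ofReal.comp H.v_continuous).mul hG.continuous).mul
      (continuous_finsetProd _ fun k _ => ?_)
    exact (continuous_mul_norm_rpow (by linarith [H.beta_lt k])).comp
      ((continuous_circExp 1).sub continuous_const)
  rw [integral_eq_of_hasDerivAt_off_countable (fun θ => (jacobiDensity a β v θ : ℂ) * F θ) _
    (countable_nodes a) hcont.continuousOn ?_ hI]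
  · have h1 : jacobiDensity a β v (2 * π) = jacobiDensity a β v 0 := by
      have := H.v_periodic 0
      have h2 := circExp_periodic 1 0
      rw [zero_add] at this h2
      simp only [jacobiDensity, this, h2]
    have h2 : F (2 * π) = F 0 := by simpa using hF.periodic 0
    rw [h1, h2, sub_self]
  · rintro θ ⟨-, hθ⟩
    have hθ' : ∀ k, circExp 1 θ ≠ a k := fun k hk => hθ ⟨k, hk⟩
    refine ((H.hasDerivAt_density hθ').ofReal_comp.mul (hd θ)).congr_deriv ?_
    simp only [pvIntegrand, h0, sub_zero, Complex.real_smul]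
    push_cast
    have : ∑ k, (β k : ℂ) * (F θ * cotKernel (a k) θ) = F θ * ∑ k, (β k : ℂ) * cotKernel (a k) θ := by
      rw [Finset.mul_sum]; exact Finset.sum_congr rfl fun k _ => by ring
    rw [this]; ring

end IsJacobi

namespace IsJacobi

variable {ι : Type*} [Fintype ι] {a : ι → ℂ} {β : ι → ℝ} {v γ : ℝ → ℝ} {g : ℤ → ℂ}

lemma pvIntegrand_sub (F F' G G' : ℝ → ℂ) (θ : ℝ) :
    pvIntegrand a β γ (fun θ => F θ - G θ) (fun θ => F' θ - G' θ) θ =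
      pvIntegrand a β γ F F' θ - pvIntegrand a β γ G G' θ := by
  have : ∀ k, (β k : ℂ) * ((F θ - G θ - (F (a k).arg - G (a k).arg)) * cotKernel (a k) θ) =
      β k * ((F θ - F (a k).arg) * cotKernel (a k) θ) -
        β k * ((G θ - G (a k).arg) * cotKernel (a k) θ) := fun k => by ring
  simp only [pvIntegrand, this, Finset.sum_sub_distrib]
  ring

lemma pvIntegrand_sum (c : ι → ℂ) (F F' : ι → ℝ → ℂ) (θ : ℝ) :
    pvIntegrand a β γ (fun θ => ∑ i, c i * F i θ) (fun θ => ∑ i, c i * F' i θ) θ =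
      ∑ i, c i * pvIntegrand a β γ (F i) (F' i) θ := by
  have : ∀ k, (β k : ℂ) * ((∑ i, c i * F i θ - ∑ i, c i * F i (a k).arg) * cotKernel (a k) θ) =
      ∑ i, c i * (β k * ((F i θ - F i (a k).arg) * cotKernel (a k) θ)) := fun k => by
    rw [← Finset.sum_sub_distrib, Finset.sum_mul, Finset.mul_sum]
    exact Finset.sum_congr rfl fun i _ => by ring
  simp only [pvIntegrand, this, mul_add, Finset.sum_add_distrib]
  rw [Finset.sum_comm]
  simp only [Finset.mul_sum]
  congr 2
  exact Finset.sum_congr rfl fun i _ => by ring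

lemma pvIntegrand_conj (F F' : ℝ → ℂ) (θ : ℝ) :
    pvIntegrand a β γ (fun θ => (starRingEnd ℂ) (F θ)) (fun θ => (starRingEnd ℂ) (F' θ)) θ =
      (starRingEnd ℂ) (pvIntegrand a β γ F F' θ) := by
  simp [pvIntegrand]

lemma exists_isPV (H : IsJacobi a β v γ g) (hβ : ∀ k, β k ≠ 0) :
    ∃ Cf, IsPV (jacobiMeasure a β v) a β g Cf := by
  classical
  set μ := jacobiMeasure a β v with hμ
  choose τ hτ hτc hτ1 using Trig.exists_interpolant H.norm_a H.inj
  choose τ' hτ' hτd using fun k => (hτ k).exists_hasDerivAt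
  set q : ι → ℂ := fun k => ∫ θ, pvIntegrand a β γ (τ k) (τ' k) θ ∂μ with hq
  have hqc : ∀ k, ((q k).re : ℂ) = q k := by
    intro k
    refine Complex.conj_eq_iff_re.1 ?_
    rw [hq]
    beta_reduce
    rw [← integral_conj]
    refine integral_congr_ae (Eventually.of_forall fun θ => ?_)
    beta_reduce
    rw [← pvIntegrand_conj]
    have e1 : (fun θ => (starRingEnd ℂ) (τ k θ)) = τ k := funext (hτc k)
    have e2 : (fun θ => (starRingEnd ℂ) (τ' k θ)) = τ' k := funext fun θ => by
      have h := hasDerivAt_conj (hτd k θ)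
      rw [e1] at h
      exact h.unique (hτd k θ)
    rw [e1, e2]
  refine ⟨fun k F => ∫ θ, (F θ - F (a k).arg) * cotKernel (a k) θ ∂μ -
    F (a k).arg * ((q k).re / β k : ℝ), ⟨?_, ?_, ?_⟩⟩
  · intro k F₁ F₂ G c h1 h2 hG h
    have e0 : F₁ (a k).arg = c * F₂ (a k).arg := by
      rw [h, circExp_eq_one_arg (H.norm_a k)]; simp
    have e1 : ∀ θ, (F₁ θ - c * F₂ θ) - 0 = (circExp 1 θ - a k) * G θ := fun θ => by rw [h θ]; ring
    have e2 := H.ae_kernel k e1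
    have hGi : Integrable (fun θ => Complex.I * ((circExp 1 θ + a k) * G θ)) μ :=
      H.contInt _ ((Trig.const _).mul ((Trig.circ_one.add (Trig.const _)).mul hG)).continuous
    have e3 : ∫ θ, (F₁ θ - F₁ (a k).arg) * cotKernel (a k) θ ∂μ =
        ∫ θ, (c * ((F₂ θ - F₂ (a k).arg) * cotKernel (a k) θ) +
          Complex.I * ((circExp 1 θ + a k) * G θ)) ∂μ := by
      refine integral_congr_ae ?_
      filter_upwards [e2] with θ hθ
      rw [← hθ, e0]; ring
    rw [e3, integral_add ((H.integrable_kernel k h2).const_mul c) hGi, integral_const_mul,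
      integral_const_mul, e0]
    ring
  · intro k F hF
    beta_reduce
    rw [map_sub, ← integral_conj, map_mul, Complex.conj_ofReal]
    congr 1
    refine integral_congr_ae (Eventually.of_forall fun θ => ?_)
    simp
  · intro F F' hF hF' hd
    have hz := H.integral_pvIntegrand_eq_zero (F := fun θ => F θ - ∑ k, F (a k).arg * τ k θ)
      (F' := fun θ => F' θ - ∑ k, F (a k).arg * τ' k θ)
      (hF.sub (Trig.sum _ fun k _ => (hτ k).const_mul _))
      (hF'.sub (Trig.sum _ fun k _ => (hτ' k).const_mul _))
      (fun θ => (hd θ).sub (HasDerivAt.fun_sum fun k _ => (hτd k θ).const_mul _))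
      (fun k => by simp [hτ1])
    simp only [pvIntegrand_sub, pvIntegrand_sum] at hz
    rw [integral_sub (H.pvIntegrand_integrable hF hF') (integrable_finsetSum _ fun k _ =>
      (H.pvIntegrand_integrable (hτ k) (hτ' k)).const_mul _), integral_finsetSum _ fun k _ =>
      (H.pvIntegrand_integrable (hτ k) (hτ' k)).const_mul _, H.integral_pvIntegrand hF hF',
      H.gamma_integral hF.continuous] at hz
    simp only [integral_const_mul] at hz
    have e : ∀ k, (β k : ℂ) * (∫ θ, (F θ - F (a k).arg) * cotKernel (a k) θ ∂μ -
        F (a k).arg * ((q k).re / β k : ℝ)) =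
        β k * (∫ θ, (F θ - F (a k).arg) * cotKernel (a k) θ ∂μ) - F (a k).arg * q k := fun k => by
      have : (β k : ℂ) ≠ 0 := by exact_mod_cast hβ k
      nth_rw 2 [← hqc k]
      push_cast
      field_simp
    simp only [e, Finset.sum_sub_distrib]
    linear_combination hz

end IsJacobi

/-- The Taylor coefficients at the origin. -/
noncomputable def taylorCoeff (f : ℂ → ℂ) (n : ℕ) : ℂ := (n.factorial : ℂ)⁻¹ * iteratedDeriv n f 0

lemma hasSum_taylorCoeff {f : ℂ → ℂ} {R : ℝ} (hf : DifferentiableOn ℂ f (ball 0 R)) {z : ℂ}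
    (hz : ‖z‖ < R) : HasSum (fun n => taylorCoeff f n * z ^ n) (f z) := by
  have := Complex.hasSum_taylorSeries_on_ball hf (z := z) (by simpa using hz)
  refine this.congr_fun fun n => ?_
  simp [taylorCoeff]; ring

lemma taylorCoeff_unique {f : ℂ → ℂ} {c : ℕ → ℂ} {R : ℝ} (hR : 0 < R)
    (hf : DifferentiableOn ℂ f (ball 0 R))
    (h : ∀ z, ‖z‖ < R → HasSum (fun n => c n * z ^ n) (f z)) (n : ℕ) : taylorCoeff f n = c n := by
  have h1 : ∀ c : ℕ → ℂ, (∀ z, ‖z‖ < R → HasSum (fun n => c n * z ^ n) (f z)) →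
      HasFPowerSeriesAt f (FormalMultilinearSeries.ofScalars ℂ c) 0 := by
    intro c hc
    rw [hasFPowerSeriesAt_iff]
    filter_upwards [ball_mem_nhds (0 : ℂ) hR] with z hz
    refine (hc (0 + z) (by simpa using hz)).congr_fun fun n => ?_
    simp [FormalMultilinearSeries.coeff_ofScalars]; ring
  have h2 := (h1 _ fun z hz => hasSum_taylorCoeff hf hz).eq_formalMultilinearSeries (h1 c h)
  exact congrFun (FormalMultilinearSeries.ofScalars_series_injective ℂ ℂ h2) n

lemma taylorCoeff_deriv (f : ℂ → ℂ) (n : ℕ) :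
    taylorCoeff (deriv f) n = (n + 1 : ℕ) * taylorCoeff f (n + 1) := by
  have : (n.factorial : ℂ) ≠ 0 := by exact_mod_cast n.factorial_ne_zero
  have h2 : ((n + 1 : ℕ) : ℂ) ≠ 0 := by exact_mod_cast n.succ_ne_zero
  rw [taylorCoeff, taylorCoeff, iteratedDeriv_succ', Nat.factorial_succ, Nat.cast_mul]
  field_simp

lemma taylorCoeff_mul {f g : ℂ → ℂ} (hf : AnalyticAt ℂ f 0) (hg : AnalyticAt ℂ g 0) (n : ℕ) :
    taylorCoeff (fun z => f z * g z) n =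
      ∑ q ∈ Finset.HasAntidiagonal.antidiagonal n, taylorCoeff f q.1 * taylorCoeff g q.2 := by
  have h := iteratedDeriv_mul (n := n) hf.contDiffAt hg.contDiffAt
  rw [taylorCoeff, show (fun z => f z * g z) = f * g from rfl, h,
    Finset.Nat.sum_antidiagonal_eq_sum_range_succ
      (fun i j => taylorCoeff f i * taylorCoeff g j), Finset.mul_sum]
  refine Finset.sum_congr rfl fun i hi => ?_
  have hi' : i ≤ n := by simpa [Nat.lt_succ_iff] using hi
  have h1 : (n.factorial : ℂ) ≠ 0 := by exact_mod_cast n.factorial_ne_zero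
  have h2 : (i.factorial : ℂ) ≠ 0 := by exact_mod_cast i.factorial_ne_zero
  have h3 : ((n - i).factorial : ℂ) ≠ 0 := by exact_mod_cast (n - i).factorial_ne_zero
  rw [taylorCoeff, taylorCoeff, Nat.cast_choose ℂ hi']
  field_simp

/-- The Taylor coefficients of an exponential satisfy the recursion coming from
`(exp L)' = L' exp L`. -/
lemma taylorCoeff_exp_rec {L : ℂ → ℂ} (hL : DifferentiableOn ℂ L (ball 0 1)) (i : ℕ) :
    ((i + 1 : ℕ) : ℂ) * taylorCoeff (fun z => Complex.exp (L z)) (i + 1) =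
      ∑ q ∈ Finset.HasAntidiagonal.antidiagonal i,
        ((q.1 + 1 : ℕ) * taylorCoeff L (q.1 + 1)) * taylorCoeff (fun z => Complex.exp (L z)) q.2 := by
  have h0 : ball (0 : ℂ) 1 ∈ 𝓝 (0 : ℂ) := ball_mem_nhds _ one_pos
  have hLa : AnalyticAt ℂ L 0 := hL.analyticAt h0
  have hE : AnalyticAt ℂ (fun z => Complex.exp (L z)) 0 := hLa.cexp
  rw [← taylorCoeff_deriv]
  simp only [← taylorCoeff_deriv]
  rw [← taylorCoeff_mul hLa.deriv hE, taylorCoeff, taylorCoeff]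
  congr 1
  refine Filter.EventuallyEq.iteratedDeriv_eq _ ?_
  filter_upwards [isOpen_ball.mem_nhds (mem_ball_self (x := (0:ℂ)) one_pos)] with z hz
  have : DifferentiableAt ℂ L z := (hL z hz).differentiableAt (isOpen_ball.mem_nhds hz)
  rw [this.hasDerivAt.cexp.deriv, mul_comm]

lemma taylorCoeff_zero (f : ℂ → ℂ) : taylorCoeff f 0 = f 0 := by simp [taylorCoeff]

lemma norm_radial_bounds {z a : ℂ} (hz : ‖z‖ = 1) (ha : ‖a‖ = 1) {r : ℝ} (h0 : 0 ≤ r) (h1 : r ≤ 1) :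
    ‖z - a‖ / 2 ≤ ‖r * z - a‖ ∧ ‖r * z - a‖ ≤ 2 := by
  have hr : ‖(r : ℂ) * z‖ = r := by rw [norm_mul, hz, mul_one, Complex.norm_of_nonneg h0]
  constructor
  · have e1 : ‖z - a‖ ≤ ‖r * z - a‖ + ‖z - r * z‖ := by
      rw [show z - a = (r * z - a) + (z - r * z) by ring]; exact norm_add_le _ _
    have e2 : ‖z - r * z‖ = 1 - r := by
      rw [show z - r * z = ((1 - r : ℝ) : ℂ) * z by push_cast; ring, norm_mul, hz, mul_one,
        Complex.norm_of_nonneg (by linarith)]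
    have e3 : 1 - r ≤ ‖r * z - a‖ := by
      have := norm_sub_norm_le a (r * z)
      rw [ha, hr, norm_sub_rev] at this; exact this
    linarith
  · exact (norm_sub_le _ _).trans (by rw [hr, ha]; linarith)

lemma norm_radial_rpow_le {z a : ℂ} (hz : ‖z‖ = 1) (ha : ‖a‖ = 1) (hza : z ≠ a) {r : ℝ}
    (h0 : 0 ≤ r) (h1 : r ≤ 1) (s : ℝ) :
    ‖r * z - a‖ ^ s ≤ 2 ^ |s| * ‖z - a‖ ^ (min s 0) := by
  obtain ⟨h2, h3⟩ := norm_radial_bounds hz ha h0 h1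
  have hx : 0 < ‖z - a‖ := norm_pos_iff.2 (sub_ne_zero.2 hza)
  rcases le_or_gt 0 s with hs | hs
  · rw [min_eq_right hs, Real.rpow_zero, mul_one, abs_of_nonneg hs]
    exact Real.rpow_le_rpow (norm_nonneg _) h3 hs
  · rw [min_eq_left hs.le, abs_of_neg hs]
    refine (Real.rpow_le_rpow_of_nonpos (by positivity) h2 hs.le).trans ?_
    rw [Real.div_rpow hx.le (by norm_num), Real.rpow_neg (by norm_num)]
    apply le_of_eq; field_simp

lemma tendsto_integral_radial {ι : Type*} [Fintype ι] {a : ι → ℂ} (ha : ∀ k, ‖a k‖ = 1)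
    (hinj : Function.Injective a) {s t : ι → ℝ} (ht : ∀ k, -1 < t k) {K : ℂ → ℝ}
    (hK : ContinuousOn K (closedBall 0 1)) {N : ℝ → ℝ} (hN : Measurable N) {C : ℝ}
    (hNb : ∀ θ, (∀ k, circExp 1 θ ≠ a k) →
      |N θ| * ∏ k, ‖circExp 1 θ - a k‖ ^ (min (s k) 0) ≤ C * ∏ k, ‖circExp 1 θ - a k‖ ^ t k) :
    Tendsto (fun r : ℝ => ∫ θ in (0 : ℝ)..(2 * π),
        N θ * (K (r * circExp 1 θ) * ∏ k, ‖r * circExp 1 θ - a k‖ ^ s k)) (𝓝[<] 1)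
      (𝓝 (∫ θ in (0 : ℝ)..(2 * π), N θ * (K (circExp 1 θ) * ∏ k, ‖circExp 1 θ - a k‖ ^ s k))) := by
  obtain ⟨M, hM⟩ := (isCompact_closedBall (0 : ℂ) 1).exists_bound_of_continuousOn hK
  have hM0 : 0 ≤ M := (norm_nonneg _).trans (hM 0 (by simp))
  have hmem : ∀ r ∈ Ioo (0 : ℝ) 1, ∀ θ, (r : ℂ) * circExp 1 θ ∈ closedBall (0 : ℂ) 1 := by
    intro r hr θ
    rw [mem_closedBall_zero_iff, norm_mul, norm_circExp, mul_one, Complex.norm_of_nonneg hr.1.le]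
    exact hr.2.le
  have hev : ∀ᶠ r : ℝ in 𝓝[<] 1, r ∈ Ioo (0 : ℝ) 1 := Ioo_mem_nhdsLT one_pos
  have hae : ∀ᵐ θ : ℝ, ∀ k, circExp 1 θ ≠ a k := by
    filter_upwards [(IsJacobi.countable_nodes a).ae_notMem volume] with θ hθ k hk using hθ ⟨k, hk⟩
  have hcirc := continuous_circExp 1
  refine intervalIntegral.tendsto_integral_filter_of_dominated_convergence
    (fun θ => (M * ∏ k, (2 : ℝ) ^ |s k|) * C * ∏ k, ‖circExp 1 θ - a k‖ ^ t k) ?_ ?_ ?_ ?_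
  · filter_upwards [hev] with r hr
    refine (hN.mul (Measurable.mul ?_ (Finset.measurable_fun_prod _ fun k _ => ?_))).aestronglyMeasurable
    · exact (hK.comp_continuous (continuous_const.mul hcirc) (hmem r hr)).measurable
    · exact (((continuous_const.mul hcirc).sub continuous_const).norm).measurable.pow_const _
  · filter_upwards [hev] with r hr
    filter_upwards [hae] with θ hθ _
    have h1 : ∏ k, ‖r * circExp 1 θ - a k‖ ^ s k ≤
        (∏ k, (2 : ℝ) ^ |s k|) * ∏ k, ‖circExp 1 θ - a k‖ ^ (min (s k) 0) := by
      rw [← Finset.prod_mul_distrib]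
      exact Finset.prod_le_prod (fun k _ => by positivity) fun k _ =>
        norm_radial_rpow_le (norm_circExp 1 θ) (ha k) (hθ k) hr.1.le hr.2.le _
    have h2 := hM _ (hmem r hr θ)
    have h3 : 0 ≤ ∏ k, ‖r * circExp 1 θ - a k‖ ^ s k := Finset.prod_nonneg fun k _ => by positivity
    rw [norm_mul, norm_mul, Real.norm_of_nonneg h3, Real.norm_eq_abs]
    calc |N θ| * (‖K (r * circExp 1 θ)‖ * ∏ k, ‖r * circExp 1 θ - a k‖ ^ s k)
        ≤ |N θ| * (M * ((∏ k, (2 : ℝ) ^ |s k|) * ∏ k, ‖circExp 1 θ - a k‖ ^ (min (s k) 0))) := by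
          gcongr
      _ = (M * ∏ k, (2 : ℝ) ^ |s k|) *
          (|N θ| * ∏ k, ‖circExp 1 θ - a k‖ ^ (min (s k) 0)) := by ring
      _ ≤ (M * ∏ k, (2 : ℝ) ^ |s k|) * (C * ∏ k, ‖circExp 1 θ - a k‖ ^ t k) :=
          mul_le_mul_of_nonneg_left (hNb θ hθ) (by positivity)
      _ = _ := by ring
  · exact (intervalIntegrable_prod_node ha hinj ht _ _).const_mul _
  · filter_upwards [hae] with θ hθ _
    have hlim : Tendsto (fun r : ℝ => (r : ℂ) * circExp 1 θ) (𝓝[<] 1) (𝓝 (circExp 1 θ)) := by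
      have : Tendsto (fun r : ℝ => (r : ℂ) * circExp 1 θ) (𝓝 1) (𝓝 (((1 : ℝ) : ℂ) * circExp 1 θ)) :=
        (Complex.continuous_ofReal.tendsto 1).mul_const _
      rw [Complex.ofReal_one, one_mul] at this
      exact this.mono_left nhdsWithin_le_nhds
    refine tendsto_const_nhds.mul (Tendsto.mul ?_ (tendsto_finsetProd _ fun k _ => ?_))
    · have h1 : circExp 1 θ ∈ closedBall (0 : ℂ) 1 := by
        rw [mem_closedBall_zero_iff, norm_circExp]
      refine (hK _ h1).tendsto.comp (tendsto_nhdsWithin_iff.2 ⟨hlim, ?_⟩)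
      filter_upwards [hev] with r hr using hmem r hr θ
    · exact (hlim.sub_const _).norm.rpow_const
        (Or.inl (norm_ne_zero_iff.2 (sub_ne_zero.2 (hθ k))))

/-- The logarithm of the Szegő function of a generalized Jacobi weight. -/
noncomputable def szegoLog {ι : Type*} [Fintype ι] (a : ι → ℂ) (β : ι → ℝ) (u : ℂ → ℂ) (z : ℂ) : ℂ :=
  -u z - ∑ k, β k * Complex.log (1 - z * (starRingEnd ℂ) (a k))

section SzegoLog

variable {ι : Type*} [Fintype ι] {a : ι → ℂ} {β : ι → ℝ} {u : ℂ → ℂ}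

lemma norm_mul_conj_lt {a z : ℂ} (ha : ‖a‖ = 1) (hz : ‖z‖ < 1) : ‖z * (starRingEnd ℂ) a‖ < 1 := by
  rwa [norm_mul, RCLike.norm_conj, ha, mul_one]

lemma differentiableOn_szegoLog (ha : ∀ k, ‖a k‖ = 1) (hu : DifferentiableOn ℂ u (ball 0 1)) :
    DifferentiableOn ℂ (szegoLog a β u) (ball 0 1) := by
  refine hu.neg.sub (DifferentiableOn.fun_sum fun k _ => ?_)
  refine DifferentiableOn.const_mul (DifferentiableOn.clog (by fun_prop) fun z hz => ?_) _
  have := norm_mul_conj_lt (ha k) (mem_ball_zero_iff.1 hz)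
  exact Complex.mem_slitPlane_of_norm_lt_one (z := -(z * (starRingEnd ℂ) (a k)))
    (by rwa [norm_neg]) |> fun h => by simpa [sub_eq_add_neg] using h

lemma szegoLog_zero (h0 : u 0 = 0) : szegoLog a β u 0 = 0 := by simp [szegoLog, h0]

lemma norm_one_sub_mul_conj {a z : ℂ} (ha : ‖a‖ = 1) : ‖1 - z * (starRingEnd ℂ) a‖ = ‖z - a‖ := by
  have h3 : a * (starRingEnd ℂ) a = 1 := by
    rw [Complex.mul_conj, Complex.normSq_eq_norm_sq, ha]; norm_num
  rw [show 1 - z * (starRingEnd ℂ) a = (a - z) * (starRingEnd ℂ) a by linear_combination -h3,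
    norm_mul, RCLike.norm_conj, ha, mul_one, norm_sub_rev]

lemma norm_exp_szegoLog_sq (ha : ∀ k, ‖a k‖ = 1) {z : ℂ} (hz : ‖z‖ < 1) (σ : ℝ) :
    ‖Complex.exp (σ * szegoLog a β u z)‖ ^ 2 =
      Real.exp (-(2 * σ) * (u z).re) * ∏ k, ‖z - a k‖ ^ (-σ * (2 * β k)) := by
  have hpos : ∀ k, 0 < ‖z - a k‖ := fun k => norm_pos_iff.2 (sub_ne_zero.2 fun e => by
    rw [e, ha k] at hz; exact lt_irrefl _ hz)
  have h1 : (szegoLog a β u z).re = -(u z).re - ∑ k, β k * Real.log ‖z - a k‖ := by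
    simp only [szegoLog, Complex.sub_re, Complex.neg_re, Complex.re_sum, Complex.re_ofReal_mul,
      Complex.log_re, norm_one_sub_mul_conj (ha _)]
  rw [Complex.norm_exp, Complex.re_ofReal_mul, h1, ← Real.exp_nat_mul]
  have h2 : ∏ k, ‖z - a k‖ ^ (-σ * (2 * β k)) =
      Real.exp (∑ k, Real.log ‖z - a k‖ * (-σ * (2 * β k))) := by
    rw [Real.exp_sum]
    exact Finset.prod_congr rfl fun k _ => Real.rpow_def_of_pos (hpos k) _
  rw [h2, ← Real.exp_add]
  congr 1
  have h3 : ∑ k, Real.log ‖z - a k‖ * (-σ * (2 * β k)) =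
      -(2 * σ) * ∑ k, β k * Real.log ‖z - a k‖ := by
    rw [Finset.mul_sum]; exact Finset.sum_congr rfl fun k _ => by ring
  rw [h3]; push_cast; ring

end SzegoLog

/-- The parameters of a generalized Jacobi weight whose smooth factor is `exp (v₀ + 2 Re u)` on the
circle, with `u` analytic in the disc and continuous up to the boundary. -/
structure IsSzegoWeight {ι : Type*} [Fintype ι] (a : ι → ℂ) (β : ι → ℝ) (v γ : ℝ → ℝ) (g : ℤ → ℂ)
    (u : ℂ → ℂ) (v₀ : ℝ) : Prop where
  jacobi : IsJacobi a β v γ g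
  diff : DifferentiableOn ℂ u (ball 0 1)
  cont : ContinuousOn u (closedBall 0 1)
  u_zero : u 0 = 0
  v_eq : ∀ θ, v θ = Real.exp (v₀ + 2 * (u (circExp 1 θ)).re)

namespace IsSzegoWeight

variable {ι : Type*} [Fintype ι] {a : ι → ℂ} {β : ι → ℝ} {v γ : ℝ → ℝ} {g : ℤ → ℂ} {u : ℂ → ℂ}
  {v₀ : ℝ}

lemma szegoLog_diff (S : IsSzegoWeight a β v γ g u v₀) :
    DifferentiableOn ℂ (szegoLog a β u) (ball 0 1) := differentiableOn_szegoLog S.jacobi.norm_a S.diff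

lemma sq_norm_zero_le {F : ℂ → ℂ} (hF : DifferentiableOn ℂ F (ball 0 1)) {r : ℝ}
    (hr : r ∈ Ioo (0 : ℝ) 1) :
    2 * π * ‖F 0‖ ^ 2 ≤ ∫ θ in (0 : ℝ)..(2 * π), ‖F (r * circExp 1 θ)‖ ^ 2 := by
  have h1 : DiffContOnCl ℂ (fun z => F z ^ 2) (ball 0 |r|) := by
    refine DifferentiableOn.diffContOnCl_ball (U := ball 0 1) (hF.pow 2) ?_
    rw [abs_of_pos hr.1]; exact closedBall_subset_ball hr.2
  have h2 := h1.circleAverage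
  rw [Real.circleAverage_def] at h2
  have h3 : ∀ θ, circleMap 0 r θ = r * circExp 1 θ := fun θ => by
    simp [circleMap, circExp_one]
  simp only [h3] at h2
  have h4 : ‖F 0‖ ^ 2 = (2 * π)⁻¹ * ‖∫ θ in (0 : ℝ)..(2 * π), F (r * circExp 1 θ) ^ 2‖ := by
    rw [← norm_pow, ← h2, norm_smul, Real.norm_of_nonneg (by positivity)]
  have h5 : ‖∫ θ in (0 : ℝ)..(2 * π), F (r * circExp 1 θ) ^ 2‖ ≤
      ∫ θ in (0 : ℝ)..(2 * π), ‖F (r * circExp 1 θ)‖ ^ 2 := by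
    refine (intervalIntegral.norm_integral_le_integral_norm (by positivity)).trans_eq ?_
    simp only [norm_pow]
  rw [h4, ← mul_assoc, mul_inv_cancel₀ (by positivity), one_mul]
  exact h5

lemma lower (S : IsSzegoWeight a β v γ g u v₀) :
    SzegoLower (jacobiMeasure a β v) (2 * π * Real.exp v₀) := by
  intro P
  have H := S.jacobi
  have hF : DifferentiableOn ℂ
      (fun z => P.eval z * Complex.exp (((-1 : ℝ) : ℂ) * szegoLog a β u z)) (ball 0 1) :=
    P.differentiable.differentiableOn.mul (S.szegoLog_diff.const_mul _).cexp
  have hlim := tendsto_integral_radial H.norm_a H.inj (s := fun k => 2 * β k)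
    (t := fun k => min (2 * β k) 0) (fun k => lt_min (by linarith [H.beta_lt k]) (by norm_num))
    (K := fun z => ‖P.eval z‖ ^ 2 * Real.exp (2 * (u z).re))
    ((P.continuous.norm.pow 2).continuousOn.mul
      (continuousOn_const.mul (Complex.continuous_re.comp_continuousOn S.cont)).rexp)
    (N := fun _ => 1) measurable_const (C := 1) (fun θ _ => by simp)
  have hle := ge_of_tendsto (b := 2 * π * ‖P.coeff 0‖ ^ 2) hlim (by
    filter_upwards [Ioo_mem_nhdsLT (zero_lt_one (α := ℝ))] with r hr
    have := sq_norm_zero_le hF hr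
    rw [szegoLog_zero S.u_zero, mul_zero, Complex.exp_zero, mul_one, ← coeff_zero_eq_eval_zero] at this
    refine this.trans_eq (intervalIntegral.integral_congr fun θ _ => ?_)
    have hz : ‖(r : ℂ) * circExp 1 θ‖ < 1 := by
      rw [norm_mul, norm_circExp, mul_one, Complex.norm_of_nonneg hr.1.le]; exact hr.2
    simp only [norm_mul, mul_pow, one_mul]
    rw [norm_exp_szegoLog_sq H.norm_a hz]
    simp [mul_assoc])
  rw [wNorm_sq, H.integral_eq]
  calc 2 * π * Real.exp v₀ * ‖P.coeff 0‖ ^ 2 = Real.exp v₀ * (2 * π * ‖P.coeff 0‖ ^ 2) := by ring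
    _ ≤ _ := mul_le_mul_of_nonneg_left hle (Real.exp_pos _).le
    _ = _ := by
      rw [← intervalIntegral.integral_const_mul]
      refine intervalIntegral.integral_congr fun θ _ => ?_
      simp only [jacobiDensity, S.v_eq θ, Real.exp_add, onCirc, smul_eq_mul]
      ring

lemma tendsto_integral_exp_szegoLog (S : IsSzegoWeight a β v γ g u v₀) :
    Tendsto (fun r : ℝ => ∫ θ, ‖Complex.exp (szegoLog a β u (r * circExp 1 θ))‖ ^ 2
      ∂(jacobiMeasure a β v)) (𝓝[<] 1) (𝓝 (2 * π * Real.exp v₀)) := by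
  have H := S.jacobi
  obtain ⟨C, hC⟩ : ∃ C, ∀ θ, v θ ≤ C := by
    obtain ⟨M, hM⟩ := (isCompact_closedBall (0 : ℂ) 1).exists_bound_of_continuousOn S.cont
    refine ⟨Real.exp (v₀ + 2 * M), fun θ => ?_⟩
    rw [S.v_eq]
    have := (Complex.re_le_norm _).trans (hM (circExp 1 θ) (by
      rw [mem_closedBall_zero_iff, norm_circExp]))
    gcongr
  have hlim := tendsto_integral_radial H.norm_a H.inj (s := fun k => -1 * (2 * β k))
    (t := fun k => min (2 * β k) 0) (fun k => lt_min (by linarith [H.beta_lt k]) (by norm_num))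
    (K := fun z => Real.exp (-2 * (u z).re))
    (continuousOn_const.mul (Complex.continuous_re.comp_continuousOn S.cont)).rexp
    (N := jacobiDensity a β v) H.density_measurable (C := C) (fun θ hθ => by
      rw [abs_of_nonneg (H.density_nonneg θ), jacobiDensity, mul_assoc, ← Finset.prod_mul_distrib]
      refine mul_le_mul (hC θ) (le_of_eq (Finset.prod_congr rfl fun k _ => ?_))
        (Finset.prod_nonneg fun k _ => by positivity) ((H.v_pos θ).le.trans (hC θ))
      rw [← Real.rpow_add (norm_pos_iff.2 (sub_ne_zero.2 (hθ k)))]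
      congr 1
      rcases le_total (2 * β k) 0 with h | h
      · rw [min_eq_right (by linarith), min_eq_left h, add_zero]
      · rw [min_eq_left (by linarith), min_eq_right h]; ring)
  have hval : ∫ θ in (0 : ℝ)..(2 * π), jacobiDensity a β v θ * (Real.exp (-2 * (u (circExp 1 θ)).re) *
      ∏ k, ‖circExp 1 θ - a k‖ ^ (-1 * (2 * β k))) = 2 * π * Real.exp v₀ := by
    have : ∫ θ in (0 : ℝ)..(2 * π), jacobiDensity a β v θ *
        (Real.exp (-2 * (u (circExp 1 θ)).re) * ∏ k, ‖circExp 1 θ - a k‖ ^ (-1 * (2 * β k))) =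
        ∫ θ in (0 : ℝ)..(2 * π), Real.exp v₀ := by
      refine intervalIntegral.integral_congr_ae ?_
      filter_upwards [(IsJacobi.countable_nodes a).ae_notMem volume] with θ hθ _
      have hθ' : ∀ k, circExp 1 θ ≠ a k := fun k hk => hθ ⟨k, hk⟩
      rw [jacobiDensity, S.v_eq, show ∀ x y z w : ℝ, x * y * (z * w) = (x * z) * (y * w) by
        intros; ring, ← Real.exp_add, ← Finset.prod_mul_distrib, Finset.prod_eq_one, mul_one]
      · congr 1; ring
      · intro k _
        rw [← Real.rpow_add (norm_pos_iff.2 (sub_ne_zero.2 (hθ' k)))]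
        rw [show 2 * β k + -1 * (2 * β k) = 0 by ring, Real.rpow_zero]
    rw [this, intervalIntegral.integral_const]; simp
  rw [hval] at hlim
  refine hlim.congr' ?_
  filter_upwards [Ioo_mem_nhdsLT (zero_lt_one (α := ℝ))] with r hr
  rw [H.integral_eq]
  refine intervalIntegral.integral_congr fun θ _ => ?_
  have hz : ‖(r : ℂ) * circExp 1 θ‖ < 1 := by
    rw [norm_mul, norm_circExp, mul_one, Complex.norm_of_nonneg hr.1.le]; exact hr.2
  have := norm_exp_szegoLog_sq (u := u) (β := β) H.norm_a hz 1
  rw [Complex.ofReal_one, one_mul] at this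
  simp only [smul_eq_mul, this, mul_one]

lemma exp_szegoLog_diff (S : IsSzegoWeight a β v γ g u v₀) :
    DifferentiableOn ℂ (fun z => Complex.exp (szegoLog a β u z)) (ball 0 1) := S.szegoLog_diff.cexp

lemma tendsto_wNorm_partialSum {μ : Measure ℝ} (hμ : ContInt μ) {c : ℕ → ℂ}
    (hc : Summable fun j => ‖c j‖) :
    Tendsto (fun N => wNorm μ (onCirc (∑ j ∈ Finset.range N, Polynomial.monomial j (c j))) ^ 2) atTop
      (𝓝 (∫ θ, ‖∑' j, c j * circExp 1 θ ^ j‖ ^ 2 ∂μ)) := by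
  simp only [wNorm_sq]
  have heval : ∀ N θ, onCirc (∑ j ∈ Finset.range N, Polynomial.monomial j (c j)) θ =
      ∑ j ∈ Finset.range N, c j * circExp 1 θ ^ j := fun N θ => by
    simp [onCirc, eval_finsetSum]
  have hn : ∀ θ j, ‖c j * circExp 1 θ ^ j‖ = ‖c j‖ := fun θ j => by
    rw [norm_mul, norm_pow, norm_circExp, one_pow, mul_one]
  refine tendsto_integral_of_dominated_convergence (fun _ => (∑' j, ‖c j‖) ^ 2) ?_ ?_ ?_ ?_
  · exact fun N => ((continuous_onCirc _).norm.pow 2).aestronglyMeasurable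
  · exact hμ.real continuous_const
  · refine fun N => Eventually.of_forall fun θ => ?_
    rw [Real.norm_of_nonneg (by positivity), heval]
    gcongr
    refine (norm_sum_le _ _).trans ?_
    simp only [hn]
    exact hc.sum_le_tsum _ fun _ _ => norm_nonneg _
  · refine Eventually.of_forall fun θ => ?_
    have hs : Summable fun j => c j * circExp 1 θ ^ j := Summable.of_norm (by simpa only [hn] using hc)
    have := (hs.hasSum.tendsto_sum_nat.norm).pow 2
    simpa only [heval] using this

lemma upper (S : IsSzegoWeight a β v γ g u v₀) :
    SzegoUpper (jacobiMeasure a β v) (2 * π * Real.exp v₀)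
      (taylorCoeff fun z => Complex.exp (szegoLog a β u z)) := by
  intro J ε hε
  set D := taylorCoeff fun z => Complex.exp (szegoLog a β u z) with hD
  have hD0 : D 0 = 1 := by
    rw [hD, taylorCoeff_zero, szegoLog_zero S.u_zero, Complex.exp_zero]
  have hev1 : ∀ᶠ r : ℝ in 𝓝[<] 1, ∫ θ, ‖Complex.exp (szegoLog a β u (r * circExp 1 θ))‖ ^ 2
      ∂(jacobiMeasure a β v) < 2 * π * Real.exp v₀ + ε :=
    S.tendsto_integral_exp_szegoLog.eventually_lt_const (by linarith)
  have hev2 : ∀ᶠ r : ℝ in 𝓝[<] 1, ∀ j ∈ Finset.range (J + 1), ‖D j * (r : ℂ) ^ j - D j‖ < ε := by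
    rw [Filter.eventually_all_finset]
    intro j _
    have : Tendsto (fun r : ℝ => ‖D j * (r : ℂ) ^ j - D j‖) (𝓝[<] 1) (𝓝 0) := by
      have h : Continuous fun r : ℝ => ‖D j * (r : ℂ) ^ j - D j‖ := by fun_prop
      have := (h.tendsto 1).mono_left (nhdsWithin_le_nhds (s := Iio 1))
      simpa using this
    exact this.eventually_lt_const hε
  obtain ⟨r, ⟨hr1, hr2⟩, hr⟩ := ((hev1.and hev2).and (Ioo_mem_nhdsLT (zero_lt_one (α := ℝ)))).exists
  have hrn : ‖(r : ℂ)‖ = r := Complex.norm_of_nonneg hr.1.le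
  have hc : Summable fun j => ‖D j * (r : ℂ) ^ j‖ :=
    (hasSum_taylorCoeff S.exp_szegoLog_diff (by rw [hrn]; exact hr.2)).summable.norm
  have hlim := tendsto_wNorm_partialSum S.jacobi.contInt hc
  have hint : ∫ θ, ‖∑' j, D j * (r : ℂ) ^ j * circExp 1 θ ^ j‖ ^ 2 ∂(jacobiMeasure a β v) =
      ∫ θ, ‖Complex.exp (szegoLog a β u (r * circExp 1 θ))‖ ^ 2 ∂(jacobiMeasure a β v) := by
    refine integral_congr_ae (Eventually.of_forall fun θ => ?_)
    have hz : ‖(r : ℂ) * circExp 1 θ‖ < 1 := by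
      rw [norm_mul, norm_circExp, mul_one, hrn]; exact hr.2
    have := (hasSum_taylorCoeff S.exp_szegoLog_diff hz).tsum_eq
    simp only [mul_pow, ← mul_assoc] at this
    simp only [← this, hD]
  rw [hint] at hlim
  obtain ⟨N, hN, hNJ⟩ := ((hlim.eventually_lt_const hr1).and (eventually_gt_atTop J)).exists
  have hcoeff : ∀ j ≤ J, (∑ i ∈ Finset.range N, Polynomial.monomial i (D i * (r : ℂ) ^ i)).coeff j =
      D j * (r : ℂ) ^ j := fun j hj => by
    simp only [finsetSum_coeff, coeff_monomial, Finset.sum_ite_eq', Finset.mem_range]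
    rw [if_pos (by omega)]
  refine ⟨_, ?_, hN.le, fun j hj => ?_⟩
  · rw [hcoeff 0 (Nat.zero_le _), hD0]; simp
  · rw [hcoeff j hj]; exact (hr2 j (Finset.mem_range.2 (by omega))).le

end IsSzegoWeight

/-- The analytic function in the disc whose boundary values have real part half of the logarithm of
the smooth factor of the weight. -/
noncomputable def analyticPart (g : ℤ → ℂ) (z : ℂ) : ℂ := ∑' j : ℕ, g j / j * z ^ j

section AnalyticPart

variable {g : ℤ → ℂ}

lemma norm_analyticPart_term_le (g : ℤ → ℂ) (j : ℕ) {z : ℂ} (hz : ‖z‖ ≤ 1) :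
    ‖g j / j * z ^ j‖ ≤ ‖g j‖ := by
  rw [norm_mul, norm_div, norm_pow, Complex.norm_natCast]
  have h1 : ‖g j‖ / j ≤ ‖g j‖ := by
    rcases Nat.eq_zero_or_pos j with rfl | hj
    · simp
    · exact div_le_self (norm_nonneg _) (by exact_mod_cast hj)
  exact (mul_le_of_le_one_right (by positivity) (pow_le_one₀ (norm_nonneg _) hz)).trans h1

lemma summable_norm_natCast (hg : Summable fun j : ℤ => ‖g j‖) : Summable fun j : ℕ => ‖g j‖ :=
  hg.comp_injective Nat.cast_injective

lemma hasSum_analyticPart (hg : Summable fun j : ℤ => ‖g j‖) {z : ℂ} (hz : ‖z‖ ≤ 1) :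
    HasSum (fun j : ℕ => g j / j * z ^ j) (analyticPart g z) :=
  (Summable.of_norm_bounded (summable_norm_natCast hg) fun j =>
    norm_analyticPart_term_le g j hz).hasSum

lemma differentiableOn_analyticPart (hg : Summable fun j : ℤ => ‖g j‖) :
    DifferentiableOn ℂ (analyticPart g) (ball 0 1) :=
  Complex.differentiableOn_tsum_of_summable_norm (summable_norm_natCast hg)
    (fun j => by fun_prop) isOpen_ball fun j z hz =>
      norm_analyticPart_term_le g j (mem_ball_zero_iff.1 hz).le

lemma continuousOn_analyticPart (hg : Summable fun j : ℤ => ‖g j‖) :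
    ContinuousOn (analyticPart g) (closedBall 0 1) :=
  continuousOn_tsum (fun j => by fun_prop) (summable_norm_natCast hg) fun j z hz =>
      norm_analyticPart_term_le g j (mem_closedBall_zero_iff.1 hz)

lemma analyticPart_zero (g : ℤ → ℂ) : analyticPart g 0 = 0 := by
  have h : ∀ j : ℕ, g j / j * (0 : ℂ) ^ j = 0 := fun j => by
    rcases Nat.eq_zero_or_pos j with rfl | hj
    · simp
    · simp [hj.ne']
  simp [analyticPart, h]

lemma hasDerivAt_analyticPart_circExp (hg : Summable fun j : ℤ => ‖g j‖) (hg0 : g 0 = 0) (θ : ℝ) :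
    HasDerivAt (fun θ => analyticPart g (circExp 1 θ))
      (Complex.I * ∑' j : ℕ, g j * circExp j θ) θ := by
  have h := hasDerivAt_tsum (𝕜 := ℝ) (g := fun (j : ℕ) θ => g j / j * circExp j θ)
    (g' := fun j θ => Complex.I * (g j * circExp j θ)) (summable_norm_natCast hg)
    (fun j θ => by
      refine ((hasDerivAt_circExp j θ).const_mul (g j / j)).congr_deriv ?_
      rcases Nat.eq_zero_or_pos j with rfl | hj
      · simp [hg0]
      · have : (j : ℂ) ≠ 0 := by exact_mod_cast hj.ne'
        push_cast; field_simp)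
    (fun j θ => by simp [norm_circExp]) (y₀ := θ) (by
      have := (hasSum_analyticPart hg (norm_circExp 1 θ).le).summable
      simpa only [circExp_natCast] using this) θ
  rw [tsum_mul_left] at h
  simpa only [analyticPart, circExp_natCast] using h

lemma tsum_int_eq_two_re (hg : Summable fun j : ℤ => ‖g j‖) (hg0 : g 0 = 0)
    (hsym : ∀ j, g (-j) = -(starRingEnd ℂ) (g j)) (θ : ℝ) :
    Complex.I * ∑' j, g j * circExp j θ =
      ((2 * (Complex.I * ∑' j : ℕ, g j * circExp j θ).re : ℝ) : ℂ) := by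
  have h1 : HasSum (fun j : ℕ => g j * circExp j θ) (∑' j : ℕ, g j * circExp j θ) :=
    (Summable.of_norm_bounded (summable_norm_natCast hg) fun j => by simp [norm_circExp]).hasSum
  have h2 : HasSum (fun j : ℕ => g (-j) * circExp (-j) θ)
      (-(starRingEnd ℂ) (∑' j : ℕ, g j * circExp j θ)) := by
    have := ((Complex.hasSum_conj' (f := fun j : ℕ => g j * circExp j θ)).2 h1).neg
    refine this.congr_fun fun j => ?_
    rw [map_mul, circExp_conj, hsym]; ring
  have h3 := (HasSum.of_nat_of_neg (f := fun j : ℤ => g j * circExp j θ) h1 h2).tsum_eq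
  rw [h3]
  apply Complex.ext <;> simp [hg0]; ring

end AnalyticPart

namespace IsJacobi

variable {ι : Type*} [Fintype ι] {a : ι → ℂ} {β : ι → ℝ} {v γ : ℝ → ℝ} {g : ℤ → ℂ}

lemma exists_isSzegoWeight (H : IsJacobi a β v γ g) (hg0 : g 0 = 0)
    (hsym : ∀ j, g (-j) = -(starRingEnd ℂ) (g j)) :
    ∃ v₀, IsSzegoWeight a β v γ g (analyticPart g) v₀ := by
  have hg := H.summable_norm
  set L : ℝ → ℝ := fun θ => Real.log (v θ) - 2 * (analyticPart g (circExp 1 θ)).re with hL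
  have hd : ∀ θ, HasDerivAt L 0 θ := by
    intro θ
    have h1 := (H.v_deriv θ).log (H.v_pos θ).ne'
    have h2 := (Complex.reCLM.hasFDerivAt.comp_hasDerivAt θ
      (hasDerivAt_analyticPart_circExp hg hg0 θ)).const_mul 2
    refine (h1.sub h2).congr_deriv ?_
    have h3 := H.gamma_eq θ
    rw [tsum_int_eq_two_re hg hg0 hsym, Complex.ofReal_inj] at h3
    rw [mul_div_cancel_left₀ _ (H.v_pos θ).ne', h3]
    simp
  have hconst : ∀ θ, L θ = L 0 := fun θ =>
    is_const_of_deriv_eq_zero (fun θ => (hd θ).differentiableAt) (fun θ => (hd θ).deriv) θ 0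
  refine ⟨L 0, H, differentiableOn_analyticPart hg, continuousOn_analyticPart hg,
    analyticPart_zero g, fun θ => ?_⟩
  rw [← hconst θ, hL, sub_add_cancel, Real.exp_log (H.v_pos θ)]

end IsJacobi

namespace IsSzegoWeight

variable {ι : Type*} [Fintype ι] {a : ι → ℂ} {β : ι → ℝ} {v γ : ℝ → ℝ} {g : ℤ → ℂ} {u : ℂ → ℂ}
  {v₀ : ℝ}

lemma integral_log (S : IsSzegoWeight a β v γ g u v₀) :
    ∫ θ in (0 : ℝ)..(2 * π), Real.log (v θ) = 2 * π * v₀ := by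
  have h1 : DiffContOnCl ℂ u (ball 0 |1|) := by
    rw [abs_one]
    exact ⟨S.diff, by rw [closure_ball _ one_ne_zero]; exact S.cont⟩
  have h2 := h1.circleAverage
  rw [Real.circleAverage_def, S.u_zero, smul_eq_zero_iff_right (by positivity)] at h2
  have h3 : ∀ θ, circleMap 0 1 θ = circExp 1 θ := fun θ => by simp [circleMap, circExp_one]
  simp only [h3] at h2
  have hc : Continuous fun θ => u (circExp 1 θ) :=
    S.cont.comp_continuous (continuous_circExp 1) fun θ => by
      rw [mem_closedBall_zero_iff, norm_circExp]
  have h4 : ∫ θ in (0 : ℝ)..(2 * π), (u (circExp 1 θ)).re = 0 := by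
    have := Complex.reCLM.intervalIntegral_comp_comm (hc.intervalIntegrable (μ := volume) 0 (2 * π))
    simp only [Complex.reCLM_apply] at this
    rw [this, h2, Complex.zero_re]
  have h5 : Continuous fun θ => 2 * (u (circExp 1 θ)).re :=
    continuous_const.mul (Complex.continuous_re.comp hc)
  simp only [S.v_eq, Real.log_exp]
  rw [intervalIntegral.integral_add (continuous_const.intervalIntegrable _ _)
    (h5.intervalIntegrable _ _), intervalIntegral.integral_const_mul, h4]
  simp

lemma taylorCoeff_szegoLog (S : IsSzegoWeight a β v γ g (analyticPart g) v₀) (j : ℕ) :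
    taylorCoeff (szegoLog a β (analyticPart g)) j =
      -(g j / j) + ∑ k, β k * ((starRingEnd ℂ) (a k) ^ j / j) := by
  refine taylorCoeff_unique (c := fun j : ℕ =>
    -(g j / j) + ∑ k, β k * ((starRingEnd ℂ) (a k) ^ j / j)) one_pos S.szegoLog_diff
    (fun z hz => ?_) j
  have h1 := (hasSum_analyticPart S.jacobi.summable_norm hz.le).neg
  have h2 : HasSum (fun j : ℕ => ∑ k, β k * ((z * (starRingEnd ℂ) (a k)) ^ j / j))
      (∑ k, (β k : ℂ) * -Complex.log (1 - z * (starRingEnd ℂ) (a k))) :=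
    hasSum_sum fun k _ => (Complex.hasSum_taylorSeries_neg_log
      (norm_mul_conj_lt (S.jacobi.norm_a k) hz)).mul_left _
  have h3 := h1.add h2
  rw [show szegoLog a β (analyticPart g) z = -analyticPart g z +
    ∑ k, (β k : ℂ) * -Complex.log (1 - z * (starRingEnd ℂ) (a k)) by
      simp [szegoLog, sub_eq_add_neg]]
  refine h3.congr_fun fun j => ?_
  rw [add_mul, Finset.sum_mul]
  congr 1
  · ring
  · exact Finset.sum_congr rfl fun k _ => by rw [mul_pow]; ring

lemma szegoData (S : IsSzegoWeight a β v γ g (analyticPart g) v₀) (hg0 : g 0 = 0)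
    (hsym : ∀ j, g (-j) = -(starRingEnd ℂ) (g j)) {Cf : ι → (ℝ → ℂ) → ℂ}
    (hCf : IsPV (jacobiMeasure a β v) a β g Cf) {φ : ℕ → ℂ[X]} {κ : ℕ → ℝ}
    (hφ : IsOPUC (jacobiMeasure a β v) φ κ) :
    SzegoData (jacobiMeasure a β v) φ κ a β g Cf (2 * π * Real.exp v₀)
      (fun l => (starRingEnd ℂ) (l * taylorCoeff (szegoLog a β (analyticPart g)) l))
      (fun i => (starRingEnd ℂ)
        (taylorCoeff (fun z => Complex.exp (szegoLog a β (analyticPart g) z)) i)) where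
  opuc := hφ
  pv := hCf
  norm_a := S.jacobi.norm_a
  inj := S.jacobi.inj
  summable := S.jacobi.summable
  g_zero := hg0
  G_pos := by positivity
  lower := S.lower
  upper := by simpa using S.upper
  T_eq l := by
    have h : ((l + 1 : ℕ) : ℂ) ≠ 0 := by exact_mod_cast l.succ_ne_zero
    rw [S.taylorCoeff_szegoLog, hsym, mul_add, Finset.mul_sum]
    have h1 : ((l + 1 : ℕ) : ℂ) * -(g (l + 1 : ℕ) / (l + 1 : ℕ)) = -g (l + 1 : ℕ) := by
      field_simp
    have h2 : ∀ k, ((l + 1 : ℕ) : ℂ) * (β k * ((starRingEnd ℂ) (a k) ^ (l + 1) / (l + 1 : ℕ))) =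
        β k * (starRingEnd ℂ) (a k) ^ (l + 1) := fun k => by field_simp
    simp only [h1, h2, map_add, map_sum, map_mul, map_pow, map_neg, Complex.conj_conj,
      Complex.conj_ofReal]
    ring
  rec_d i := by
    have := congrArg (starRingEnd ℂ) (taylorCoeff_exp_rec S.szegoLog_diff i)
    rw [map_mul, map_natCast, map_sum] at this
    simpa only [map_mul] using this

end IsSzegoWeight

/-- The asymptotics of the leading coefficients for a generalized Jacobi weight with nonzero
exponents. -/
theorem IsJacobi.exists_kappa_bound {ι : Type*} [Fintype ι] {a : ι → ℂ} {β : ι → ℝ} {v γ : ℝ → ℝ}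
    {g : ℤ → ℂ} (H : IsJacobi a β v γ g) (hβ : ∀ k, β k ≠ 0) (hg0 : g 0 = 0)
    (hsym : ∀ j, g (-j) = -(starRingEnd ℂ) (g j)) {φ : ℕ → ℂ[X]} {κ : ℕ → ℝ}
    (hφ : IsOPUC (jacobiMeasure a β v) φ κ) {G : ℝ}
    (hG : G = 2 * π * Real.exp ((2 * π)⁻¹ * ∫ θ in (0 : ℝ)..(2 * π), Real.log (v θ))) :
    ∃ C > 0, ∃ N : ℕ, 1 ≤ N ∧ ∀ n : ℕ, N ≤ n →
      |G * κ n ^ 2 - 1 + (∑ k, β k ^ 2) / (n + 1)| ≤ C / (n : ℝ) ^ 2 := by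
  obtain ⟨v₀, S⟩ := H.exists_isSzegoWeight hg0 hsym
  obtain ⟨Cf, hCf⟩ := H.exists_isPV hβ
  have hG' : G = 2 * π * Real.exp v₀ := by
    rw [hG, S.integral_log, ← mul_assoc, inv_mul_cancel₀ (by positivity), one_mul]
  obtain ⟨C, hC, N, hN, h⟩ :=
    exists_bound_of_isBigO_invPow (S.szegoData hg0 hsym hCf hφ).kappa_isBigO
  refine ⟨C, hC, N, hN, fun n hn => ?_⟩
  have := h n hn
  rwa [Complex.norm_real, Real.norm_eq_abs, ← hG'] at this

/-- The open annulus of radii `ρ` and `1 / ρ`. -/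
def annulus (ρ : ℝ) : Set ℂ := {z : ℂ | ρ < ‖z‖ ∧ ‖z‖ < 1 / ρ}

lemma isOpen_annulus (ρ : ℝ) : IsOpen (annulus ρ) :=
  (isOpen_lt continuous_const continuous_norm).inter (isOpen_lt continuous_norm continuous_const)

/-- The Fourier coefficients of the restriction of a function to the unit circle. -/
noncomputable def circCoeff (h : ℂ → ℂ) (j : ℤ) : ℂ :=
  (2 * π : ℂ)⁻¹ * ∫ θ in (0 : ℝ)..(2 * π), circExp (-j) θ * h (circExp 1 θ)

lemma integral_circle_scale {f : ℂ → ℂ} {r R : ℝ} (hr : 0 < r) (hrR : r ≤ R)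
    (hf : DifferentiableOn ℂ f {z | r ≤ ‖z‖ ∧ ‖z‖ ≤ R}) :
    ∫ θ in (0 : ℝ)..(2 * π), f (r * circExp 1 θ) = ∫ θ in (0 : ℝ)..(2 * π), f (R * circExp 1 θ) := by
  have hmain := Complex.circleIntegral_sub_center_inv_smul_eq_of_differentiable_on_annulus_off_countable
    (c := 0) hr hrR (f := f) countable_empty
    (hf.continuousOn.mono fun z hz => by
      simpa [and_comm] using hz)
    (fun z hz => by
      have hz' : r < ‖z‖ ∧ ‖z‖ < R := by simpa [and_comm] using hz
      refine (hf.mono (fun x hx => ⟨hx.1.le, hx.2.le⟩)).differentiableAt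
        (((isOpen_lt continuous_const continuous_norm).inter
          (isOpen_lt continuous_norm continuous_const)).mem_nhds hz'))
  have hcalc : ∀ s : ℝ, 0 < s → (∮ z in C(0, s), (z - 0)⁻¹ • f z) =
      Complex.I * ∫ θ in (0 : ℝ)..(2 * π), f (s * circExp 1 θ) := by
    intro s hs
    rw [circleIntegral, ← intervalIntegral.integral_const_mul]
    refine intervalIntegral.integral_congr fun θ _ => ?_
    have h1 : circleMap 0 s θ = s * circExp 1 θ := by simp [circleMap, circExp_one]
    have h2 : (s : ℂ) * circExp 1 θ ≠ 0 :=
      mul_ne_zero (by exact_mod_cast hs.ne') (circExp_ne_zero _ _)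
    simp only [deriv_circleMap, h1, sub_zero, smul_eq_mul]
    field_simp
    rw [mul_div_cancel_left₀ _ h2]
  rw [hcalc r hr, hcalc R (hr.trans_le hrR)] at hmain
  exact (mul_left_cancel₀ Complex.I_ne_zero hmain).symm

section Laurent

variable {ρ : ℝ} {h : ℂ → ℂ}

lemma mem_annulus_circle (hρ1 : ρ < 1) (hρ0 : 0 < ρ) (θ : ℝ) : circExp 1 θ ∈ annulus ρ := by
  simp only [annulus, mem_ofPred_eq, norm_circExp]
  exact ⟨hρ1, (one_lt_div hρ0).2 hρ1⟩

lemma circCoeff_eq_scale (hρ0 : 0 < ρ) (hρ1 : ρ < 1) (hh : DifferentiableOn ℂ h (annulus ρ)) {R : ℝ}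
    (hR : ρ < R) (hR' : R < 1 / ρ) (j : ℤ) :
    circCoeff h j = (2 * π : ℂ)⁻¹ *
      ∫ θ in (0 : ℝ)..(2 * π), (R : ℂ) ^ (-j) * (circExp (-j) θ * h (R * circExp 1 θ)) := by
  have hR0 : 0 < R := hρ0.trans hR
  have h1 : (1 : ℝ) < 1 / ρ := (one_lt_div hρ0).2 hρ1
  have hz : ∀ z ∈ annulus ρ, z ≠ 0 := fun z hz => norm_pos_iff.1 (hρ0.trans hz.1)
  have hf : DifferentiableOn ℂ (fun z => z ^ (-j) * h z) (annulus ρ) := fun z hz' =>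
    (differentiableAt_zpow.2 (Or.inl (hz z hz'))).differentiableWithinAt.mul (hh z hz')
  have hexp : ∀ θ, circExp 1 θ ^ (-j) = circExp (-j) θ := fun θ => by
    simp only [circExp, ← Complex.exp_int_mul]; congr 1; push_cast; ring
  have hval : ∀ s : ℝ, ∫ θ in (0 : ℝ)..(2 * π), (s * circExp 1 θ) ^ (-j) * h (s * circExp 1 θ) =
      ∫ θ in (0 : ℝ)..(2 * π), (s : ℂ) ^ (-j) * (circExp (-j) θ * h (s * circExp 1 θ)) := fun s => by
    simp only [mul_zpow, hexp, mul_assoc]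
  have hone := hval 1
  simp only [Complex.ofReal_one, one_mul, one_zpow] at hone
  rw [circCoeff, ← hone, ← hval]
  congr 1
  rcases le_total 1 R with h2 | h2
  · have := integral_circle_scale (f := fun z => z ^ (-j) * h z) one_pos h2
      (hf.mono fun z hz => ⟨hρ1.trans_le hz.1, hz.2.trans_lt hR'⟩)
    simpa using this
  · have := integral_circle_scale (f := fun z => z ^ (-j) * h z) hR0 h2
      (hf.mono fun z hz => ⟨hR.trans_le hz.1, hz.2.trans_lt h1⟩)
    simpa using this.symm

lemma exists_norm_circCoeff_le_zpow (hρ0 : 0 < ρ) (hρ1 : ρ < 1) (hh : DifferentiableOn ℂ h (annulus ρ))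
    {R : ℝ} (hR : ρ < R) (hR' : R < 1 / ρ) : ∃ M, ∀ j, ‖circCoeff h j‖ ≤ M * R ^ (-j) := by
  have hR0 : 0 < R := hρ0.trans hR
  have hc : Continuous fun θ => h (R * circExp 1 θ) :=
    hh.continuousOn.comp_continuous (continuous_const.mul (continuous_circExp 1)) fun θ => by
      simp only [annulus, mem_ofPred_eq, norm_mul, norm_circExp, mul_one, Complex.norm_of_nonneg hR0.le]
      exact ⟨hR, hR'⟩
  refine ⟨(2 * π)⁻¹ * ∫ θ in (0 : ℝ)..(2 * π), ‖h (R * circExp 1 θ)‖, fun j => ?_⟩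
  rw [circCoeff_eq_scale hρ0 hρ1 hh hR hR', intervalIntegral.integral_const_mul, norm_mul, norm_mul,
    norm_zpow, Complex.norm_of_nonneg hR0.le]
  have h1 : ‖(2 * π : ℂ)⁻¹‖ = (2 * π)⁻¹ := by
    rw [norm_inv, norm_mul, Complex.norm_ofNat, Complex.norm_of_nonneg Real.pi_pos.le]
  have h2 : ‖∫ θ in (0 : ℝ)..(2 * π), circExp (-j) θ * h (R * circExp 1 θ)‖ ≤
      ∫ θ in (0 : ℝ)..(2 * π), ‖h (R * circExp 1 θ)‖ := by
    refine (intervalIntegral.norm_integral_le_integral_norm (by positivity)).trans_eq ?_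
    simp only [norm_mul, norm_circExp, one_mul]
  rw [h1, mul_assoc, mul_comm _ (R ^ (-j))]
  gcongr

lemma summable_circCoeff (hρ0 : 0 < ρ) (hρ1 : ρ < 1) (hh : DifferentiableOn ℂ h (annulus ρ)) :
    Summable fun j : ℤ => ‖circCoeff h j‖ * (1 + |(j : ℝ)|) := by
  obtain ⟨r, hr, hr1⟩ := exists_between hρ1
  have hr0 : 0 < r := hρ0.trans hr
  have h1 : 1 < 1 / ρ := (one_lt_div hρ0).2 hρ1
  obtain ⟨M₁, hM₁⟩ := exists_norm_circCoeff_le_zpow hρ0 hρ1 hh hr (hr1.trans h1)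
  obtain ⟨M₂, hM₂⟩ := exists_norm_circCoeff_le_zpow hρ0 hρ1 hh (R := r⁻¹)
    (hρ1.trans ((one_lt_inv₀ hr0).2 hr1)) (by rw [one_div]; exact inv_strictAnti₀ hρ0 hr)
  have hgeom : ∀ M : ℝ, Summable fun n : ℕ => M * r ^ n * (1 + (n : ℝ)) := fun M => by
    have e1 := summable_geometric_of_lt_one hr0.le hr1
    have e2 := summable_pow_mul_geometric_of_norm_lt_one 1 (r := r)
      (by rwa [Real.norm_of_nonneg hr0.le])
    refine ((e1.add e2).mul_left M).congr fun n => ?_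
    ring
  refine Summable.of_nat_of_neg ?_ ?_
  · refine (hgeom M₂).of_nonneg_of_le (fun _ => by positivity) fun n => ?_
    have := hM₂ n
    rw [zpow_neg, inv_zpow, inv_inv, zpow_natCast] at this
    simp only [Int.cast_natCast, Nat.abs_cast]
    gcongr
  · refine (hgeom M₁).of_nonneg_of_le (fun _ => by positivity) fun n => ?_
    have := hM₁ (-n)
    rw [neg_neg, zpow_natCast] at this
    simp only [Int.cast_neg, abs_neg, Int.cast_natCast, Nat.abs_cast]
    gcongr

lemma tsum_circCoeff (hc : ContinuousOn h (sphere 0 1))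
    (hs : Summable fun j : ℤ => ‖circCoeff h j‖) (θ : ℝ) :
    h (circExp 1 θ) = ∑' j, circCoeff h j * circExp j θ := by
  have : Fact (0 < 2 * π) := ⟨Real.two_pi_pos⟩
  let F : C(AddCircle (2 * π), ℂ) := ⟨fun x => h (AddCircle.toCircle x : ℂ),
    hc.comp_continuous (continuous_induced_dom.comp AddCircle.continuous_toCircle) fun x => by
      rw [mem_sphere_zero_iff_norm]; exact Circle.norm_coe _⟩
  have hF : ∀ θ : ℝ, F (θ : AddCircle (2 * π)) = h (circExp 1 θ) := fun θ => by
    have h1 : (2 * π / (2 * π) * θ : ℝ) = θ := by field_simp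
    simp only [F, ContinuousMap.coe_mk, AddCircle.toCircle_apply_mk, h1, Circle.coe_exp, circExp_one]
  have hfour : ∀ (n : ℤ) (θ : ℝ), fourier n (θ : AddCircle (2 * π)) = circExp n θ := fun n θ => by
    have h2 : (π : ℂ) ≠ 0 := by exact_mod_cast Real.pi_ne_zero
    rw [fourier_coe_apply, circExp]
    congr 1
    push_cast; field_simp
  have hcoeff : ∀ j, fourierCoeff F j = circCoeff h j := fun j => by
    rw [fourierCoeff_eq_intervalIntegral _ _ 0, circCoeff, zero_add]
    simp only [hF, hfour, smul_eq_mul, Complex.real_smul]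
    push_cast; rw [one_div]
  have hsum : Summable (fourierCoeff F) := by
    rw [funext hcoeff]; exact hs.of_norm
  have := has_pointwise_sum_fourier_series_of_summable hsum (θ : AddCircle (2 * π))
  simp only [hcoeff, hfour, hF, smul_eq_mul] at this
  exact this.tsum_eq.symm

end Laurent

section AnalyticWeight

variable {ρ : ℝ} {w : ℂ → ℂ}

/-- The function `z w'(z) / w(z)`. -/
noncomputable def eulerLogDeriv (w : ℂ → ℂ) (z : ℂ) : ℂ := z * deriv w z / w z

lemma differentiableOn_eulerLogDeriv (hw : AnalyticOn ℂ w (annulus ρ))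
    (hne : ∀ z ∈ annulus ρ, w z ≠ 0) : DifferentiableOn ℂ (eulerLogDeriv w) (annulus ρ) :=
  (differentiableOn_id.mul (hw.differentiableOn.deriv (isOpen_annulus ρ))).div
    hw.differentiableOn hne

lemma hasDerivAt_comp_circExp (hρ0 : 0 < ρ) (hρ1 : ρ < 1) (hw : AnalyticOn ℂ w (annulus ρ))
    (hne : ∀ z ∈ annulus ρ, w z ≠ 0) (θ : ℝ) :
    HasDerivAt (fun θ => w (circExp 1 θ))
      (w (circExp 1 θ) * (Complex.I * eulerLogDeriv w (circExp 1 θ))) θ := by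
  have hmem := mem_annulus_circle hρ1 hρ0 θ
  have h1 : HasDerivAt w (deriv w (circExp 1 θ)) (circExp 1 θ) :=
    (hw.differentiableOn.differentiableAt ((isOpen_annulus ρ).mem_nhds hmem)).hasDerivAt
  refine (h1.comp θ (hasDerivAt_circExp 1 θ)).congr_deriv ?_
  have := hne _ hmem
  rw [eulerLogDeriv]; push_cast; field_simp

lemma eulerLogDeriv_circExp (hρ0 : 0 < ρ) (hρ1 : ρ < 1) (hw : AnalyticOn ℂ w (annulus ρ))
    (hne : ∀ z ∈ annulus ρ, w z ≠ 0) (hpos : ∀ z : ℂ, ‖z‖ = 1 → 0 < (w z).re ∧ (w z).im = 0) (θ : ℝ) :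
    (((Complex.I * eulerLogDeriv w (circExp 1 θ)).re : ℝ) : ℂ) =
      Complex.I * eulerLogDeriv w (circExp 1 θ) := by
  have h1 := Complex.imCLM.hasFDerivAt.comp_hasDerivAt θ (hasDerivAt_comp_circExp hρ0 hρ1 hw hne θ)
  have h2 : (⇑Complex.imCLM ∘ fun θ => w (circExp 1 θ)) = fun _ => 0 := by
    ext t; exact (hpos _ (norm_circExp 1 t)).2
  rw [h2] at h1
  have h3 := h1.unique (hasDerivAt_const θ (0 : ℝ))
  have h4 := hpos _ (norm_circExp 1 θ)
  rw [Complex.imCLM_apply, Complex.mul_im, h4.2, zero_mul, add_zero] at h3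
  have h5 := (mul_eq_zero.1 h3).resolve_left h4.1.ne'
  exact Complex.ext rfl (by rw [Complex.ofReal_im, h5])

lemma isJacobi_of_analyticOn {ι : Type*} [Fintype ι] {a : ι → ℂ} {β : ι → ℝ} (hρ0 : 0 < ρ)
    (hρ1 : ρ < 1) (hw : AnalyticOn ℂ w (annulus ρ)) (hne : ∀ z ∈ annulus ρ, w z ≠ 0)
    (hpos : ∀ z : ℂ, ‖z‖ = 1 → 0 < (w z).re ∧ (w z).im = 0) (ha : ∀ k, ‖a k‖ = 1)
    (hinj : Function.Injective a) (hβ : ∀ k, -(1 / 2) < β k) :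
    IsJacobi a β (fun θ => (w (circExp 1 θ)).re)
      (fun θ => (Complex.I * eulerLogDeriv w (circExp 1 θ)).re) (circCoeff (eulerLogDeriv w)) where
  norm_a := ha
  inj := hinj
  beta_lt := hβ
  v_pos θ := (hpos _ (norm_circExp 1 θ)).1
  v_periodic θ := by simp only [circExp_periodic 1 θ]
  v_deriv θ := by
    refine (Complex.reCLM.hasFDerivAt.comp_hasDerivAt θ
      (hasDerivAt_comp_circExp hρ0 hρ1 hw hne θ)).congr_deriv ?_
    rw [Complex.reCLM_apply, Complex.mul_re, (hpos _ (norm_circExp 1 θ)).2, zero_mul, sub_zero]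
  summable := summable_circCoeff hρ0 hρ1 (differentiableOn_eulerLogDeriv hw hne)
  gamma_eq θ := by
    have hd := differentiableOn_eulerLogDeriv hw hne
    have hs : Summable fun j : ℤ => ‖circCoeff (eulerLogDeriv w) j‖ :=
      (summable_circCoeff hρ0 hρ1 hd).of_nonneg_of_le (fun _ => norm_nonneg _) fun j =>
        le_mul_of_one_le_right (norm_nonneg _) (by linarith [abs_nonneg (j : ℝ)])
    rw [eulerLogDeriv_circExp hρ0 hρ1 hw hne hpos, ← tsum_circCoeff (hd.continuousOn.mono fun z hz => by
      rw [mem_sphere_zero_iff_norm] at hz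
      exact ⟨by rw [hz]; exact hρ1, by rw [hz]; exact (one_lt_div hρ0).2 hρ1⟩) hs]

lemma circCoeff_eulerLogDeriv_neg (hρ0 : 0 < ρ) (hρ1 : ρ < 1) (hw : AnalyticOn ℂ w (annulus ρ))
    (hne : ∀ z ∈ annulus ρ, w z ≠ 0) (hpos : ∀ z : ℂ, ‖z‖ = 1 → 0 < (w z).re ∧ (w z).im = 0) (j : ℤ) :
    circCoeff (eulerLogDeriv w) (-j) = -(starRingEnd ℂ) (circCoeff (eulerLogDeriv w) j) := by
  have h1 : ∀ θ, (starRingEnd ℂ) (eulerLogDeriv w (circExp 1 θ)) = -eulerLogDeriv w (circExp 1 θ) := by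
    intro θ
    have := congrArg (starRingEnd ℂ) (eulerLogDeriv_circExp hρ0 hρ1 hw hne hpos θ)
    rw [Complex.conj_ofReal, eulerLogDeriv_circExp hρ0 hρ1 hw hne hpos θ, map_mul, Complex.conj_I] at this
    have h := mul_left_cancel₀ Complex.I_ne_zero (this.trans (neg_mul_comm _ _))
    exact (neg_eq_iff_eq_neg.2 h).symm
  have h2 : (starRingEnd ℂ) (∫ θ in (0 : ℝ)..(2 * π), circExp (-j) θ * eulerLogDeriv w (circExp 1 θ)) =
      -∫ θ in (0 : ℝ)..(2 * π), circExp (- -j) θ * eulerLogDeriv w (circExp 1 θ) := by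
    rw [intervalIntegral.integral_of_le (by positivity), intervalIntegral.integral_of_le (by positivity),
      ← integral_conj, ← integral_neg]
    simp only [map_mul, h1, circExp_conj, mul_neg]
  rw [circCoeff, circCoeff, map_mul, h2]
  simp only [map_inv₀, map_mul, Complex.conj_ofReal, Complex.conj_ofNat]
  ring

lemma circCoeff_eulerLogDeriv_zero (hρ0 : 0 < ρ) (hρ1 : ρ < 1) (hw : AnalyticOn ℂ w (annulus ρ))
    (hne : ∀ z ∈ annulus ρ, w z ≠ 0) (hpos : ∀ z : ℂ, ‖z‖ = 1 → 0 < (w z).re ∧ (w z).im = 0) :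
    circCoeff (eulerLogDeriv w) 0 = 0 := by
  have H := isJacobi_of_analyticOn (a := Empty.elim) (β := Empty.elim) hρ0 hρ1 hw hne hpos
    (fun k => k.elim) (fun k => k.elim) (fun k => k.elim)
  have h1 := intervalIntegral.integral_eq_sub_of_hasDerivAt (a := 0) (b := 2 * π)
    (fun θ _ => (H.v_deriv θ).log (H.v_pos θ).ne')
    (by
      refine Continuous.intervalIntegrable ?_ _ _
      exact (H.v_continuous.mul H.gamma_continuous).div H.v_continuous fun θ => (H.v_pos θ).ne')
  have h2 : circExp 1 (2 * π) = circExp 1 0 := by simpa using circExp_periodic 1 0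
  rw [h2, sub_self] at h1
  have h3 : (∫ θ in (0 : ℝ)..(2 * π), Complex.I * eulerLogDeriv w (circExp 1 θ)) = 0 := by
    refine Eq.trans ?_ ((congrArg Complex.ofReal h1).trans Complex.ofReal_zero)
    rw [← intervalIntegral.integral_ofReal]
    refine intervalIntegral.integral_congr fun θ _ => ?_
    rw [mul_div_cancel_left₀ _ (H.v_pos θ).ne', eulerLogDeriv_circExp hρ0 hρ1 hw hne hpos]
  rw [intervalIntegral.integral_const_mul] at h3
  rw [circCoeff, neg_zero]
  simp only [circExp_zero, one_mul]
  rw [(mul_eq_zero.1 h3).resolve_left Complex.I_ne_zero, mul_zero]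

end AnalyticWeight

lemma isOPUC_jacobiMeasure {ι : Type*} [Fintype ι] {a : ι → ℂ} {β : ι → ℝ} {v γ : ℝ → ℝ} {g : ℤ → ℂ}
    (H : IsJacobi a β v γ g) {φ : ℕ → ℂ[X]} {κ : ℕ → ℝ} (hpos : ∀ n, 0 < κ n)
    (hdeg : ∀ n, (φ n).natDegree = n) (hlead : ∀ n, (φ n).leadingCoeff = (κ n : ℂ))
    (horth : ∀ n j : ℕ, (∫ θ in (0 : ℝ)..(2 * π), (φ n).eval (circExp 1 θ) *
      (starRingEnd ℂ) ((φ j).eval (circExp 1 θ)) * (jacobiDensity a β v θ : ℂ)) =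
        if n = j then 1 else 0) :
    IsOPUC (jacobiMeasure a β v) φ κ where
  contInt := H.contInt
  pos := hpos
  deg := hdeg
  lead n := by rw [← hlead n, leadingCoeff, hdeg n]
  orth n j := by
    rw [wInner, H.integral_eq, ← horth n j]
    refine intervalIntegral.integral_congr fun θ _ => ?_
    simp only [onCirc, Complex.real_smul]
    ring

theorem stmt6
    (ρ : ℝ) (hρ0 : 0 < ρ) (hρ1 : ρ < 1)
    (m : ℕ) (hm : 0 < m)
    (a : Fin m → ℂ) (ha : ∀ k, ‖a k‖ = 1) (ha' : Function.Injective a)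
    (β : Fin m → ℝ) (hβ : ∀ k, -(1/2 : ℝ) < β k)
    (w : ℂ → ℂ)
    (hw_an : AnalyticOn ℂ w {z : ℂ | ρ < ‖z‖ ∧ ‖z‖ < 1/ρ})
    (hw_ne : ∀ z : ℂ, ρ < ‖z‖ → ‖z‖ < 1/ρ → w z ≠ 0)
    (hw_pos : ∀ z : ℂ, ‖z‖ = 1 → 0 < (w z).re ∧ (w z).im = 0)
    (W : ℂ → ℝ)
    (hW : ∀ z : ℂ, ‖z‖ = 1 → W z = (w z).re * ∏ k, ‖z - a k‖ ^ (2 * β k))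
    (κ : ℕ → ℝ) (hκpos : ∀ n, 0 < κ n)
    (φp : ℕ → Polynomial ℂ)
    (hφdeg : ∀ n, (φp n).natDegree = n)
    (hφlead : ∀ n, (φp n).leadingCoeff = (κ n : ℂ))
    (hφorth : ∀ n j : ℕ,
      (∫ θ in (0:ℝ)..(2 * π),
        (φp n).eval (Complex.exp (θ * Complex.I)) *
          (starRingEnd ℂ) ((φp j).eval (Complex.exp (θ * Complex.I))) *
          (W (Complex.exp (θ * Complex.I)) : ℂ)) = (if n = j then 1 else 0))
    (G : ℝ)
    (hG : G = Real.exp ((2 * π)⁻¹ *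
      ∫ θ in (0:ℝ)..(2 * π), Real.log (2 * π * (w (Complex.exp (θ * Complex.I))).re))) :
    ∃ C : ℝ, 0 < C ∧ ∃ N : ℕ, 1 ≤ N ∧ ∃ E : ℕ → ℝ,
      (∀ n : ℕ, N ≤ n → |E n| ≤ C / (n : ℝ) ^ 2) ∧
      (∀ n : ℕ, N ≤ n →
        κ (n - 1) ^ 2 = G⁻¹ * (1 - ((n : ℝ))⁻¹ * (∑ k, β k ^ 2) + E n)) := by
  have hw_an' : AnalyticOn ℂ w (annulus ρ) := hw_an
  have hne : ∀ z ∈ annulus ρ, w z ≠ 0 := fun z hz => hw_ne z hz.1 hz.2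
  let b : {k : Fin m // β k ≠ 0} → ℂ := fun k => a k
  let η : {k : Fin m // β k ≠ 0} → ℝ := fun k => β k
  have H := isJacobi_of_analyticOn (a := b) (β := η) hρ0 hρ1 hw_an' hne hw_pos (fun k => ha k)
    (ha'.comp Subtype.val_injective) (fun k => hβ k)
  have hsupp : ∀ f : Fin m → ℝ, (∀ k, β k = 0 → f k = 1) →
      ∏ k, f k = ∏ k : {k : Fin m // β k ≠ 0}, f k := fun f hf => by
    classical
    rw [← Finset.prod_subtype (Finset.univ.filter fun k => β k ≠ 0) (by simp)]
    exact (Finset.prod_filter_of_ne fun k _ hk => mt (hf k) hk).symm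
  have hsum : ∑ k, β k ^ 2 = ∑ k, η k ^ 2 := by
    classical
    rw [← Finset.sum_subtype (Finset.univ.filter fun k => β k ≠ 0) (by simp) (fun k => β k ^ 2)]
    exact (Finset.sum_filter_of_ne fun k _ hk => mt (fun h => by rw [h]; norm_num) hk).symm
  have hdens : ∀ θ, W (circExp 1 θ) = jacobiDensity b η (fun θ => (w (circExp 1 θ)).re) θ := fun θ => by
    rw [hW _ (norm_circExp 1 θ), jacobiDensity, hsupp _ fun k hk => by rw [hk]; simp]
  simp only [← circExp_one] at hφorth hG
  have hφ := isOPUC_jacobiMeasure H hκpos hφdeg hφlead fun n j => by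
    simpa only [hdens] using hφorth n j
  have hlog : Continuous fun θ => Real.log (w (circExp 1 θ)).re :=
    H.v_continuous.log fun θ => (H.v_pos θ).ne'
  have hG' : G = 2 * π * Real.exp ((2 * π)⁻¹ *
      ∫ θ in (0 : ℝ)..(2 * π), Real.log (w (circExp 1 θ)).re) := by
    rw [hG, intervalIntegral.integral_congr
      (g := fun θ => Real.log (2 * π) + Real.log (w (circExp 1 θ)).re)
      fun θ _ => Real.log_mul (by positivity) (H.v_pos θ).ne']
    rw [intervalIntegral.integral_add (continuous_const.intervalIntegrable _ _)
      (hlog.intervalIntegrable _ _), intervalIntegral.integral_const, sub_zero, smul_eq_mul, mul_add,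
      ← mul_assoc, inv_mul_cancel₀ (by positivity), one_mul, Real.exp_add,
      Real.exp_log (by positivity)]
  obtain ⟨C, hC, N, hN, h⟩ := H.exists_kappa_bound (fun k => k.2)
    (circCoeff_eulerLogDeriv_zero hρ0 hρ1 hw_an' hne hw_pos)
    (circCoeff_eulerLogDeriv_neg hρ0 hρ1 hw_an' hne hw_pos) hφ hG'
  have hG0 : 0 < G := by rw [hG]; positivity
  refine ⟨4 * C, by positivity, N + 1, by omega,
    fun n => G * κ (n - 1) ^ 2 - 1 + (n : ℝ)⁻¹ * ∑ k, β k ^ 2, fun n hn => ?_, fun n _ => ?_⟩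
  · obtain ⟨l, rfl⟩ : ∃ l, n = l + 1 := ⟨n - 1, by omega⟩
    have h1 := h l (by omega)
    have hl : (1 : ℝ) ≤ l := by exact_mod_cast (by omega : 1 ≤ l)
    rw [← hsum] at h1
    have h2 : C / (l : ℝ) ^ 2 ≤ 4 * C / ((l + 1 : ℕ) : ℝ) ^ 2 := by
      rw [div_le_div_iff₀ (by positivity) (by positivity)]
      push_cast
      nlinarith [mul_le_mul_of_nonneg_left (show ((l : ℝ) + 1) ^ 2 ≤ 4 * (l : ℝ) ^ 2 by nlinarith) hC.le]
    refine le_trans (le_of_eq ?_) (h1.trans h2)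
    beta_reduce
    rw [Nat.add_sub_cancel]
    push_cast
    rw [inv_mul_eq_div]
  · field_simp
    ring
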